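/- arXiv:2212.07830 — 13 statements merged into one kernel-verified Lean document; each statement's English description precedes it below -/
import Mathlib

section
/- Let G be a countably infinite discrete group. Then every right thickly syndetic subset of G contains an m-set. -/
/-- `S` is right syndetic in `G`: there is a finite set `F ⊆ G` with `G = F * S`. -/
def RightSyndetic {G : Type*} [Group G] (S : Set G) : Prop :=
  ∃ F : Finset G, ∀ g : G, ∃ f ∈ F, f⁻¹ * g ∈ S

/-- `S` is right thickly syndetic: for every finite `A ⊆ G` there is a right syndetic
set `Q` with `A * Q ⊆ S`. -/
def RightThicklySyndetic {G : Type*} [Group G] (S : Set G) : Prop :=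
  ∀ A : Finset G, ∃ Q : Set G, RightSyndetic Q ∧ ∀ a ∈ A, ∀ q ∈ Q, a * q ∈ S

/-- A `G`-system: a compact metrizable space with a continuous action of the
(discrete) group `G` by homeomorphisms. -/
structure GSys (G : Type) [Group G] : Type 1 where
  carrier : Type
  [ts : TopologicalSpace carrier]
  [cs : CompactSpace carrier]
  [ms : TopologicalSpace.MetrizableSpace carrier]
  [ma : MulAction G carrier]
  [cts : ContinuousConstSMul G carrier]

attribute [instance] GSys.ts GSys.cs GSys.ms GSys.ma GSys.cts

/-- A `G`-system is minimal if every orbit is dense. -/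
def GSys.Minimal {G : Type} [Group G] (Y : GSys G) : Prop :=
  ∀ y : Y.carrier, Dense (MulAction.orbit G y)

/-- `A ⊆ G` is an m-set: there are a minimal `G`-system `(Y,G)`, a point `y ∈ Y` and a
nonempty open set `U ⊆ Y` such that `N_G(y,U) = {g : g • y ∈ U} ⊆ A`. -/
def IsMSet (G : Type) [Group G] (A : Set G) : Prop :=
  ∃ Y : GSys G, Y.Minimal ∧ ∃ (y : Y.carrier) (U : Set Y.carrier),
    IsOpen U ∧ U.Nonempty ∧ {g : G | g • y ∈ U} ⊆ A

open scoped Pointwise Classical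

/-- right-shift action on configurations -/
def shf {G : Type} [Group G] (h : G) (z : G → Bool) : G → Bool := fun g => z (g * h)

def VSep {G : Type} [Group G] (V : Finset G) (C : Set G) : Prop :=
  ∀ c ∈ C, ∀ c' ∈ C, c ≠ c' → c * c'⁻¹ ∉ V

lemma exists_max_sep {G : Type} [Group G] (V : Finset G) (h1 : (1 : G) ∈ V)
    (hV : ∀ v ∈ V, v⁻¹ ∈ V) (N A : Set G) (hN : VSep V N) :
    ∃ C : Set G, N ⊆ C ∧ C ⊆ N ∪ A ∧ VSep V C ∧ ∀ g ∈ A, ∃ c ∈ C, g * c⁻¹ ∈ V := by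
  obtain ⟨C, hNC, hC⟩ := zorn_subset_nonempty {C : Set G | C ⊆ N ∪ A ∧ VSep V C} (by
    intro c hc hch hne
    refine ⟨⋃₀ c, ⟨Set.sUnion_subset fun s hs => (hc hs).1, ?_⟩, fun s hs => Set.subset_sUnion_of_mem hs⟩
    rintro a ⟨s, hs, has⟩ b ⟨t, ht, hbt⟩ hab
    rcases hch.total hs ht with h | h
    · exact (hc ht).2 a (h has) b hbt hab
    · exact (hc hs).2 a has b (h hbt) hab) N ⟨Set.subset_union_left, hN⟩
  refine ⟨C, hNC, hC.prop.1, hC.prop.2, ?_⟩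
  intro g hg
  by_contra hcon
  push Not at hcon
  have hmem : insert g C ∈ {C : Set G | C ⊆ N ∪ A ∧ VSep V C} := by
    refine ⟨Set.insert_subset (Or.inr hg) hC.prop.1, ?_⟩
    rintro a (rfl | ha) b (rfl | hb) hab
    · exact absurd rfl hab
    · exact hcon b hb
    · intro h
      apply hcon a ha
      have := hV _ h
      simpa using this
    · exact hC.prop.2 a ha b hb hab
  have := hC.le_of_ge hmem (Set.subset_insert g C) (Set.mem_insert g C)
  exact hcon g this (by simpa using h1)

structure Good {G : Type} [Group G] (T : Set G) (X : Set (G → Bool)) : Prop where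
  closed : IsClosed X
  inv : ∀ h : G, ∀ z ∈ X, shf h z ∈ X
  irr : ∃ D : Finset G, ∀ (ι : Type) (S : ι → Set G) (u : ι → G → Bool), (∀ i, u i ∈ X) →
    (∀ i j, i ≠ j → ∀ s ∈ S i, ∀ t ∈ S j, s * t⁻¹ ∉ D) →
    ∃ z ∈ X, ∀ i, ∀ s ∈ S i, z s = u i s
  compat : ∃ x ∈ X, ∀ g, x g = true → g ∈ T

lemma good_univ {G : Type} [Group G] (T : Set G) : Good T Set.univ where
  closed := isClosed_univ
  inv := fun _ _ _ => trivial
  compat := ⟨fun _ => false, trivial, by simp⟩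
  irr := by
    refine ⟨{1}, fun ι S u _ hS => ?_⟩
    refine ⟨fun g => if h : ∃ i, g ∈ S i then u h.choose g else false, trivial, ?_⟩
    intro i s hs
    have h : ∃ i, s ∈ S i := ⟨i, hs⟩
    simp only [dif_pos h]
    have : h.choose = i := by
      by_contra hne
      exact hS _ _ hne s h.choose_spec s hs (by simp)
    rw [this]

/-- the next subshift -/
def nxt {G : Type} [Group G] (X : Set (G → Bool)) (K V V' : Finset G) (p : G → Bool) :
    Set (G → Bool) :=
  {z | z ∈ X ∧ ∃ C : Set G, VSep V C ∧ (∀ g, ∃ c ∈ C, g * c⁻¹ ∈ V') ∧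
    ∀ c ∈ C, ∀ k ∈ K, z (k * c) = p k}

lemma nxt_closed {G : Type} [Group G] (X : Set (G → Bool)) (K V V' : Finset G) (p : G → Bool)
    (hX : IsClosed X) : IsClosed (nxt X K V V' p) := by
  have hcl : IsClosed {w : (G → Bool) × (G → Bool) | w.1 ∈ X ∧
      (∀ c c', c ≠ c' → c * c'⁻¹ ∈ V → ¬ (w.2 c = true ∧ w.2 c' = true)) ∧
      (∀ g, ∃ v ∈ V', w.2 (v⁻¹ * g) = true) ∧
      (∀ c, ∀ k ∈ K, w.2 c = true → w.1 (k * c) = p k)} := by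
    have hc1 : ∀ g : G, Continuous fun w : (G → Bool) × (G → Bool) => w.1 g := fun g => by fun_prop
    have hc2 : ∀ g : G, Continuous fun w : (G → Bool) × (G → Bool) => w.2 g := fun g => by fun_prop
    simp only [Set.ofPred_and]
    refine IsClosed.inter (hX.preimage continuous_fst) (IsClosed.inter ?_ (IsClosed.inter ?_ ?_))
    · simp only [Set.ofPred_forall]
      refine isClosed_iInter fun c => isClosed_iInter fun c' => isClosed_iInter fun _ =>
        isClosed_iInter fun _ => ?_
      exact (isClosed_discrete {b : Bool × Bool | ¬ (b.1 = true ∧ b.2 = true)}).preimage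
        ((hc2 c).prodMk (hc2 c'))
    · simp only [Set.ofPred_forall]
      refine isClosed_iInter fun g => ?_
      have : {w : (G → Bool) × (G → Bool) | ∃ v ∈ V', w.2 (v⁻¹ * g) = true} =
          ⋃ v ∈ V', {w : (G → Bool) × (G → Bool) | w.2 (v⁻¹ * g) = true} := by
        ext w; simp
      rw [this]
      exact isClosed_biUnion_finset fun v _ => isClosed_eq (hc2 _) continuous_const
    · simp only [Set.ofPred_forall]
      refine isClosed_iInter fun c => isClosed_iInter fun k => isClosed_iInter fun _ => ?_
      exact (isClosed_discrete {b : Bool × Bool | b.1 = true → b.2 = p k}).preimage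
        ((hc2 c).prodMk (hc1 (k * c)))
  convert isClosedMap_fst_of_compactSpace _ hcl using 1
  ext z
  constructor
  · rintro ⟨hz, C, h1, h2, h3⟩
    refine ⟨(z, fun g => decide (g ∈ C)), ⟨hz, ?_, ?_, ?_⟩, rfl⟩
    · rintro c c' hne hv ⟨h, h'⟩
      exact h1 c (by simpa using h) c' (by simpa using h') hne hv
    · intro g
      obtain ⟨c, hc, hv⟩ := h2 g
      exact ⟨_, hv, by simpa using hc⟩
    · intro c k hk hc
      exact h3 c (by simpa using hc) k hk
  · rintro ⟨⟨z', C⟩, ⟨hz, h1, h2, h3⟩, rfl⟩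
    refine ⟨hz, {g | C g = true}, ?_, ?_, ?_⟩
    · intro c hc c' hc' hne hv
      exact h1 c c' hne hv ⟨hc, hc'⟩
    · intro g
      obtain ⟨v, hv, h⟩ := h2 g
      exact ⟨v⁻¹ * g, h, by simpa using hv⟩
    · intro c hc k hk
      exact h3 c k hk hc

lemma nxt_inv {G : Type} [Group G] (X : Set (G → Bool)) (K V V' : Finset G) (p : G → Bool)
    (hX : ∀ h : G, ∀ z ∈ X, shf h z ∈ X) (h : G) (z : G → Bool) (hz : z ∈ nxt X K V V' p) :
    shf h z ∈ nxt X K V V' p := by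
  obtain ⟨hz, C, h1, h2, h3⟩ := hz
  refine ⟨hX h z hz, {c | c * h ∈ C}, ?_, ?_, ?_⟩
  · intro c hc c' hc' hne
    have := h1 _ hc _ hc' (by simpa using hne)
    simpa [mul_assoc] using this
  · intro g
    obtain ⟨c, hc, hv⟩ := h2 (g * h)
    exact ⟨c * h⁻¹, by simpa using hc, by simpa [mul_assoc] using hv⟩
  · intro c hc k hk
    have := h3 _ hc k hk
    simpa [shf, mul_assoc] using this

lemma nxt_irr {G : Type} [Group G] (X : Set (G → Bool)) (K V V' D : Finset G) (p : G → Bool)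
    (hp : p ∈ X)
    (hX : ∀ h : G, ∀ z ∈ X, shf h z ∈ X)
    (hD : ∀ (ι : Type) (S : ι → Set G) (u : ι → G → Bool), (∀ i, u i ∈ X) →
      (∀ i j, i ≠ j → ∀ s ∈ S i, ∀ t ∈ S j, s * t⁻¹ ∉ D) →
      ∃ z ∈ X, ∀ i, ∀ s ∈ S i, z s = u i s)
    (h1V : (1 : G) ∈ V) (hVs : ∀ v ∈ V, v⁻¹ ∈ V)
    (hVD : ∀ k ∈ K, ∀ k' ∈ K, ∀ c c' : G, (k * c) * (k' * c')⁻¹ ∈ D → c * c'⁻¹ ∈ V)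
    (hVV : V ⊆ V') :
    ∃ D : Finset G, ∀ (ι : Type) (S : ι → Set G) (u : ι → G → Bool),
      (∀ i, u i ∈ nxt X K V V' p) →
      (∀ i j, i ≠ j → ∀ s ∈ S i, ∀ t ∈ S j, s * t⁻¹ ∉ D) →
      ∃ z ∈ nxt X K V V' p, ∀ i, ∀ s ∈ S i, z s = u i s := by
  let E : Finset G := K⁻¹ * D ∪ K⁻¹ * D⁻¹
  let E2 : Finset G := V'⁻¹ * E
  have hEE2 : ∀ e ∈ E, e ∈ E2 := fun e he => by
    have := Finset.mul_mem_mul (Finset.inv_mem_inv (hVV h1V)) he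
    simpa [E2] using this
  refine ⟨D ∪ D * K * E2 ∪ E2⁻¹ * K⁻¹ * D ∪ E2⁻¹ * V * E2, fun ι S u hu hS => ?_⟩
  simp only [Finset.mem_union, not_or] at hS
  have hE : ∀ k ∈ K, ∀ c s : G, (k * c * s⁻¹ ∈ D ∨ s * (k * c)⁻¹ ∈ D) → c * s⁻¹ ∈ E := by
    intro k hk c s h
    rcases h with h | h
    · refine Finset.mem_union_left _ ?_
      have := Finset.mul_mem_mul (Finset.inv_mem_inv hk) h
      simpa [mul_assoc] using this
    · refine Finset.mem_union_right _ ?_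
      have := Finset.mul_mem_mul (Finset.inv_mem_inv hk) (Finset.inv_mem_inv h)
      simpa [mul_assoc] using this
  choose huX C hC1 hC2 hC3 using hu
  let N : ι → Set G := fun i => {c | c ∈ C i ∧ ∃ s ∈ S i, c * s⁻¹ ∈ E2}
  have hNsep : VSep V (⋃ i, N i) := by
    intro c hc c' hc' hne hv
    obtain ⟨i, hc, s, hs, hcs⟩ := Set.mem_iUnion.1 hc
    obtain ⟨j, hc', t, ht, hct⟩ := Set.mem_iUnion.1 hc'
    by_cases hij : i = j
    · subst hij
      exact hC1 i c hc c' hc' hne hv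
    · apply (hS i j hij s hs t ht).2
      have := Finset.mul_mem_mul (Finset.mul_mem_mul (Finset.inv_mem_inv hcs) hv) hct
      simpa [mul_assoc] using this
  obtain ⟨M, hNM, hMN, hMsep, hMmax⟩ := exists_max_sep V h1V hVs (⋃ i, N i)
    {g | ∀ i, ∀ s ∈ S i, g * s⁻¹ ∉ E} hNsep
  have hNM' : ∀ i, ∀ c ∈ N i, c ∈ M := fun i c hc => hNM (Set.mem_iUnion.2 ⟨i, hc⟩)
  -- disjointness of the sets of centres for different indices
  have hNdisj : ∀ i j, i ≠ j → ∀ c ∈ N i, ∀ c' ∈ N j, c * c'⁻¹ ∉ V := by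
    rintro i j hij c ⟨hc, s, hs, hcs⟩ c' ⟨hc', t, ht, hct⟩ hv
    apply (hS i j hij s hs t ht).2
    have := Finset.mul_mem_mul (Finset.mul_mem_mul (Finset.inv_mem_inv hcs) hv) hct
    simpa [mul_assoc] using this
  let S' : ι ⊕ G → Set G := fun a => match a with
    | Sum.inl i => S i ∪ {g | ∃ c ∈ N i, ∃ k ∈ K, g = k * c}
    | Sum.inr c => {g | c ∈ M ∧ (∀ i, c ∉ N i) ∧ ∃ k ∈ K, g = k * c}
  let u' : ι ⊕ G → G → Bool := fun a => match a with
    | Sum.inl i => u i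
    | Sum.inr c => shf c⁻¹ p
  have hfar : ∀ c ∈ M, (∀ i, c ∉ N i) → ∀ i, ∀ s ∈ S i, c * s⁻¹ ∉ E := by
    intro c hc hn
    rcases hMN hc with h | h
    · obtain ⟨i, hi⟩ := Set.mem_iUnion.1 h
      exact absurd hi (hn i)
    · exact h
  obtain ⟨z, hz, hzu⟩ := hD (ι ⊕ G) S' u' (by
    rintro (i | c)
    · exact huX i
    · exact hX _ _ hp) (by
    rintro (i | c) (j | c') hij s hs t ht hd
    · have hij' : i ≠ j := fun h => hij (by rw [h])
      rcases hs with hs | ⟨c, hc, k, hk, rfl⟩ <;> rcases ht with ht | ⟨c', hc', k', hk', rfl⟩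
      · exact (hS i j hij' s hs t ht).1.1.1 hd
      · obtain ⟨_, t, ht, hct⟩ := hc'
        apply (hS i j hij' s hs t ht).1.1.2
        have := Finset.mul_mem_mul (Finset.mul_mem_mul hd hk') hct
        simpa [mul_assoc] using this
      · obtain ⟨_, s, hs, hcs⟩ := hc
        apply (hS i j hij' s hs t ht).1.2
        have := Finset.mul_mem_mul (Finset.mul_mem_mul (Finset.inv_mem_inv hcs)
          (Finset.inv_mem_inv hk)) hd
        simpa [mul_assoc] using this
      · exact hNdisj i j hij' c hc c' hc' (hVD k hk k' hk' _ _ hd)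
    · obtain ⟨hM, hn, k', hk', rfl⟩ := ht
      rcases hs with hs | ⟨c, hc, k, hk, rfl⟩
      · exact hfar c' hM hn i s hs (hE k' hk' _ _ (Or.inr hd))
      · exact hMsep c (hNM' i c hc) c' hM (fun h => hn i (h ▸ hc)) (hVD k hk k' hk' _ _ hd)
    · obtain ⟨hM, hn, k, hk, rfl⟩ := hs
      rcases ht with ht | ⟨c', hc', k', hk', rfl⟩
      · exact hfar c hM hn j t ht (hE k hk _ _ (Or.inl hd))
      · exact hMsep c hM c' (hNM' j c' hc') (fun h => hn j (h ▸ hc')) (hVD k hk k' hk' _ _ hd)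
    · obtain ⟨hM, hn, k, hk, rfl⟩ := hs
      obtain ⟨hM', hn', k', hk', rfl⟩ := ht
      exact hMsep c hM c' hM' (fun h => hij (by rw [h])) (hVD k hk k' hk' _ _ hd))
  refine ⟨z, ⟨hz, M, hMsep, ?_, ?_⟩, fun i s hs => hzu (Sum.inl i) s (Or.inl hs)⟩
  · intro g
    by_cases hg : ∀ i, ∀ s ∈ S i, g * s⁻¹ ∉ E
    · obtain ⟨c, hc, hv⟩ := hMmax g hg
      exact ⟨c, hc, hVV hv⟩
    · push Not at hg
      obtain ⟨i, s, hs, hgs⟩ := hg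
      obtain ⟨c, hc, hv⟩ := hC2 i g
      refine ⟨c, hNM' i c ⟨hc, s, hs, ?_⟩, hv⟩
      have := Finset.mul_mem_mul (Finset.inv_mem_inv hv) hgs
      simpa [mul_assoc, E2] using this
  · intro c hc k hk
    by_cases hn : ∀ i, c ∉ N i
    · rw [hzu (Sum.inr c) (k * c) ⟨hc, hn, k, hk, rfl⟩]
      simp [u', shf]
    · push Not at hn
      obtain ⟨i, hi⟩ := hn
      rw [hzu (Sum.inl i) (k * c) (Or.inr ⟨c, hi, k, hk, rfl⟩)]
      exact hC3 i c hi.1 k hk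

lemma good_step {G : Type} [Group G] (T : Set G) (hT : RightThicklySyndetic T)
    (X : Set (G → Bool)) (hX : Good T X) (K : Finset G) (p : G → Bool) (hp : p ∈ X) :
    ∃ X' ⊆ X, Good T X' ∧ ∀ z ∈ X', ∃ c, ∀ k ∈ K, z (k * c) = p k := by
  obtain ⟨D, hD⟩ := hX.irr
  obtain ⟨x, hx, hxT⟩ := hX.compat
  let V : Finset G := insert 1 (K⁻¹ * D * K ∪ (K⁻¹ * D * K)⁻¹)
  have h1V : (1 : G) ∈ V := Finset.mem_insert_self _ _
  have hVs : ∀ v ∈ V, v⁻¹ ∈ V := by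
    intro v hv
    rcases Finset.mem_insert.1 hv with rfl | hv
    · simpa using h1V
    · refine Finset.mem_insert_of_mem ?_
      rcases Finset.mem_union.1 hv with hv | hv
      · exact Finset.mem_union_right _ (Finset.inv_mem_inv hv)
      · exact Finset.mem_union_left _ (Finset.mem_inv'.1 hv)
  have hVD : ∀ k ∈ K, ∀ k' ∈ K, ∀ c c' : G, (k * c) * (k' * c')⁻¹ ∈ D → c * c'⁻¹ ∈ V := by
    intro k hk k' hk' c c' h
    refine Finset.mem_insert_of_mem (Finset.mem_union_left _ ?_)
    have := Finset.mul_mem_mul (Finset.mul_mem_mul (Finset.inv_mem_inv hk) h) hk'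
    simpa [mul_assoc] using this
  obtain ⟨Q, ⟨F, hF⟩, hQ⟩ := hT (D * K ∪ D⁻¹ * K)
  obtain ⟨C, -, hCQ, hCsep, hCmax⟩ := exists_max_sep V h1V hVs ∅ Q (by intro c hc; exact hc.elim)
  rw [Set.empty_union] at hCQ
  let V' : Finset G := V ∪ F * V
  have hVV : V ⊆ V' := Finset.subset_union_left
  refine ⟨nxt X K V V' p, fun z hz => hz.1, ⟨nxt_closed X K V V' p hX.closed,
    nxt_inv X K V V' p hX.inv, nxt_irr X K V V' D p hp hX.inv hD h1V hVs hVD hVV, ?_⟩, ?_⟩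
  · let S' : Unit ⊕ G → Set G := fun a => match a with
      | Sum.inl _ => {g | ∀ c ∈ C, ∀ k ∈ K, g * (k * c)⁻¹ ∉ D ∧ (k * c) * g⁻¹ ∉ D}
      | Sum.inr c => {g | c ∈ C ∧ ∃ k ∈ K, g = k * c}
    let u' : Unit ⊕ G → G → Bool := fun a => match a with
      | Sum.inl _ => x
      | Sum.inr c => shf c⁻¹ p
    obtain ⟨z, hz, hzu⟩ := hD (Unit ⊕ G) S' u' (by
      rintro (i | c)
      · exact hx
      · exact hX.inv _ _ hp) (by
      rintro (i | c) (j | c') hij s hs t ht hd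
      · exact hij rfl
      · obtain ⟨hc, k, hk, rfl⟩ := ht
        exact (hs c' hc k hk).1 hd
      · obtain ⟨hc, k, hk, rfl⟩ := hs
        exact (ht c hc k hk).2 hd
      · obtain ⟨hc, k, hk, rfl⟩ := hs
        obtain ⟨hc', k', hk', rfl⟩ := ht
        exact hCsep c hc c' hc' (fun h => hij (by rw [h])) (hVD k hk k' hk' _ _ hd))
    refine ⟨z, ⟨hz, C, hCsep, ?_, ?_⟩, ?_⟩
    · intro g
      obtain ⟨f, hf, hfg⟩ := hF g
      obtain ⟨c, hc, hv⟩ := hCmax _ hfg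
      refine ⟨c, hc, Finset.mem_union_right _ ?_⟩
      have := Finset.mul_mem_mul hf hv
      simpa [mul_assoc] using this
    · intro c hc k hk
      rw [hzu (Sum.inr c) (k * c) ⟨hc, k, hk, rfl⟩]
      simp [u', shf]
    · intro g hg
      by_cases hgS : g ∈ S' (Sum.inl ())
      · rw [hzu (Sum.inl ()) g hgS] at hg
        exact hxT g hg
      · have : ∃ c ∈ C, ∃ k ∈ K, g * (k * c)⁻¹ ∈ D ∨ (k * c) * g⁻¹ ∈ D := by
          by_contra hcon
          push Not at hcon
          exact hgS hcon
        obtain ⟨c, hc, k, hk, h | h⟩ := this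
        · have := hQ _ (Finset.mem_union_left _ (Finset.mul_mem_mul h hk)) c (hCQ hc)
          simpa [mul_assoc] using this
        · have := hQ _ (Finset.mem_union_right _
            (Finset.mul_mem_mul (Finset.inv_mem_inv h) hk)) c (hCQ hc)
          simpa [mul_assoc] using this
  · rintro z ⟨-, M, -, h2, h3⟩
    obtain ⟨c, hc, -⟩ := h2 1
    exact ⟨c, h3 c hc⟩

lemma good_step' {G : Type} [Group G] (T : Set G) (hT : RightThicklySyndetic T)
    (X : Set (G → Bool)) (hX : Good T X) (K P : Finset G) :
    ∃ X' ⊆ X, Good T X' ∧ ∀ y ∈ X', ∀ z ∈ X', (∀ k ∈ K, y k = decide (k ∈ P)) →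
      ∃ c, ∀ k ∈ K, z (k * c) = y k := by
  by_cases h : ∃ p ∈ X, ∀ k ∈ K, p k = decide (k ∈ P)
  · obtain ⟨p, hp, hpk⟩ := h
    obtain ⟨X', hs, hg, hz⟩ := good_step T hT X hX K p hp
    refine ⟨X', hs, hg, fun y _ z hzX hyk => ?_⟩
    obtain ⟨c, hc⟩ := hz z hzX
    exact ⟨c, fun k hk => by rw [hc k hk, hpk k hk, hyk k hk]⟩
  · exact ⟨X, subset_rfl, hX, fun y hy z _ hyk => absurd ⟨y, hy, hyk⟩ h⟩

lemma exists_seq {G : Type} [Group G] [Countable G] (T : Set G) (hT : RightThicklySyndetic T) :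
    ∃ Y : Set (G → Bool), IsClosed Y ∧ (∀ h : G, ∀ z ∈ Y, shf h z ∈ Y) ∧
      (∃ x ∈ Y, ∀ g, x g = true → g ∈ T) ∧ (∀ z ∈ Y, ∃ c, z c = true) ∧
      ∀ K : Finset G, ∀ y ∈ Y, ∀ z ∈ Y, ∃ c, ∀ k ∈ K, z (k * c) = y k := by
  obtain ⟨X0, -, hg0, hX0⟩ := good_step T hT Set.univ (good_univ T) {1} (fun _ => true) trivial
  obtain ⟨e, he⟩ := exists_surjective_nat (Finset G × Finset G)
  choose f hfs hfg hfp using fun (X : {X : Set (G → Bool) // Good T X}) (n : ℕ) =>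
    good_step' T hT X.1 X.2 (e n).1 (e n).2
  let W : ℕ → {X : Set (G → Bool) // Good T X} := fun n =>
    Nat.rec ⟨X0, hg0⟩ (fun n X => ⟨f X n, hfg X n⟩) n
  have hW : ∀ n, (W (n + 1)).1 = f (W n) n := fun n => rfl
  refine ⟨⋂ n, (W n).1, isClosed_iInter fun n => (W n).2.closed, ?_, ?_, ?_, ?_⟩
  · intro h z hz
    exact Set.mem_iInter.2 fun n => (W n).2.inv h z (Set.mem_iInter.1 hz n)
  · have hcl : IsClosed {x : G → Bool | ∀ g, x g = true → g ∈ T} := by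
      rw [Set.ofPred_forall]
      refine isClosed_iInter fun g => ?_
      have hcg : Continuous fun x : G → Bool => x g := continuous_apply g
      exact (isClosed_discrete {b : Bool | b = true → g ∈ T}).preimage hcg
    obtain ⟨x, hx⟩ := IsCompact.nonempty_iInter_of_sequence_nonempty_isCompact_isClosed
      (fun n => (W n).1 ∩ {x : G → Bool | ∀ g, x g = true → g ∈ T})
      (fun n => Set.inter_subset_inter_left _ (by rw [hW]; exact hfs _ _))
      (fun n => (W n).2.compat) (((W 0).2.closed.inter hcl).isCompact)
      (fun n => (W n).2.closed.inter hcl)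
    rw [Set.mem_iInter] at hx
    exact ⟨x, Set.mem_iInter.2 fun n => (hx n).1, (hx 0).2⟩
  · intro z hz
    obtain ⟨c, hc⟩ := hX0 z (Set.mem_iInter.1 hz 0)
    exact ⟨c, by simpa using hc⟩
  · intro K y hy z hz
    obtain ⟨n, hn⟩ := he (K, K.filter fun k => y k = true)
    have := hfp (W n) n y (Set.mem_iInter.1 hy (n + 1)) z (Set.mem_iInter.1 hz (n + 1))
    rw [hn] at this
    exact this fun k hk => by simp [hk]

/-- For a countably infinite group `G`, every right thickly syndetic subset of `G`
contains an m-set. -/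
theorem stmt1 (G : Type) [Group G] [Countable G] [Infinite G] (T : Set G)
    (hT : RightThicklySyndetic T) :
    ∃ A : Set G, A ⊆ T ∧ IsMSet G A := by
  obtain ⟨Y, hYc, hYi, ⟨x, hx, hxT⟩, hne, hmin⟩ := exists_seq T hT
  refine ⟨T, subset_rfl, ?_⟩
  have : CompactSpace Y := isCompact_iff_compactSpace.1 hYc.isCompact
  let _ : MulAction G Y :=
    { smul := fun h z => ⟨shf h z.1, hYi h z.1 z.2⟩
      one_smul := fun z => Subtype.ext (funext fun g => congrArg z.1 (mul_one g))
      mul_smul := fun a b z => Subtype.ext (funext fun g => congrArg z.1 (mul_assoc g a b).symm) }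
  have hsm : ∀ (h : G) (z : Y) (g : G), (h • z).1 g = z.1 (g * h) := fun _ _ _ => rfl
  have : ContinuousConstSMul G Y := ⟨fun h => by
    refine Continuous.subtype_mk (continuous_pi fun g => ?_) _
    exact (continuous_apply (g * h)).comp continuous_subtype_val⟩
  have : TopologicalSpace.MetrizableSpace Y :=
    TopologicalSpace.metrizableSpace_of_t3_secondCountable Y
  refine ⟨GSys.mk Y, ?_, (⟨x, hx⟩ : Y), {z : Y | z.1 1 = true}, ?_, ?_, ?_⟩
  · intro z
    change Dense (MulAction.orbit G (z : Y))
    change Y at z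
    rw [dense_iff_inter_open]
    rintro U hU ⟨y, hy⟩
    obtain ⟨O, hO, rfl⟩ := isOpen_induced_iff.1 hU
    obtain ⟨I, u, hu, hIu⟩ := isOpen_pi_iff.1 hO y.1 hy
    obtain ⟨c, hc⟩ := hmin I y.1 y.2 z.1 z.2
    refine ⟨c • z, hIu ?_, ⟨c, rfl⟩⟩
    intro k hk
    rw [hsm, hc k hk]
    exact (hu k hk).2
  · have hc1 : Continuous fun z : Y => z.1 1 :=
      (continuous_apply (1 : G)).comp continuous_subtype_val
    exact (isOpen_discrete {b : Bool | b = true}).preimage hc1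
  · obtain ⟨c, hc⟩ := hne x hx
    refine ⟨c • (⟨x, hx⟩ : Y), ?_⟩
    change x (1 * c) = true
    simpa using hc
  · intro g hg
    change x (1 * g) = true at hg
    exact hxT g (by simpa using hg)
end

section
/- Let G be a countable discrete group and (X,G) a transitive G-system. If (X,G) is disjoint with all minimal G-systems, then (X,G) is an M-system (transitive with a dense set of minimal points) and every minimal factor of (X,G) is trivial (a one-point system). -/
/-- A joining of the `G`-systems `X` and `Y`: a nonempty closed subset of `X × Y`,
invariant under the diagonal `G`-action, projecting onto both coordinates. -/
def IsJoining (G : Type) [Group G] {X Y : Type} [TopologicalSpace X] [TopologicalSpace Y]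
    [MulAction G X] [MulAction G Y] (J : Set (X × Y)) : Prop :=
  J.Nonempty ∧ IsClosed J ∧ (∀ g : G, ∀ p ∈ J, (g • p.1, g • p.2) ∈ J) ∧
    Prod.fst '' J = Set.univ ∧ Prod.snd '' J = Set.univ

/-- Two `G`-systems are disjoint if their only joining is `X × Y`. -/
def DisjointSys (G : Type) [Group G] (X Y : Type) [TopologicalSpace X] [TopologicalSpace Y]
    [MulAction G X] [MulAction G Y] : Prop :=
  ∀ J : Set (X × Y), IsJoining G J → J = Set.univ

/-- A point `x` of a `G`-space is a minimal point if its orbit closure is a minimal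
system, i.e. every point of the orbit closure of `x` has the same orbit closure. -/
def IsMinimalPoint (G : Type) [Group G] {X : Type*} [TopologicalSpace X] [MulAction G X]
    (x : X) : Prop :=
  ∀ y ∈ closure (MulAction.orbit G x),
    closure (MulAction.orbit G y) = closure (MulAction.orbit G x)

open Pointwise in
theorem aux_step {G : Type} [Group G] (C : Set G)
    (hole : ∀ E : Set G, E.Finite → ∃ S : Set G, S.Finite ∧
      ∀ g : G, ∃ s ∈ S, ∀ e ∈ E, e * s * g ∉ C)
    (D : Set G) (hD : D.Finite) (hDC : D ⊆ C) (M : Set G) (hM : M.Finite) :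
    ∃ M' R : Set G, M'.Finite ∧ R.Finite ∧ ∀ Q : Set G,
      (∀ g : G, ∃ t : G, ∀ m ∈ M', m * g ∈ Q → m * g * t⁻¹ ∈ C) →
      ∃ Q' : Set G, Q ⊆ Q' ∧ (∀ g : G, ∃ t : G, ∀ m ∈ M, m * g ∈ Q' → m * g * t⁻¹ ∈ C) ∧
        ∀ g : G, ∃ r ∈ R, ∀ d ∈ D, d * (r * g) ∈ Q' := by
  classical
  set N : Set G := M * M⁻¹ with hN
  have hNf : N.Finite := hM.mul hM.inv
  have hNinv : ∀ n ∈ N, n⁻¹ ∈ N := by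
    rintro n ⟨a, ha, b, hb, rfl⟩
    refine ⟨b⁻¹, hb, a⁻¹, by simpa using ha, by simp⟩
  obtain ⟨S, hS, hSh⟩ := hole (N * D) (hNf.mul hD)
  refine ⟨M ∪ (N * D) * S, (D⁻¹ * N * D ∪ {1}) * S, hM.union ((hNf.mul hD).mul hS),
    (((hD.inv.mul hNf).mul hD).union (Set.finite_singleton 1)).mul hS, ?_⟩
  intro Q hQ
  let good : Set (Set G) := {T | (∀ t ∈ T, ∀ n ∈ N, ∀ d ∈ D, n * d * t ∉ Q) ∧
    ∀ t ∈ T, ∀ t' ∈ T, t ≠ t' → ∀ n ∈ N, ∀ d ∈ D, ∀ d' ∈ D, n * d * t ≠ d' * t'}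
  obtain ⟨T, hT⟩ : ∃ T, Maximal (· ∈ good) T := by
    apply zorn_subset
    intro c hc hchain
    refine ⟨⋃₀ c, ⟨?_, ?_⟩, fun s hs => Set.subset_sUnion_of_mem hs⟩
    · rintro t ⟨A, hA, htA⟩
      exact (hc hA).1 t htA
    · rintro t ⟨A, hA, htA⟩ t' ⟨B, hB, htB⟩
      rcases hchain.total hA hB with h | h
      · exact (hc hB).2 t (h htA) t' htB
      · exact (hc hA).2 t htA t' (h htB)
  have hTg : T ∈ good := hT.prop
  refine ⟨Q ∪ {h | ∃ d ∈ D, ∃ t ∈ T, h = d * t}, Set.subset_union_left, ?_, ?_⟩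
  · intro g
    by_cases hex : ∃ m ∈ M, ∃ d ∈ D, ∃ t ∈ T, m * g = d * t
    · obtain ⟨m, hm, d, hd, t, ht, hmg⟩ := hex
      refine ⟨t, fun m' hm' h => ?_⟩
      have hn : m' * m⁻¹ ∈ N := ⟨m', hm', m⁻¹, by simpa using hm, rfl⟩
      have heq : m' * g = m' * m⁻¹ * d * t := by
        rw [mul_assoc (m' * m⁻¹), ← hmg]; group
      rcases h with h | ⟨d', hd', t', ht', h⟩
      · rw [heq] at h
        exact absurd h (hTg.1 t ht _ hn d hd)
      · by_cases htt : t = t'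
        · subst htt
          rw [h]
          simpa using hDC hd'
        · exact absurd (heq.symm.trans h) (hTg.2 t ht t' ht' htt _ hn d hd d' hd')
    · obtain ⟨t, ht⟩ := hQ g
      refine ⟨t, fun m hm h => ht m (Or.inl hm) ?_⟩
      rcases h with h | ⟨d, hd, t', ht', h⟩
      · exact h
      · exact absurd ⟨m, hm, d, hd, t', ht', h⟩ hex
  · intro g
    suffices h : ∃ r ∈ (D⁻¹ * N * D ∪ {1}) * S, r * g ∈ T by
      obtain ⟨r, hr, h⟩ := h
      exact ⟨r, hr, fun d hd => Or.inr ⟨d, hd, _, h, rfl⟩⟩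
    obtain ⟨t0, ht0⟩ := hQ g
    obtain ⟨s, hs, hsh⟩ := hSh (g * t0⁻¹)
    have hfree : ∀ n ∈ N, ∀ d ∈ D, n * d * (s * g) ∉ Q := by
      intro n hn d hd hq
      have h1 := ht0 (n * d * s) (Or.inr ⟨n * d, ⟨n, hn, d, hd, rfl⟩, s, hs, rfl⟩)
        (by rwa [mul_assoc (n * d)])
      apply hsh (n * d) ⟨n, hn, d, hd, rfl⟩
      rwa [← mul_assoc]
    by_cases hin : s * g ∈ T
    · exact ⟨s, ⟨1, Or.inr rfl, s, hs, by simp⟩, hin⟩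
    by_contra hno
    apply hin
    have hins : insert (s * g) T ∈ good := by
      refine ⟨?_, ?_⟩
      · rintro t (rfl | ht)
        · exact hfree
        · exact hTg.1 t ht
      · rintro t (rfl | ht) t' (rfl | ht') hne n hn d hd d' hd' heq
        · exact hne rfl
        · apply hno
          refine ⟨d'⁻¹ * n * d * s, ⟨d'⁻¹ * n * d, Or.inl ⟨d'⁻¹ * n, ⟨d'⁻¹, by simpa using hd',
            n, hn, rfl⟩, d, hd, rfl⟩, s, hs, rfl⟩, ?_⟩
          have : d'⁻¹ * n * d * s * g = t' := by
            calc _ = d'⁻¹ * (n * d * (s * g)) := by group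
              _ = t' := by rw [heq]; group
          rwa [this]
        · apply hno
          refine ⟨d⁻¹ * n⁻¹ * d' * s, ⟨d⁻¹ * n⁻¹ * d', Or.inl ⟨d⁻¹ * n⁻¹, ⟨d⁻¹, by simpa using hd,
            n⁻¹, hNinv n hn, rfl⟩, d', hd', rfl⟩, s, hs, rfl⟩, ?_⟩
          have : d⁻¹ * n⁻¹ * d' * s * g = t := by
            calc _ = d⁻¹ * n⁻¹ * (d' * (s * g)) := by group
              _ = t := by rw [← heq]; group
          rwa [this]
        · exact hTg.2 t ht t' ht' hne n hn d hd d' hd' heq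
    exact hT.le_of_ge hins (Set.subset_insert _ _) (Set.mem_insert _ _)

/-- Finite-level combinatorial statement, with constants independent of the level. -/
theorem aux_levels {G : Type} [Group G] (C : Set G)
    (hole : ∀ E : Set G, E.Finite → ∃ S : Set G, S.Finite ∧
      ∀ g : G, ∃ s ∈ S, ∀ e ∈ E, e * s * g ∉ C)
    (D : ℕ → Set G) (hD : ∀ k, (D k).Finite) (hDC : ∀ k, D k ⊆ C) :
    ∃ (S : Set G) (R : ℕ → Set G), S.Finite ∧ (∀ k, (R k).Finite) ∧ ∀ n : ℕ, ∃ Q : Set G,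
      (∀ g : G, ∃ s ∈ S, s * g ∉ Q) ∧
      ∀ k < n, ∀ g : G, ∃ r ∈ R k, ∀ d ∈ D k, d * (r * g) ∈ Q := by
  choose! f r hf hr hstep using fun (k : ℕ) => aux_step C hole (D k) (hD k) (hDC k)
  obtain ⟨S, hS, hSh⟩ := hole {1} (Set.finite_singleton 1)
  let M : ℕ → Set G := fun n => Nat.rec S (fun k A => f k A) n
  have hMf : ∀ n, (M n).Finite := by
    intro n
    induction n with
    | zero => exact hS
    | succ k ih => exact hf k _ ih
  refine ⟨S, fun k => r k (M k), hS, fun k => hr k _ (hMf k), ?_⟩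
  have key : ∀ n, ∀ Q : Set G, (∀ g : G, ∃ t : G, ∀ m ∈ M n, m * g ∈ Q → m * g * t⁻¹ ∈ C) →
      ∃ Q' : Set G, Q ⊆ Q' ∧ (∀ g : G, ∃ t : G, ∀ m ∈ M 0, m * g ∈ Q' → m * g * t⁻¹ ∈ C) ∧
      ∀ k < n, ∀ g : G, ∃ a ∈ r k (M k), ∀ d ∈ D k, d * (a * g) ∈ Q' := by
    intro n
    induction n with
    | zero => exact fun Q h => ⟨Q, subset_rfl, h, fun k hk => absurd hk (by omega)⟩
    | succ n ih =>
      intro Q h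
      obtain ⟨Q1, h1, h2, h3⟩ := hstep n (M n) (hMf n) Q h
      obtain ⟨Q2, h4, h5, h6⟩ := ih Q1 h2
      refine ⟨Q2, h1.trans h4, h5, fun k hk g => ?_⟩
      rcases Nat.lt_succ_iff_lt_or_eq.1 hk with hk | rfl
      · exact h6 k hk g
      · obtain ⟨a, ha, hb⟩ := h3 g
        exact ⟨a, ha, fun d hd => h4 (hb d hd)⟩
  intro n
  obtain ⟨Q, -, h1, h2⟩ := key n ∅ (fun g => ⟨1, fun m _ h => absurd h (by simp)⟩)
  refine ⟨Q, fun g => ?_, h2⟩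
  obtain ⟨t, ht⟩ := h1 g
  obtain ⟨s, hs, h⟩ := hSh (g * t⁻¹)
  refine ⟨s, hs, fun hq => h 1 rfl ?_⟩
  have := ht s hs hq
  rwa [one_mul, ← mul_assoc]

/-- Existence of minimal subsets. -/
theorem aux_minimal {G : Type} [Group G] {X : Type} [TopologicalSpace X] [CompactSpace X]
    [MulAction G X] [ContinuousConstSMul G X] (K : Set X) (hK : IsClosed K) (hne : K.Nonempty)
    (hinv : ∀ g : G, ∀ x ∈ K, g • x ∈ K) :
    ∃ Y : Set X, Y ⊆ K ∧ IsClosed Y ∧ Y.Nonempty ∧ (∀ g : G, ∀ x ∈ Y, g • x ∈ Y) ∧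
      ∀ y ∈ Y, closure (MulAction.orbit G y) = Y := by
  let F : Set (Set X) := {Y | IsClosed Y ∧ Y.Nonempty ∧ ∀ g : G, ∀ x ∈ Y, g • x ∈ Y}
  obtain ⟨Y, hYK, hY⟩ := zorn_superset_nonempty F (by
    intro c hc hchain hcne
    refine ⟨⋂₀ c, ⟨isClosed_sInter fun s hs => (hc hs).1, ?_, ?_⟩,
      fun s hs => Set.sInter_subset_of_mem hs⟩
    · have := hcne.to_subtype
      apply IsCompact.nonempty_sInter_of_directed_nonempty_isCompact_isClosed
      · intro a ha b hb
        rcases hchain.total ha hb with h | h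
        · exact ⟨a, ha, subset_rfl, h⟩
        · exact ⟨b, hb, h, subset_rfl⟩
      · exact fun s hs => (hc hs).2.1
      · exact fun s hs => (hc hs).1.isCompact
      · exact fun s hs => (hc hs).1
    · intro g x hx s hs
      exact (hc hs).2.2 g x (hx s hs)) K ⟨hK, hne, hinv⟩
  obtain ⟨h1, h2, h3⟩ := hY.prop
  refine ⟨Y, hYK, h1, h2, h3, fun y hy => ?_⟩
  have hsub : closure (MulAction.orbit G y) ⊆ Y := by
    apply closure_minimal _ h1
    rintro _ ⟨g, rfl⟩
    exact h3 g y hy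
  refine hsub.antisymm (hY.le_of_le ⟨isClosed_closure, ?_, ?_⟩ hsub)
  · exact ⟨y, subset_closure (MulAction.mem_orbit_self y)⟩
  · intro g x hx
    have : g • x ∈ (g • ·) '' closure (MulAction.orbit G y) := ⟨x, hx, rfl⟩
    refine closure_mono ?_ (image_closure_subset_closure_image (continuous_const_smul g) this)
    rintro _ ⟨_, ⟨h, rfl⟩, rfl⟩
    exact ⟨g * h, by simp [mul_smul]⟩

/-- The full shift. -/
def FShift (G : Type) : Type := G → Bool

instance (G : Type) : TopologicalSpace (FShift G) := inferInstanceAs (TopologicalSpace (G → Bool))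
instance (G : Type) : CompactSpace (FShift G) := inferInstanceAs (CompactSpace (G → Bool))
instance (G : Type) [Countable G] : TopologicalSpace.MetrizableSpace (FShift G) :=
  inferInstanceAs (TopologicalSpace.MetrizableSpace (G → Bool))
instance (G : Type) [Group G] : MulAction G (FShift G) where
  smul g y := fun h => y (h * g)
  one_smul y := by
    funext h
    exact congrArg y (mul_one h)
  mul_smul a b y := by
    funext h
    exact congrArg y (mul_assoc h a b).symm

theorem FShift.smul_apply {G : Type} [Group G] (g : G) (y : FShift G) (h : G) :
    (g • y) h = y (h * g) := rfl

theorem FShift.continuous_apply {G : Type} (h : G) : Continuous (fun y : FShift G => y h) :=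
  _root_.continuous_apply (A := fun _ : G => Bool) h

instance (G : Type) [Group G] : ContinuousConstSMul G (FShift G) where
  continuous_const_smul g :=
    continuous_pi (A := fun _ : G => Bool) fun h => FShift.continuous_apply (h * g)

theorem FShift.isClosed_eq {G : Type} (h : G) (b : Bool) : IsClosed {y : FShift G | y h = b} :=
  _root_.isClosed_eq (FShift.continuous_apply h) continuous_const

theorem FShift.isClosed_exists {G : Type} (R : Set G) (hR : R.Finite) (P : G → FShift G → Prop)
    (hP : ∀ r, IsClosed {y | P r y}) : IsClosed {y : FShift G | ∃ r ∈ R, P r y} := by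
  have : {y : FShift G | ∃ r ∈ R, P r y} = ⋃ r ∈ R, {y | P r y} := by
    ext; simp
  rw [this]
  exact hR.isClosed_biUnion fun r _ => hP r

/-- The symbolic minimal system. -/
theorem aux_shift {G : Type} [Group G] [Countable G] (C : Set G)
    (hole : ∀ E : Set G, E.Finite → ∃ S : Set G, S.Finite ∧
      ∀ g : G, ∃ s ∈ S, ∀ e ∈ E, e * s * g ∉ C) :
    ∃ Y : Set (FShift G), IsClosed Y ∧ Y.Nonempty ∧ (∀ g : G, ∀ x ∈ Y, g • x ∈ Y) ∧
      (∀ y ∈ Y, closure (MulAction.orbit G y) = Y) ∧ (∀ y ∈ Y, ∃ s, y s = true) ∧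
      ∃ y ∈ Y, ∀ c ∈ C, y c = false := by
  classical
  obtain ⟨f, hf⟩ := exists_surjective_nat G
  let D : ℕ → Set G := fun k => (f '' Set.Iic k) ∩ C
  have hD : ∀ k, (D k).Finite := fun k => ((Set.finite_Iic k).image f).inter_of_left C
  have hDm : ∀ k l, k ≤ l → D k ⊆ D l := fun k l h =>
    Set.inter_subset_inter_left _ (Set.image_mono (Set.Iic_subset_Iic.2 h))
  obtain ⟨S, R, hS, hR, hn⟩ := aux_levels C hole D hD (fun k => Set.inter_subset_right)
  let Ω : ℕ → Set (FShift G) := fun n => {y | (∀ g : G, ∃ s ∈ S, y (s * g) = true) ∧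
    ∀ k < n, ∀ g : G, ∃ r ∈ R k, ∀ d ∈ D k, y (d * (r * g)) = false}
  have hΩc : ∀ n, IsClosed (Ω n) := by
    intro n
    refine IsClosed.inter ?_ ?_
    · change IsClosed {y : FShift G | ∀ g : G, ∃ s ∈ S, y (s * g) = true}
      rw [Set.ofPred_forall]
      refine isClosed_iInter fun g => FShift.isClosed_exists S hS _ fun s => FShift.isClosed_eq _ _
    · change IsClosed {y : FShift G | ∀ k < n, ∀ g : G, ∃ r ∈ R k, ∀ d ∈ D k, y (d * (r * g)) = false}
      simp only [Set.ofPred_forall]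
      refine isClosed_iInter fun k => isClosed_iInter fun _ => isClosed_iInter fun g =>
        FShift.isClosed_exists (R k) (hR k) _ fun r => ?_
      simp only [Set.ofPred_forall]
      exact isClosed_iInter fun d => isClosed_iInter fun _ => FShift.isClosed_eq _ _
  have hΩne : ∀ n, (Ω n).Nonempty := by
    intro n
    obtain ⟨Q, h1, h2⟩ := hn n
    refine ⟨fun g => decide (g ∉ Q), ?_, ?_⟩
    · intro g
      obtain ⟨s, hs, h⟩ := h1 g
      exact ⟨s, hs, decide_eq_true h⟩
    · intro k hk g
      obtain ⟨r, hr, h⟩ := h2 k hk g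
      exact ⟨r, hr, fun d hd => decide_eq_false (not_not.2 (h d hd))⟩
  have hne : (⋂ n, Ω n).Nonempty := by
    apply IsCompact.nonempty_iInter_of_sequence_nonempty_isCompact_isClosed
    · exact fun n y hy => ⟨hy.1, fun k hk => hy.2 k (by omega)⟩
    · exact hΩne
    · exact (hΩc 0).isCompact
    · exact hΩc
  obtain ⟨Y, hYΩ, hYc, hYne, hYi, hYm⟩ := aux_minimal (G := G) (⋂ n, Ω n)
    (isClosed_iInter hΩc) hne (by
      intro g y hy
      rw [Set.mem_iInter] at hy ⊢
      intro n
      refine ⟨fun h => ?_, fun k hk h => ?_⟩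
      · obtain ⟨s, hs, h'⟩ := (hy n).1 (h * g)
        exact ⟨s, hs, by rwa [FShift.smul_apply, mul_assoc]⟩
      · obtain ⟨s, hs, h'⟩ := (hy n).2 k hk (h * g)
        refine ⟨s, hs, fun d hd => ?_⟩
        rw [FShift.smul_apply, mul_assoc, mul_assoc]
        exact h' d hd)
  refine ⟨Y, hYc, hYne, hYi, hYm, ?_, ?_⟩
  · intro y hy
    obtain ⟨s, -, h⟩ := (Set.mem_iInter.1 (hYΩ hy) 0).1 1
    exact ⟨_, h⟩
  · let Z : ℕ → Set (FShift G) := fun k => Y ∩ {y | ∀ d ∈ D k, y d = false}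
    have hZc : ∀ k, IsClosed (Z k) := by
      intro k
      refine hYc.inter ?_
      simp only [Set.ofPred_forall]
      exact isClosed_iInter fun d => isClosed_iInter fun _ => FShift.isClosed_eq _ _
    have hZ : (⋂ k, Z k).Nonempty := by
      apply IsCompact.nonempty_iInter_of_sequence_nonempty_isCompact_isClosed
      · exact fun n y hy => ⟨hy.1, fun d hd => hy.2 d (hDm n (n+1) (by omega) hd)⟩
      · intro k
        obtain ⟨y, hy⟩ := hYne
        obtain ⟨r, hr, h⟩ := (Set.mem_iInter.1 (hYΩ hy) (k+1)).2 k (by omega) 1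
        refine ⟨r • y, hYi r y hy, fun d hd => ?_⟩
        have := h d hd
        rwa [mul_one] at this
      · exact (hZc 0).isCompact
      · exact hZc
    obtain ⟨y, hy⟩ := hZ
    rw [Set.mem_iInter] at hy
    refine ⟨y, (hy 0).1, fun c hc => ?_⟩
    obtain ⟨k, rfl⟩ := hf c
    exact (hy k).2 _ ⟨⟨k, Set.mem_Iic.2 le_rfl, rfl⟩, hc⟩

theorem aux_minpt_smul {G : Type} [Group G] {X : Type} [TopologicalSpace X]
    [MulAction G X] (g : G) (x : X)
    (hx : IsMinimalPoint G x) : IsMinimalPoint G (g • x) := by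
  unfold IsMinimalPoint at *
  have : MulAction.orbit G (g • x) = MulAction.orbit G x := MulAction.orbit_eq_iff.2 ⟨g, rfl⟩
  rwa [this]

/-- Return times to an open set whose closure has no minimal points are full of holes. -/
theorem aux_hole {G : Type} [Group G] {X : Type} [TopologicalSpace X] [CompactSpace X]
    [MulAction G X] [ContinuousConstSMul G X] (U : Set X)
    (hU : ∀ z ∈ closure U, ¬ IsMinimalPoint G z) (x : X) (E : Set G) (hE : E.Finite) :
    ∃ S : Set G, S.Finite ∧ ∀ g : G, ∃ s ∈ S, ∀ e ∈ E, e * s * g ∉ {g : G | g • x ∈ U} := by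
  let W : Set X := ⋂ e ∈ E, (fun z : X => e • z) ⁻¹' (closure U)ᶜ
  have hW : IsOpen W := hE.isOpen_biInter fun e _ =>
    isClosed_closure.isOpen_compl.preimage (continuous_const_smul e)
  have hcov : (Set.univ : Set X) ⊆ ⋃ s : G, (fun z : X => s • z) ⁻¹' W := by
    intro z _
    obtain ⟨Y, hY, hYc, ⟨m, hm⟩, hYi, hYm⟩ := aux_minimal (G := G)
      (closure (MulAction.orbit G z)) isClosed_closure
      ⟨z, subset_closure (MulAction.mem_orbit_self z)⟩ (by
        intro g x hx
        have : g • x ∈ (g • ·) '' closure (MulAction.orbit G z) := ⟨x, hx, rfl⟩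
        refine closure_mono ?_ (image_closure_subset_closure_image (continuous_const_smul g) this)
        rintro _ ⟨_, ⟨h, rfl⟩, rfl⟩
        exact ⟨g * h, by simp [mul_smul]⟩)
    have hmm : IsMinimalPoint G m := by
      intro y hy
      rw [hYm m hm] at hy ⊢
      exact hYm y hy
    have hmW : m ∈ W := by
      simp only [W, Set.mem_iInter]
      intro e _ hc
      exact hU _ hc (aux_minpt_smul e m hmm)
    obtain ⟨_, hw, ⟨g, rfl⟩⟩ := mem_closure_iff.1 (hY hm) W hW hmW
    exact Set.mem_iUnion.2 ⟨g, hw⟩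
  obtain ⟨S, hS⟩ := isCompact_univ.elim_finite_subcover _
    (fun s => hW.preimage (continuous_const_smul s)) hcov
  refine ⟨S, S.finite_toSet, fun g => ?_⟩
  obtain ⟨s, hs, h⟩ := Set.mem_iUnion₂.1 (hS (Set.mem_univ (g • x)))
  refine ⟨s, hs, fun e he hc => ?_⟩
  have h1 := Set.mem_iInter₂.1 h e he
  apply h1
  apply subset_closure
  change e • s • g • x ∈ U
  rw [← mul_smul, ← mul_smul]
  exact hc

/-- The subsystem carried by a closed invariant set. -/
def subAction {G : Type} [Group G] {X : Type} [MulAction G X] (Y : Set X)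
    (h : ∀ g : G, ∀ x ∈ Y, g • x ∈ Y) : MulAction G Y where
  smul g y := ⟨g • y.1, h g y.1 y.2⟩
  one_smul y := Subtype.ext (one_smul G y.1)
  mul_smul a b y := Subtype.ext (mul_smul a b y.1)

/-- If a transitive `G`-system `(X,G)` (with `G` a countable discrete group) is disjoint
with all minimal `G`-systems, then the set of minimal points of `X` is dense (so `X` is an
M-system) and every minimal factor of `(X,G)` is trivial. -/
theorem stmt2 (G : Type) [Group G] [Countable G]
    (X : Type) [TopologicalSpace X] [CompactSpace X] [TopologicalSpace.MetrizableSpace X]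
    [MulAction G X] [ContinuousConstSMul G X]
    (htrans : ∃ x : X, Dense (MulAction.orbit G x))
    (hdisj : ∀ Y : GSys G, Y.Minimal → DisjointSys G X Y.carrier) :
    Dense {x : X | IsMinimalPoint G x} ∧
      ∀ Z : GSys G, Z.Minimal →
        ∀ π : X → Z.carrier, Continuous π → Function.Surjective π →
          (∀ (g : G) (x : X), π (g • x) = g • π x) → Subsingleton Z.carrier := by
  obtain ⟨x, hx⟩ := htrans
  refine ⟨?_, ?_⟩
  · by_contra hnd
    obtain ⟨p, hp⟩ : ∃ p, p ∉ closure {x : X | IsMinimalPoint G x} := by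
      by_contra h
      push Not at h
      exact hnd h
    obtain ⟨V, hV, hVc, hVs⟩ := exists_mem_nhds_isClosed_subset
      (isClosed_closure.isOpen_compl.mem_nhds hp)
    let U := interior V
    have hUo : IsOpen U := isOpen_interior
    have hpU : p ∈ U := mem_interior_iff_mem_nhds.2 hV
    have hU : ∀ z ∈ closure U, ¬ IsMinimalPoint G z := fun z hz hm =>
      hVs (closure_minimal interior_subset hVc hz) (subset_closure hm)
    obtain ⟨Y, hYc, hYne, hYi, hYm, hY1, y0, hy0, hy0C⟩ := aux_shift {g : G | g • x ∈ U}
      (aux_hole U hU x)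
    letI : MulAction G Y := subAction Y hYi
    haveI : CompactSpace Y := isCompact_iff_compactSpace.1 hYc.isCompact
    haveI : ContinuousConstSMul G Y :=
      ⟨fun g => ((continuous_const_smul g).comp continuous_subtype_val).subtype_mk _⟩
    have hval : ∀ (g : G) (y : Y), (g • y).1 = g • y.1 := fun g y => rfl
    let YS : GSys G := { carrier := Y }
    have hmin : ∀ y : Y, Dense (MulAction.orbit G y) := by
      intro y z
      rw [closure_subtype]
      have : (Subtype.val '' MulAction.orbit G y) = MulAction.orbit G y.1 := by
        ext w
        constructor
        · rintro ⟨_, ⟨g, rfl⟩, rfl⟩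
          exact ⟨g, rfl⟩
        · rintro ⟨g, rfl⟩
          exact ⟨g • y, ⟨g, rfl⟩, rfl⟩
      rw [this, hYm y.1 y.2]
      exact z.2
    let J : Set (X × Y) := {q | ∀ g : G, g • q.1 ∈ U → q.2.1 g = false}
    have hJc : IsClosed J := by
      have : J = ⋂ g : G, ({q : X × Y | g • q.1 ∈ Uᶜ} ∪ {q : X × Y | q.2.1 g = false}) := by
        ext q
        simp only [J, Set.mem_setOf_eq, Set.mem_iInter, Set.mem_union, Set.mem_compl_iff]
        exact forall_congr' fun g => imp_iff_not_or
      rw [this]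
      refine isClosed_iInter fun g => IsClosed.union ?_ ?_
      · exact hUo.isClosed_compl.preimage ((continuous_const_smul g).comp continuous_fst)
      · exact (FShift.isClosed_eq g false).preimage (continuous_subtype_val.comp continuous_snd)
    have hJi : ∀ g : G, ∀ q ∈ J, (g • q.1, g • q.2) ∈ J := by
      intro g q hq h hh
      change q.2.1 (h * g) = false
      apply hq
      rw [mul_smul]
      exact hh
    have hJ0 : (x, (⟨y0, hy0⟩ : Y)) ∈ J := fun g hg => hy0C g hg
    have hJcomp : IsCompact J := hJc.isCompact
    have hJ : IsJoining G J := by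
      refine ⟨⟨_, hJ0⟩, hJc, hJi, ?_, ?_⟩
      · have hc : IsClosed (Prod.fst '' J) := (hJcomp.image continuous_fst).isClosed
        refine Set.eq_univ_of_univ_subset ?_
        rw [← hx.closure_eq]
        apply closure_minimal _ hc
        rintro _ ⟨g, rfl⟩
        exact ⟨_, hJi g _ hJ0, rfl⟩
      · have hc : IsClosed (Prod.snd '' J) := (hJcomp.image continuous_snd).isClosed
        refine Set.eq_univ_of_univ_subset ?_
        rw [← (hmin ⟨y0, hy0⟩).closure_eq]
        apply closure_minimal _ hc
        rintro _ ⟨g, rfl⟩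
        exact ⟨_, hJi g _ hJ0, rfl⟩
    have huniv : J = Set.univ := hdisj YS hmin J hJ
    obtain ⟨s, hs⟩ := hY1 y0 hy0
    have hmem : (s⁻¹ • p, (⟨y0, hy0⟩ : Y)) ∈ J := huniv ▸ Set.mem_univ _
    have := hmem s (by simpa using hpU)
    simp only [hs] at this
    exact absurd this (by simp)
  · intro Z hZ π hπ hsurj heq
    let J : Set (X × Z.carrier) := {q | π q.1 = q.2}
    have hJ : IsJoining G J := by
      refine ⟨⟨(x, π x), rfl⟩, isClosed_eq (hπ.comp continuous_fst) continuous_snd, ?_, ?_, ?_⟩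
      · intro g q hq
        change π (g • q.1) = g • q.2
        rw [heq, show π q.1 = q.2 from hq]
      · exact Set.eq_univ_of_forall fun a => ⟨(a, π a), rfl, rfl⟩
      · refine Set.eq_univ_of_forall fun b => ?_
        obtain ⟨a, rfl⟩ := hsurj b
        exact ⟨(a, π a), rfl, rfl⟩
    have huniv : J = Set.univ := hdisj Z hZ J hJ
    have h : ∀ b, π x = b := fun b => by
      have : (x, b) ∈ J := huniv ▸ Set.mem_univ _
      exact this
    exact ⟨fun a b => (h a).symm.trans (h b)⟩
end

section
/- Let G be a countable discrete group and (X,G) a transitive G-system. Then (X,G) is disjoint with all minimal G-systems if and only if (X,G) is ∞-transitive and there is a countable dense subset D ⊂ X consisting of minimal points such that for every minimal G-system (Y,G), every y ∈ Y, every open neighborhood V of y, and every nonempty open set U ⊂ X, there is some x ∈ D ∩ U such that N_G((x,y), U×V) = {g ∈ G : gx ∈ U and gy ∈ V} is right syndetic. -/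
/-- A `G`-space is (topologically) transitive: for all nonempty open `U, V` there is
`g ∈ G` with `gU ∩ V ≠ ∅`. -/
def TransSys (G : Type) [Group G] (X : Type*) [TopologicalSpace X] [MulAction G X] : Prop :=
  ∀ U V : Set X, IsOpen U → IsOpen V → U.Nonempty → V.Nonempty →
    ∃ g : G, ((g • ·) '' U ∩ V).Nonempty

/-- `(X,G)` is ∞-transitive: the diagonal `G`-action on `X^k` is transitive for all `k ≥ 1`. -/
def InftyTransitive (G : Type) [Group G] (X : Type*) [TopologicalSpace X] [MulAction G X] :
    Prop :=
  ∀ k : ℕ, 0 < k → TransSys G (Fin k → X)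

section Helpers

open Set TopologicalSpace

variable {G : Type} [Group G]

theorem smul_mem_orbCl {A : Type*} [TopologicalSpace A] [MulAction G A] [ContinuousConstSMul G A]
    {a b : A} (h : a ∈ closure (MulAction.orbit G b)) (g : G) :
    g • a ∈ closure (MulAction.orbit G b) := by
  have h1 : MapsTo (fun x : A => g • x) (MulAction.orbit G b) (MulAction.orbit G b) := by
    rintro _ ⟨k, rfl⟩
    exact ⟨g * k, by simp [mul_smul]⟩
  exact h1.closure (continuous_const_smul g) h

theorem orbCl_subset {A : Type*} [TopologicalSpace A] [MulAction G A] {S : Set A}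
    (hS : IsClosed S) (hinv : ∀ g : G, ∀ a ∈ S, g • a ∈ S) {a : A} (ha : a ∈ S) :
    closure (MulAction.orbit G a) ⊆ S := by
  apply closure_minimal _ hS
  rintro _ ⟨k, rfl⟩
  exact hinv k a ha

theorem self_mem_orbCl {A : Type*} [TopologicalSpace A] [MulAction G A] (a : A) :
    a ∈ closure (MulAction.orbit G a) := subset_closure (MulAction.mem_orbit_self a)

theorem exists_min {A : Type*} [TopologicalSpace A] [CompactSpace A] [MulAction G A]
    [ContinuousConstSMul G A] {S : Set A} (hS : IsClosed S) (hne : S.Nonempty)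
    (hinv : ∀ g : G, ∀ a ∈ S, g • a ∈ S) : ∃ a ∈ S, IsMinimalPoint G a := by
  let P : Set (Set A) := {T | IsClosed T ∧ T.Nonempty ∧ ∀ g : G, ∀ a ∈ T, g • a ∈ T}
  obtain ⟨T, hTS, hT⟩ := zorn_superset_nonempty P (by
    intro c hc hchain hcne
    refine ⟨⋂₀ c, ⟨isClosed_sInter fun t ht => (hc ht).1, ?_, ?_⟩, fun s hs => sInter_subset_of_mem hs⟩
    · haveI : Nonempty c := hcne.to_subtype
      rw [sInter_eq_iInter]
      apply IsCompact.nonempty_iInter_of_directed_nonempty_isCompact_isClosed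
      · intro a b
        rcases hchain.total a.2 b.2 with h | h
        · exact ⟨a, subset_rfl, h⟩
        · exact ⟨b, h, subset_rfl⟩
      · exact fun i => (hc i.2).2.1
      · exact fun i => (hc i.2).1.isCompact
      · exact fun i => (hc i.2).1
    · intro g a ha t ht
      exact (hc ht).2.2 g a (ha t ht)) S ⟨hS, hne, hinv⟩
  have key : ∀ b ∈ T, closure (MulAction.orbit G b) = T := by
    intro b hb
    have h1 := orbCl_subset hT.prop.1 hT.prop.2.2 hb
    exact h1.antisymm (hT.2 (y := closure (MulAction.orbit G b))
      ⟨isClosed_closure, ⟨b, self_mem_orbCl b⟩, fun g a ha => smul_mem_orbCl ha g⟩ h1)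
  obtain ⟨a, ha⟩ := hT.prop.2.1
  refine ⟨a, hTS ha, ?_⟩
  intro y hy
  rw [key a ha] at hy ⊢
  exact key y hy

theorem IsMinimalPoint.mem_symm {A : Type*} [TopologicalSpace A] [MulAction G A] {a b : A}
    (ha : IsMinimalPoint G a) (hb : b ∈ closure (MulAction.orbit G a)) :
    a ∈ closure (MulAction.orbit G b) := by
  rw [ha b hb]; exact self_mem_orbCl a

theorem IsMinimalPoint.map {A B : Type*} [TopologicalSpace A] [CompactSpace A] [MulAction G A]
    [TopologicalSpace B] [T2Space B] [MulAction G B] (φ : A → B) (hφ : Continuous φ)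
    (heq : ∀ (g : G) a, φ (g • a) = g • φ a) {a : A} (ha : IsMinimalPoint G a) :
    IsMinimalPoint G (φ a) := by
  have key : ∀ a, closure (MulAction.orbit G (φ a)) = φ '' closure (MulAction.orbit G a) := by
    intro a
    have : MulAction.orbit G (φ a) = φ '' MulAction.orbit G a := by
      ext b; constructor
      · rintro ⟨g, rfl⟩; exact ⟨g • a, ⟨g, rfl⟩, heq g a⟩
      · rintro ⟨_, ⟨g, rfl⟩, rfl⟩; exact ⟨g, (heq g a).symm⟩
    rw [this]
    apply Subset.antisymm
    · exact closure_minimal (image_mono subset_closure)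
        (isClosed_closure.isCompact.image hφ).isClosed
    · exact image_closure_subset_closure_image hφ
  intro y hy
  rw [key] at hy
  obtain ⟨a', ha', rfl⟩ := hy
  rw [key, key, ha a' ha']

theorem IsMinimalPoint.smul {A : Type*} [TopologicalSpace A] [MulAction G A]
    [ContinuousConstSMul G A] {a : A} (ha : IsMinimalPoint G a) (g : G) :
    IsMinimalPoint G (g • a) := by
  intro y hy
  rw [MulAction.orbit_smul] at hy ⊢
  exact ha y hy

theorem finite_visit {A : Type*} [TopologicalSpace A] [MulAction G A]
    [ContinuousConstSMul G A] {K : Set A} (hK : IsCompact K) {O : Set A} (hO : IsOpen O)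
    (h : ∀ a ∈ K, ∃ g : G, g • a ∈ O) : ∃ H : Finset G, ∀ a ∈ K, ∃ g ∈ H, g • a ∈ O := by
  obtain ⟨H, hH⟩ := hK.elim_finite_subcover (fun g : G => (fun a : A => g • a) ⁻¹' O)
    (fun g => hO.preimage (continuous_const_smul g)) (by
      intro a ha
      obtain ⟨g, hg⟩ := h a ha
      exact mem_iUnion.2 ⟨g, hg⟩)
  refine ⟨H, fun a ha => ?_⟩
  obtain ⟨g, hg, hga⟩ := mem_iUnion₂.1 (hH ha)
  exact ⟨g, hg, hga⟩

/-- The subsystem carried by an orbit closure. -/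
def subSys {A : Type} [TopologicalSpace A] [CompactSpace A] [MetrizableSpace A] [MulAction G A]
    [ContinuousConstSMul G A] (v : A) : GSys G :=
  letI ma : MulAction G (closure (MulAction.orbit G v) : Set A) :=
    { smul := fun g a => ⟨g • a.1, smul_mem_orbCl a.2 g⟩
      one_smul := fun a => Subtype.ext (one_smul G a.1)
      mul_smul := fun g h a => Subtype.ext (mul_smul g h a.1) }
  { carrier := (closure (MulAction.orbit G v) : Set A)
    cs := isCompact_iff_compactSpace.1 isClosed_closure.isCompact
    ma := ma
    cts := ⟨fun g => Continuous.subtype_mk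
      ((continuous_const_smul g).comp continuous_subtype_val) _⟩ }

theorem disj_use {X : Type} [TopologicalSpace X] [CompactSpace X] [MulAction G X]
    (hdis : ∀ Y : GSys G, Y.Minimal → DisjointSys G X Y.carrier)
    {A : Type} [TopologicalSpace A] [CompactSpace A] [MetrizableSpace A] [MulAction G A]
    [ContinuousConstSMul G A] {v : A} (hv : IsMinimalPoint G v) (J : Set (X × A))
    (hJ : IsClosed J) (hinv : ∀ g : G, ∀ p ∈ J, (g • p.1, g • p.2) ∈ J)
    (hproj : ∀ x, ∃ a ∈ closure (MulAction.orbit G v), (x, a) ∈ J) (x : X) (a : A)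
    (ha : a ∈ closure (MulAction.orbit G v)) : (x, a) ∈ J := by
  have hmin : (subSys (G := G) v).Minimal := by
    intro y
    change Dense (MulAction.orbit G y)
    rw [dense_iff_closure_eq, eq_univ_iff_forall]
    intro b
    have hb : b.1 ∈ closure (MulAction.orbit G y.1) := by
      rw [hv y.1 y.2]; exact b.2
    refine mem_closure_iff.2 fun O hO hbO => ?_
    obtain ⟨O', hO', rfl⟩ := (isOpen_induced_iff (f := Subtype.val)).1 hO
    obtain ⟨_, hc, ⟨g, rfl⟩⟩ := mem_closure_iff.1 hb O' hO' hbO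
    exact ⟨g • y, hc, ⟨g, rfl⟩⟩
  let J' : Set (X × (subSys (G := G) v).carrier) := {p | (p.1, (p.2 : closure (MulAction.orbit G v)).1) ∈ J}
  have hJ'c : IsClosed J' := by
    apply hJ.preimage (f := fun p : X × (closure (MulAction.orbit G v) : Set A) => (p.1, p.2.1))
    fun_prop
  have hJ'i : ∀ g : G, ∀ p ∈ J', (g • p.1, g • p.2) ∈ J' := by
    intro g p hp
    exact hinv g _ hp
  have hmem : ∀ x, ∃ b, (x, b) ∈ J' := by
    intro x
    obtain ⟨a, ha, h⟩ := hproj x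
    exact ⟨⟨a, ha⟩, h⟩
  have := hdis _ hmin J' ⟨?_, hJ'c, hJ'i, ?_, ?_⟩
  · have h2 : (x, (⟨a, ha⟩ : (closure (MulAction.orbit G v) : Set A))) ∈ J' := by
      rw [this]; trivial
    exact h2
  · obtain ⟨b, hb⟩ := hmem x
    exact ⟨_, hb⟩
  · rw [eq_univ_iff_forall]
    intro x
    obtain ⟨b, hb⟩ := hmem x
    exact ⟨_, hb, rfl⟩
  · obtain ⟨b, hb⟩ := hmem x
    have hcl : IsClosed (Prod.snd '' J') := (hJ'c.isCompact.image continuous_snd).isClosed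
    have h3 := orbCl_subset (G := G) hcl (by
      rintro g _ ⟨p, hp, rfl⟩
      exact ⟨_, hJ'i g p hp, rfl⟩) ⟨_, hb, rfl⟩
    rw [(hmin b).closure_eq] at h3
    exact univ_subset_iff.1 h3

theorem exists_transPt [Countable G] {X : Type} [TopologicalSpace X] [CompactSpace X]
    [MetrizableSpace X] [MulAction G X] [ContinuousConstSMul G X] (htrans : TransSys G X)
    [Nonempty X] : ∃ x : X, Dense (MulAction.orbit G x) := by
  letI := metrizableSpaceMetric X
  have hB := isBasis_countableBasis X
  have hd : Dense (⋂ U ∈ countableBasis X, ⋃ g : G, (fun x : X => g • x) ⁻¹' U) := by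
    apply dense_biInter_of_isOpen
    · intro U hU
      exact isOpen_iUnion fun g => (hB.isOpen hU).preimage (continuous_const_smul g)
    · exact countable_countableBasis X
    · intro U hU
      rw [dense_iff_inter_open]
      intro W hW hWne
      obtain ⟨g, _, ⟨x, hx, rfl⟩, hx2⟩ := htrans W U hW (hB.isOpen hU) hWne
        (nonempty_of_mem_countableBasis hU)
      exact ⟨x, hx, mem_iUnion.2 ⟨g, hx2⟩⟩
  obtain ⟨x, hx⟩ := hd.nonempty
  refine ⟨x, ?_⟩
  rw [hB.dense_iff]
  intro U hU _
  obtain ⟨g, hg⟩ := mem_iUnion.1 (mem_iInter₂.1 hx U hU)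
  exact ⟨_, hg, ⟨g, rfl⟩⟩

/-- A closed invariant set meeting a dense subset of an open set is everything. -/
theorem trans_full {X : Type} [TopologicalSpace X] [MulAction G X] [ContinuousConstSMul G X]
    (htrans : TransSys G X) {P : Set X} (hP : IsClosed P)
    (hinv : ∀ g : G, ∀ a ∈ P, g • a ∈ P) {U : Set X} (hU : IsOpen U) (hne : U.Nonempty)
    (hUP : U ⊆ P) : P = univ := by
  by_contra h
  obtain ⟨g, _, ⟨x, hx, rfl⟩, hx2⟩ := htrans U Pᶜ hU hP.isOpen_compl hne
    (nonempty_compl.2 h)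
  exact hx2 (hinv g x (hUP hx))

theorem lemmaA {X : Type} [TopologicalSpace X] [CompactSpace X] [MetrizableSpace X]
    [MulAction G X] [ContinuousConstSMul G X] (htrans : TransSys G X)
    (hdis : ∀ Y : GSys G, Y.Minimal → DisjointSys G X Y.carrier)
    (hD : Dense {x : X | IsMinimalPoint G x})
    {A : Type} [TopologicalSpace A] [CompactSpace A] [MetrizableSpace A] [MulAction G A]
    [ContinuousConstSMul G A] {v : A} (hv : IsMinimalPoint G v) {U U' : Set X} (hU : IsOpen U)
    (hUne : U.Nonempty) (hU' : IsOpen U') (hUne' : U'.Nonempty) {V : Set A} (hV : IsOpen V)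
    {v' : A} (hv' : v' ∈ closure (MulAction.orbit G v)) (hvV : v' ∈ V) :
    ∃ z ∈ U, IsMinimalPoint G z ∧ ∀ w ∈ closure (MulAction.orbit G z),
      ∃ g : G, g • w ∈ U' ∧ g • v ∈ V := by
  by_contra! hcon
  let J : Set (X × A) := {p | ∀ g : G, ¬ (g • p.1 ∈ U' ∧ g • p.2 ∈ V)}
  have hJ : IsClosed J := by
    have : J = ⋂ g : G, {p : X × A | (g • p.1 ∈ U' ∧ g • p.2 ∈ V)}ᶜ := by
      ext p; simp [J]
    rw [this]
    refine isClosed_iInter fun g => IsOpen.isClosed_compl ?_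
    exact (hU'.preimage (by fun_prop : Continuous fun p : X × A => g • p.1)).inter
      (hV.preimage (by fun_prop : Continuous fun p : X × A => g • p.2))
  have hJi : ∀ g : G, ∀ p ∈ J, (g • p.1, g • p.2) ∈ J := by
    intro g p hp k
    have := hp (k * g)
    simpa [mul_smul] using this
  let P : Set X := Prod.fst '' (J ∩ (univ ×ˢ closure (MulAction.orbit G v)))
  have hP : IsClosed P := by
    have : IsClosed (J ∩ (univ ×ˢ closure (MulAction.orbit G v))) :=
      hJ.inter (isClosed_univ.prod isClosed_closure)
    exact (this.isCompact.image continuous_fst).isClosed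
  have hPi : ∀ g : G, ∀ a ∈ P, g • a ∈ P := by
    rintro g _ ⟨p, ⟨hp1, hp2⟩, rfl⟩
    exact ⟨(g • p.1, g • p.2), ⟨hJi g p hp1, trivial, smul_mem_orbCl hp2.2 g⟩, rfl⟩
  have hUP : U ⊆ P := by
    have h1 : U ∩ {x : X | IsMinimalPoint G x} ⊆ P := by
      rintro z ⟨hzU, hz⟩
      obtain ⟨w, hw, hwg⟩ := hcon z hzU hz
      have hwP : w ∈ P := by
        refine ⟨(w, v), ⟨fun g hg => hwg g hg.1 hg.2, trivial, self_mem_orbCl v⟩, rfl⟩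
      exact orbCl_subset hP hPi hwP (hz.mem_symm hw)
    exact (hD.open_subset_closure_inter hU).trans (closure_minimal h1 hP)
  have hPu := trans_full htrans hP hPi hU hUne hUP
  obtain ⟨x, hx⟩ := hUne'
  have := disj_use hdis hv J hJ hJi (by
    intro x
    have : x ∈ P := by rw [hPu]; trivial
    obtain ⟨p, ⟨hp1, hp2⟩, rfl⟩ := this
    exact ⟨p.2, hp2.2, hp1⟩) x v' hv'
  exact this 1 (by simpa using ⟨hx, hvV⟩)

theorem claimB {X : Type} [TopologicalSpace X] [CompactSpace X] [MetrizableSpace X]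
    [MulAction G X] [ContinuousConstSMul G X] (htrans : TransSys G X)
    (hdis : ∀ Y : GSys G, Y.Minimal → DisjointSys G X Y.carrier)
    (hD : Dense {x : X | IsMinimalPoint G x})
    (w : {x : X // IsMinimalPoint G x} → X) (hw : IsMinimalPoint G w)
    (hwz : ∀ z, w z ∈ closure (MulAction.orbit G z.1)) :
    ∀ (n : ℕ) (U W : Fin n → Set X), (∀ i, IsOpen (U i)) → (∀ i, IsOpen (W i)) →
      (∀ i, (U i).Nonempty) → (∀ i, (W i).Nonempty) →
      ∃ z : Fin n → {x : X // IsMinimalPoint G x}, (∀ i, (z i).1 ∈ U i) ∧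
        ∃ g : G, ∀ i, g • w (z i) ∈ W i := by
  intro n
  induction n with
  | zero =>
    intro U W _ _ _ _
    exact ⟨Fin.elim0, fun i => i.elim0, 1, fun i => i.elim0⟩
  | succ n ih =>
    intro U W hU hW hUn hWn
    obtain ⟨z, hz, g, hg⟩ := ih (fun i => U i.succ) (fun i => W i.succ) (fun i => hU _)
      (fun i => hW _) (fun i => hUn _) (fun i => hWn _)
    have hv : IsMinimalPoint G (fun i => w (z i)) :=
      hw.map (fun w i => w (z i)) (by fun_prop) (fun g a => rfl)
    have hV : IsOpen {a : Fin n → X | ∀ i, a i ∈ W i.succ} := by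
      simp only [ofPred_forall]
      exact isOpen_iInter_of_finite fun i => (hW i.succ).preimage (continuous_apply i)
    obtain ⟨z0, hz0U, hz0, h0⟩ := lemmaA htrans hdis hD hv (hU 0) (hUn 0) (hW 0) (hWn 0) hV
      (v' := g • (fun i => w (z i))) (smul_mem_orbCl (self_mem_orbCl _) g) hg
    obtain ⟨k, hk1, hk2⟩ := h0 _ (hwz ⟨z0, hz0⟩)
    refine ⟨Fin.cons ⟨z0, hz0⟩ z, ?_, k, ?_⟩
    · intro i
      refine Fin.cases ?_ (fun j => ?_) i
      · simpa using hz0U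
      · simpa using hz j
    · intro i
      refine Fin.cases ?_ (fun j => ?_) i
      · simpa using hk1
      · simpa using hk2 j

theorem inftyTrans_of {X : Type} [TopologicalSpace X] [CompactSpace X] [MetrizableSpace X]
    [MulAction G X] [ContinuousConstSMul G X] (htrans : TransSys G X)
    (hdis : ∀ Y : GSys G, Y.Minimal → DisjointSys G X Y.carrier)
    (hD : Dense {x : X | IsMinimalPoint G x}) : InftyTransitive G X := by
  intro k _ U V hU hV ⟨u, hu⟩ ⟨v, hv⟩
  obtain ⟨U', hU', hU'2⟩ := isOpen_pi_iff'.1 hU u hu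
  obtain ⟨V', hV', hV'2⟩ := isOpen_pi_iff'.1 hV v hv
  obtain ⟨w, hw, hwm⟩ := exists_min (G := G)
    (S := closure (MulAction.orbit G (fun z : {x : X // IsMinimalPoint G x} => z.1)))
    isClosed_closure ⟨_, self_mem_orbCl _⟩ (fun g a ha => smul_mem_orbCl ha g)
  have hwz : ∀ z, w z ∈ closure (MulAction.orbit G z.1) := by
    intro z
    have : MapsTo (fun a : {x : X // IsMinimalPoint G x} → X => a z)
        (MulAction.orbit G (fun z : {x : X // IsMinimalPoint G x} => z.1))
        (MulAction.orbit G z.1) := by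
      rintro _ ⟨g, rfl⟩; exact ⟨g, rfl⟩
    exact this.closure (continuous_apply z) hw
  obtain ⟨z, hz, g, hg⟩ := claimB htrans hdis hD w hwm hwz k U' V' (fun i => (hU' i).1)
    (fun i => (hV' i).1) (fun i => ⟨_, (hU' i).2⟩) (fun i => ⟨_, (hV' i).2⟩)
  have hO : IsOpen {a : {x : X // IsMinimalPoint G x} → X | ∀ i, g • a (z i) ∈ V' i} := by
    simp only [ofPred_forall]
    refine isOpen_iInter_of_finite fun i => (hV' i).1.preimage ?_
    fun_prop
  obtain ⟨_, ha, ⟨h, rfl⟩⟩ := mem_closure_iff.1 hw _ hO hg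
  refine ⟨g * h, _, ⟨fun i => (z i).1, hU'2 fun i _ => hz i, rfl⟩, hV'2 fun i _ => ?_⟩
  have := ha i
  simpa [mul_smul] using this

theorem exists_E {X : Type} [TopologicalSpace X] [CompactSpace X] [MetrizableSpace X]
    [MulAction G X] [ContinuousConstSMul G X] (htrans : TransSys G X)
    (hdis : ∀ Y : GSys G, Y.Minimal → DisjointSys G X Y.carrier)
    (hD : Dense {x : X | IsMinimalPoint G x}) {U : Set X} (hU : IsOpen U) (hUn : U.Nonempty)
    (F : Finset G) : ∃ E : Finset {x : X // IsMinimalPoint G x}, (∀ z ∈ E, z.1 ∈ U) ∧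
      ∀ w : {x : X // IsMinimalPoint G x} → X, (∀ z, w z ∈ closure (MulAction.orbit G z.1)) →
        ∃ g : G, ∀ f ∈ F, ∃ z ∈ E, f⁻¹ • g • w z ∈ U := by
  classical
  let M := {x : X // IsMinimalPoint G x}
  let Ω : Set (M → X) := {w | ∀ z, w z ∈ closure (MulAction.orbit G z.1)}
  have hΩ : IsClosed Ω := by
    have : Ω = ⋂ z : M, (fun w : M → X => w z) ⁻¹' closure (MulAction.orbit G z.1) := by
      ext w; simp [Ω]
    rw [this]
    exact isClosed_iInter fun z => isClosed_closure.preimage (continuous_apply z)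
  have hΩi : ∀ g : G, ∀ w ∈ Ω, g • w ∈ Ω := fun g w hw z => smul_mem_orbCl (hw z) g
  let I := {E : Finset M // ∀ z ∈ E, z.1 ∈ U}
  let O : I → Set (M → X) := fun E => ⋃ g : G, ⋂ f ∈ F, ⋃ z ∈ E.1,
    (fun w : M → X => f⁻¹ • g • w z) ⁻¹' U
  have hOo : ∀ E, IsOpen (O E) := by
    intro E
    refine isOpen_iUnion fun g => isOpen_biInter_finset fun f _ => isOpen_biUnion fun z _ => ?_
    exact hU.preimage (by fun_prop)
  have hOmem : ∀ (E : I) w, w ∈ O E ↔ ∃ g : G, ∀ f ∈ F, ∃ z ∈ E.1, f⁻¹ • g • w z ∈ U := by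
    intro E w; simp [O]
  haveI : Nonempty I := ⟨⟨∅, by simp⟩⟩
  obtain ⟨E, hE⟩ := hΩ.isCompact.elim_directed_cover O hOo (by
    intro w hw
    obtain ⟨w', hw', hmin⟩ := exists_min (G := G) (S := closure (MulAction.orbit G w))
      isClosed_closure ⟨_, self_mem_orbCl _⟩ (fun g a ha => smul_mem_orbCl ha g)
    have hw'Ω : w' ∈ Ω := orbCl_subset hΩ hΩi hw hw'
    obtain ⟨z, hz, g, hg⟩ := claimB htrans hdis hD w' hmin hw'Ω F.card (fun _ => U)
      (fun i => (fun x : X => ((F.equivFin.symm i : F) : G)⁻¹ • x) ⁻¹' U) (fun _ => hU)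
      (fun i => hU.preimage (continuous_const_smul _)) (fun _ => hUn)
      (fun i => by
        obtain ⟨x, hx⟩ := hUn
        exact ⟨((F.equivFin.symm i : F) : G) • x, by simpa using hx⟩)
    let E : I := ⟨Finset.univ.image z, by
      intro a ha
      obtain ⟨i, -, rfl⟩ := Finset.mem_image.1 ha
      exact hz i⟩
    have h1 : w' ∈ O E := by
      rw [hOmem]
      refine ⟨g, fun f hf => ⟨z (F.equivFin ⟨f, hf⟩), Finset.mem_image_of_mem _ (Finset.mem_univ _), ?_⟩⟩
      simpa using hg (F.equivFin ⟨f, hf⟩)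
    obtain ⟨_, ha, ⟨h, rfl⟩⟩ := mem_closure_iff.1 hw' _ (hOo E) h1
    refine mem_iUnion.2 ⟨E, ?_⟩
    rw [hOmem] at ha ⊢
    obtain ⟨g, hg⟩ := ha
    refine ⟨g * h, fun f hf => ?_⟩
    obtain ⟨z, hz, hzU⟩ := hg f hf
    exact ⟨z, hz, by simpa [mul_smul] using hzU⟩) (by
    intro E1 E2
    refine ⟨⟨E1.1 ∪ E2.1, ?_⟩, ?_, ?_⟩
    · intro z hz
      rcases Finset.mem_union.1 hz with h | h
      · exact E1.2 z h
      · exact E2.2 z h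
    · intro w hw
      rw [hOmem] at hw ⊢
      obtain ⟨g, hg⟩ := hw
      refine ⟨g, fun f hf => ?_⟩
      obtain ⟨z, hz, h⟩ := hg f hf
      exact ⟨z, Finset.mem_union_left _ hz, h⟩
    · intro w hw
      rw [hOmem] at hw ⊢
      obtain ⟨g, hg⟩ := hw
      refine ⟨g, fun f hf => ?_⟩
      obtain ⟨z, hz, h⟩ := hg f hf
      exact ⟨z, Finset.mem_union_right _ hz, h⟩)
  exact ⟨E.1, E.2, fun w hw => (hOmem E w).1 (hE hw)⟩

theorem exists_of_not_syndetic {X Y : Type} [TopologicalSpace X] [CompactSpace X]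
    [MulAction G X] [ContinuousConstSMul G X] [TopologicalSpace Y] [CompactSpace Y] [T2Space Y]
    [MulAction G Y] [ContinuousConstSMul G Y] (hY : ∀ y : Y, Dense (MulAction.orbit G y))
    {z : X} {y : Y} {U : Set X} {V : Set Y} (hU : IsOpen U) (hV : IsOpen V)
    (h : ¬ RightSyndetic {g : G | g • z ∈ U ∧ g • y ∈ V}) :
    ∃ w ∈ closure (MulAction.orbit G z), ∀ g : G, ¬ (g • w ∈ U ∧ g • y ∈ V) := by
  classical
  by_contra! hcon
  apply h
  let K : Set (X × Y) := closure (MulAction.orbit G z) ×ˢ univ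
  have hK : IsClosed K := isClosed_closure.prod isClosed_univ
  have hvis : ∀ p ∈ K, ∃ g : G, g • p ∈ U ×ˢ V := by
    by_contra! hp
    obtain ⟨p, hpK, hp⟩ := hp
    let J : Set (X × Y) := K ∩ ⋂ g : G, ((fun p : X × Y => g • p) ⁻¹' (U ×ˢ V))ᶜ
    have hJ : IsClosed J := hK.inter (isClosed_iInter fun g =>
      ((hU.prod hV).preimage (continuous_const_smul g)).isClosed_compl)
    have hmem : ∀ q, q ∈ J ↔ q ∈ K ∧ ∀ g : G, g • q ∉ U ×ˢ V := by
      intro q; simp [J]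
    have hJi : ∀ g : G, ∀ q ∈ J, g • q ∈ J := by
      intro g q hq
      rw [hmem] at hq ⊢
      refine ⟨⟨smul_mem_orbCl hq.1.1 g, trivial⟩, fun k => ?_⟩
      rw [← mul_smul]; exact hq.2 _
    have hcl : IsClosed (Prod.snd '' J) := (hJ.isCompact.image continuous_snd).isClosed
    have h3 := orbCl_subset (G := G) (a := p.2) hcl (by
      rintro g _ ⟨p, hp, rfl⟩
      exact ⟨_, hJi g p hp, rfl⟩) ⟨p, (hmem p).2 ⟨hpK, hp⟩, rfl⟩
    rw [(hY p.2).closure_eq] at h3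
    obtain ⟨q, hq, hqy⟩ := h3 (mem_univ y)
    rw [hmem] at hq
    obtain ⟨g, hg1, hg2⟩ := hcon q.1 hq.1.1
    exact hq.2 g ⟨hg1, by rw [← hqy] at hg2; exact hg2⟩
  obtain ⟨H, hH⟩ := finite_visit hK.isCompact (hU.prod hV) hvis
  refine ⟨H.image (·⁻¹), fun g => ?_⟩
  obtain ⟨k, hk, hkk⟩ := hH (g • z, g • y) ⟨smul_mem_orbCl (self_mem_orbCl z) g, trivial⟩
  refine ⟨k⁻¹, Finset.mem_image_of_mem _ hk, ?_⟩
  have h1 : k • g • z ∈ U := hkk.1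
  have h2 : k • g • y ∈ V := hkk.2
  exact ⟨by simpa [mul_smul] using h1, by simpa [mul_smul] using h2⟩

theorem exists_D [Countable G] {X : Type} [TopologicalSpace X] [CompactSpace X]
    [MetrizableSpace X] [MulAction G X] [ContinuousConstSMul G X] (htrans : TransSys G X)
    (hdis : ∀ Y : GSys G, Y.Minimal → DisjointSys G X Y.carrier)
    (hD : Dense {x : X | IsMinimalPoint G x}) :
    ∃ D : Set X, D.Countable ∧ Dense D ∧ (∀ x ∈ D, IsMinimalPoint G x) ∧
          ∀ Y : GSys G, Y.Minimal → ∀ (y : Y.carrier) (V : Set Y.carrier),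
            IsOpen V → y ∈ V → ∀ U : Set X, IsOpen U → U.Nonempty →
              ∃ x ∈ D ∩ U, RightSyndetic {g : G | g • x ∈ U ∧ g • y ∈ V} := by
  classical
  letI := metrizableSpaceMetric X
  have hB := isBasis_countableBasis X
  have hex : ∀ (U : countableBasis X) (F : Finset G), ∃ E : Finset {x : X // IsMinimalPoint G x},
      (∀ z ∈ E, z.1 ∈ U.1) ∧ ∀ w : {x : X // IsMinimalPoint G x} → X,
        (∀ z, w z ∈ closure (MulAction.orbit G z.1)) →
        ∃ g : G, ∀ f ∈ F, ∃ z ∈ E, f⁻¹ • g • w z ∈ U.1 := fun U F =>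
    exists_E htrans hdis hD (hB.isOpen U.2) (nonempty_of_mem_countableBasis U.2) F
  choose E hE1 hE2 using hex
  let D : Set X := ⋃ U : countableBasis X, ⋃ F : Finset G, Subtype.val '' (↑(E U F) : Set {x : X // IsMinimalPoint G x})
  haveI : Countable (countableBasis X) := (countable_countableBasis X).to_subtype
  have hbas : ∀ U : Set X, IsOpen U → U.Nonempty → ∃ U0 : countableBasis X, U0.1 ⊆ U := by
    rintro U hU ⟨x, hx⟩
    obtain ⟨U0, h0, -, h⟩ := hB.exists_subset_of_mem_open hx hU
    exact ⟨⟨U0, h0⟩, h⟩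
  have hmemD : ∀ U F z, z ∈ E U F → z.1 ∈ D := fun U F z hz =>
    mem_iUnion₂.2 ⟨U, F, z, hz, rfl⟩
  refine ⟨D, ?_, ?_, ?_, ?_⟩
  · exact countable_iUnion fun U => countable_iUnion fun F =>
      ((E U F).finite_toSet.image _).countable
  · rw [dense_iff_inter_open]
    intro U hU hUn
    obtain ⟨U0, h0⟩ := hbas U hU hUn
    obtain ⟨g, hg⟩ := hE2 U0 {1} (fun z => z.1) (fun z => self_mem_orbCl _)
    obtain ⟨z, hz, -⟩ := hg 1 (by simp)
    exact ⟨z.1, h0 (hE1 _ _ z hz), hmemD _ _ z hz⟩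
  · intro x hx
    obtain ⟨U, F, z, hz, rfl⟩ := mem_iUnion₂.1 hx
    exact z.2
  · intro Y hY y V hV hyV U hU hUn
    by_contra! hcon
    obtain ⟨U0, h0⟩ := hbas U hU hUn
    obtain ⟨H, hH⟩ := finite_visit (G := G) (K := (univ : Set Y.carrier)) isCompact_univ hV (by
      intro a _
      obtain ⟨_, hb, ⟨g, rfl⟩⟩ := (hY a).inter_open_nonempty V hV ⟨y, hyV⟩
      exact ⟨g, hb⟩)
    have hw : ∀ z : {x : X // IsMinimalPoint G x}, ∃ w ∈ closure (MulAction.orbit G z.1),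
        z ∈ E U0 (H.image (·⁻¹)) → ∀ g : G, ¬ (g • w ∈ U ∧ g • y ∈ V) := by
      intro z
      by_cases hz : z ∈ E U0 (H.image (·⁻¹))
      · obtain ⟨w, hw, hh⟩ := exists_of_not_syndetic hY hU hV
          (hcon z.1 ⟨hmemD _ _ z hz, h0 (hE1 _ _ z hz)⟩)
        exact ⟨w, hw, fun _ => hh⟩
      · exact ⟨z.1, self_mem_orbCl _, fun h => absurd h hz⟩
    choose w hw1 hw2 using hw
    obtain ⟨g, hg⟩ := hE2 U0 (H.image (·⁻¹)) w hw1
    obtain ⟨h, hhH, hhV⟩ := hH (g • y) trivial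
    obtain ⟨z, hz, hzU⟩ := hg h⁻¹ (Finset.mem_image_of_mem _ hhH)
    refine hw2 z hz (h * g) ⟨?_, ?_⟩
    · apply h0; simpa [mul_smul] using hzU
    · simpa [mul_smul] using hhV

theorem reverse_dir {X : Type} [TopologicalSpace X] [CompactSpace X]
    [MetrizableSpace X] [MulAction G X] [ContinuousConstSMul G X] (hinf : InftyTransitive G X)
    {D : Set X} (hDc : D.Countable)
    (hDs : ∀ Y : GSys G, Y.Minimal → ∀ (y : Y.carrier) (V : Set Y.carrier),
            IsOpen V → y ∈ V → ∀ U : Set X, IsOpen U → U.Nonempty →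
              ∃ x ∈ D ∩ U, RightSyndetic {g : G | g • x ∈ U ∧ g • y ∈ V})
    (Y : GSys G) (hY : Y.Minimal) : DisjointSys G X Y.carrier := by
  letI := metrizableSpaceMetric X
  rintro J ⟨⟨p0, hp0⟩, hJ, hJi, hJ1, hJ2⟩
  haveI : Nonempty X := ⟨p0.1⟩
  -- a point proximal to all points of `D`
  have hprox : ∀ (z : X) (ε : ℝ), 0 < ε → Dense {x : X | ∃ g : G, dist (g • x) (g • z) < ε} := by
    intro z ε hε
    rw [dense_iff_inter_open]
    intro U hU hUn
    obtain ⟨t, -, htf, ht⟩ := finite_cover_balls_of_compact (isCompact_univ (X := X)) (half_pos hε)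
    obtain ⟨n, e, he⟩ := htf.fin_param
    have hn : 0 < n := by
      obtain ⟨c, hc, -⟩ := mem_iUnion₂.1 (ht (mem_univ p0.1))
      rw [← he.2] at hc
      obtain ⟨i, -⟩ := hc
      exact i.pos
    obtain ⟨g, _, ⟨a, ha, rfl⟩, ha2⟩ := hinf n hn (univ.pi fun _ => U)
      (univ.pi fun i => Metric.ball (e i) (ε / 2))
      (isOpen_set_pi finite_univ fun _ _ => hU)
      (isOpen_set_pi finite_univ fun _ _ => Metric.isOpen_ball)
      (univ_pi_nonempty_iff.2 fun _ => hUn)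
      (univ_pi_nonempty_iff.2 fun i => ⟨e i, Metric.mem_ball_self (half_pos hε)⟩)
    obtain ⟨c, hc, hzc⟩ := mem_iUnion₂.1 (ht (mem_univ (g • z)))
    rw [← he.2] at hc
    obtain ⟨i, rfl⟩ := hc
    refine ⟨a i, ha i trivial, g, ?_⟩
    have h1 : dist (g • a i) (e i) < ε / 2 := ha2 i trivial
    have h2 : dist (g • z) (e i) < ε / 2 := hzc
    have := dist_triangle_right (g • a i) (g • z) (e i)
    linarith
  haveI : Countable D := hDc.to_subtype
  have hd : Dense (⋂ q : D × ℕ, {x : X | ∃ g : G, dist (g • x) (g • q.1.1) < 1 / ((q.2 : ℝ) + 1)}) := by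
    apply dense_iInter_of_isOpen
    · intro q
      have : {x : X | ∃ g : G, dist (g • x) (g • q.1.1) < 1 / ((q.2 : ℝ) + 1)} =
          ⋃ g : G, {x : X | dist (g • x) (g • q.1.1) < 1 / ((q.2 : ℝ) + 1)} := by
        ext; simp
      rw [this]
      exact isOpen_iUnion fun g => isOpen_lt (by fun_prop) continuous_const
    · intro q
      exact hprox _ _ (by positivity)
  obtain ⟨x, hx⟩ := hd.nonempty
  have hx' : ∀ z ∈ D, ∀ ε : ℝ, 0 < ε → ∃ g : G, dist (g • x) (g • z) < ε := by
    intro z hz ε hε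
    obtain ⟨n, hn⟩ := exists_nat_one_div_lt hε
    obtain ⟨g, hg⟩ := mem_iInter.1 hx (⟨z, hz⟩, n)
    exact ⟨g, hg.trans hn⟩
  -- uniform version
  have hx'' : ∀ z ∈ D, ∀ (F : Finset G) (ε : ℝ), 0 < ε →
      ∃ g : G, ∀ f ∈ F, dist (f⁻¹ • g • x) (f⁻¹ • g • z) < ε := by
    intro z hz F ε hε
    have huc : ∀ f : G, ∃ δ > 0, ∀ a b : X, dist a b < δ → dist (f⁻¹ • a) (f⁻¹ • b) < ε := by
      intro f
      have := CompactSpace.uniformContinuous_of_continuous (continuous_const_smul (f⁻¹) : Continuous fun a : X => f⁻¹ • a)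
      obtain ⟨δ, hδ, h⟩ := Metric.uniformContinuous_iff.1 this ε hε
      exact ⟨δ, hδ, fun a b hab => h hab⟩
    choose δ hδ hh using huc
    have : ∃ η > 0, ∀ f ∈ F, η ≤ δ f := by
      rcases F.eq_empty_or_nonempty with rfl | hF
      · exact ⟨1, one_pos, by simp⟩
      · refine ⟨F.inf' hF δ, ?_, fun f hf => Finset.inf'_le _ hf⟩
        rw [gt_iff_lt, Finset.lt_inf'_iff]
        exact fun f _ => hδ f
    obtain ⟨η, hη, hηF⟩ := this
    obtain ⟨g, hg⟩ := hx' z hz η hη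
    exact ⟨g, fun f hf => hh f _ _ (hg.trans_le (hηF f hf))⟩
  obtain ⟨p, hp, hpx⟩ : x ∈ Prod.fst '' J := by rw [hJ1]; trivial
  rw [eq_univ_iff_forall]
  rintro ⟨a, b⟩
  rw [← hJ.closure_eq, mem_closure_iff]
  intro O hO hab
  obtain ⟨U, V, hU, hV, haU, hbV, hUV⟩ := isOpen_prod_iff.1 hO a b hab
  obtain ⟨_, hk, ⟨k, rfl⟩⟩ := (hY p.2).inter_open_nonempty V hV ⟨b, hbV⟩
  have hU' : IsOpen ((fun u : X => k • u) ⁻¹' U) := hU.preimage (continuous_const_smul k)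
  obtain ⟨ε, hε, hball⟩ := Metric.isOpen_iff.1 hU' (k⁻¹ • a) (by simpa using haU)
  obtain ⟨z, ⟨hzD, hzU⟩, F, hF⟩ := hDs Y hY p.2 ((fun u : Y.carrier => k • u) ⁻¹' V)
    (hV.preimage (continuous_const_smul k)) hk (Metric.ball (k⁻¹ • a) (ε / 2))
    Metric.isOpen_ball ⟨k⁻¹ • a, Metric.mem_ball_self (half_pos hε)⟩
  obtain ⟨g, hg⟩ := hx'' z hzD F (ε / 2) (half_pos hε)
  obtain ⟨f, hfF, hf1, hf2⟩ := hF g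
  have h1 : dist (f⁻¹ • g • z) (k⁻¹ • a) < ε / 2 := by
    rw [← mul_smul]; exact hf1
  have h2 := hg f hfF
  have h3 : f⁻¹ • g • x ∈ Metric.ball (k⁻¹ • a) ε := by
    have := dist_triangle (f⁻¹ • g • x) (f⁻¹ • g • z) (k⁻¹ • a)
    rw [Metric.mem_ball]
    linarith
  have h4 : k • f⁻¹ • g • x ∈ U := hball h3
  have h5 : k • (f⁻¹ * g) • p.2 ∈ V := hf2
  refine ⟨((k * (f⁻¹ * g)) • p.1, (k * (f⁻¹ * g)) • p.2), hUV ⟨?_, ?_⟩, hJi _ p hp⟩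
  · rw [hpx]; simpa only [mul_smul] using h4
  · simpa only [mul_smul] using h5

/-- Every member of the family is covered by a right translate of `N`. -/
def GoodFam (N : Set G) (T : Set (Set G)) : Prop :=
  ∀ A ∈ T, ∃ t : G, ∀ a ∈ A, a * t⁻¹ ∈ N

/-- A right translate of `D` meets at most one member of the family. -/
def SepFam (D : Finset G) (T : Set (Set G)) : Prop :=
  ∀ A ∈ T, ∀ B ∈ T, ∀ g : G, (∃ d ∈ D, d * g ∈ A) → (∃ d ∈ D, d * g ∈ B) → A = B

theorem comb_avoid {N : Set G} {L H D : Finset G}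
    (hH : ∀ g : G, ∃ h ∈ H, ∀ f ∈ L, f * h * g ∉ N) {T : Set (Set G)} (hT : GoodFam N T)
    (hD : ∀ l ∈ L, ∀ h ∈ H, l * h ∈ D) (hs : SepFam D T) (g : G) :
    ∃ h ∈ H, ∀ A ∈ T, ∀ l ∈ L, l * h * g ∉ A := by
  by_cases hex : ∃ A ∈ T, ∃ l ∈ L, ∃ h ∈ H, l * h * g ∈ A
  · obtain ⟨A, hA, l, hl, h, hh, hm⟩ := hex
    obtain ⟨t, ht⟩ := hT A hA
    obtain ⟨h', hh', hav⟩ := hH (g * t⁻¹)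
    refine ⟨h', hh', fun B hB l' hl' hm' => ?_⟩
    have hAB : A = B := hs A hA B hB g ⟨l * h, hD l hl h hh, hm⟩ ⟨l' * h', hD l' hl' h' hh', hm'⟩
    subst hAB
    have := ht _ hm'
    exact hav l' hl' (by simpa [mul_assoc] using this)
  · push Not at hex
    obtain ⟨h, hh, -⟩ := hH 1
    exact ⟨h, hh, fun A hA l hl => hex A hA l hl h hh⟩

theorem comb_step {N : Set G}
    (hN : ∀ F : Finset G, ∃ H : Finset G, ∀ g : G, ∃ h ∈ H, ∀ f ∈ F, f * h * g ∉ N)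
    (P : Finset G) (hP : ∀ p ∈ P, p ∈ N) (D : Finset G) :
    ∃ Dt H' : Finset G, ∀ T : Set (Set G), GoodFam N T → SepFam Dt T →
      ∃ T' : Set (Set G), T ⊆ T' ∧ GoodFam N T' ∧ SepFam D T' ∧
        ∀ g : G, ∃ h ∈ H', {x : G | ∃ p ∈ P, x = p * h * g} ∈ T' := by
  classical

  obtain ⟨L, hL⟩ : ∃ L : Finset G, ∀ x, x ∈ L ↔ ∃ d ∈ D, ∃ d' ∈ D, ∃ p ∈ P, x = d * d'⁻¹ * p := by
    refine ⟨((D ×ˢ D) ×ˢ P).image fun q => q.1.1 * q.1.2⁻¹ * q.2, fun x => ?_⟩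
    simp only [Finset.mem_image, Finset.mem_product, Prod.exists]
    constructor
    · rintro ⟨d, d', p, h, rfl⟩; exact ⟨d, h.1.1, d', h.1.2, p, h.2, rfl⟩
    · rintro ⟨d, hd, d', hd', p, hp, rfl⟩; exact ⟨d, d', p, ⟨⟨hd, hd'⟩, hp⟩, rfl⟩
  obtain ⟨Q, hQ⟩ : ∃ Q : Finset G, ∀ x, x ∈ Q ↔ ∃ p ∈ P, ∃ l ∈ L, x = p⁻¹ * l := by
    refine ⟨(P ×ˢ L).image fun q => q.1⁻¹ * q.2, fun x => ?_⟩
    simp only [Finset.mem_image, Finset.mem_product, Prod.exists]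
    constructor
    · rintro ⟨d, d', h, rfl⟩; exact ⟨d, h.1, d', h.2, rfl⟩
    · rintro ⟨d, hd, d', hd', rfl⟩; exact ⟨d, d', ⟨hd, hd'⟩, rfl⟩
  have hQs : ∀ x ∈ Q, x⁻¹ ∈ Q := by
    intro x hx
    obtain ⟨p, hp, l, hl, rfl⟩ := (hQ x).1 hx
    obtain ⟨d, hd, d', hd', p', hp', rfl⟩ := (hL l).1 hl
    exact (hQ _).2 ⟨p', hp', d' * d⁻¹ * p, (hL _).2 ⟨d', hd', d, hd, p, hp, rfl⟩, by group⟩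
  obtain ⟨H, hH⟩ := hN L
  refine ⟨D ∪ (L ×ˢ H).image (fun q => q.1 * q.2),
    ((insert 1 Q) ×ˢ H).image (fun q => q.1 * q.2), fun T hT hs => ?_⟩
  have hcand := comb_avoid hH hT (fun l hl h hh => Finset.mem_union_right D
    (Finset.mem_image.2 ⟨(l, h), Finset.mem_product.2 ⟨hl, hh⟩, rfl⟩)) hs
  let Cand : Set G := {s | ∀ A ∈ T, ∀ l ∈ L, l * s ∉ A}
  let Fam : Set (Set G) := {S | S ⊆ Cand ∧ ∀ s ∈ S, ∀ s' ∈ S, s * s'⁻¹ ∈ Q → s = s'}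
  obtain ⟨S, hS⟩ := zorn_subset Fam (by
    intro c hc hch
    refine ⟨⋃₀ c, ⟨sUnion_subset fun s hs => (hc hs).1, ?_⟩, fun s hs => subset_sUnion_of_mem hs⟩
    rintro s ⟨a, ha, hsa⟩ s' ⟨b, hb, hsb⟩ hq
    rcases hch.total ha hb with h | h
    · exact (hc hb).2 s (h hsa) s' hsb hq
    · exact (hc ha).2 s hsa s' (h hsb) hq)
  have hmax : ∀ s ∈ Cand, ∃ q ∈ insert 1 Q, q * s ∈ S := by
    intro s hsC
    by_contra! hcon
    have hsS : s ∉ S := by simpa using hcon 1 (Finset.mem_insert_self _ _)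
    have hne : ∀ s' ∈ S, s' * s⁻¹ ∉ Q := fun s' hs' hq =>
      hcon _ (Finset.mem_insert_of_mem hq) (by simpa using hs')
    have hins : insert s S ∈ Fam := by
      refine ⟨insert_subset hsC hS.prop.1, ?_⟩
      rintro a (rfl | ha) b (rfl | hb) hq
      · rfl
      · exact absurd (by simpa using hQs _ hq) (hne b hb)
      · exact absurd hq (hne a ha)
      · exact hS.prop.2 a ha b hb hq
    exact hsS (hS.2 hins (subset_insert s S) (mem_insert s S))
  refine ⟨T ∪ (fun s => {x : G | ∃ p ∈ P, x = p * s}) '' S, subset_union_left, ?_, ?_, ?_⟩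
  · rintro A (hA | ⟨s, hs, rfl⟩)
    · exact hT A hA
    · refine ⟨s, ?_⟩
      rintro _ ⟨p, hp, rfl⟩
      simpa using hP p hp
  · rintro A (hA | ⟨s, hs1, rfl⟩) B (hB | ⟨s', hs', rfl⟩) g ⟨d, hd, hdA⟩ ⟨d', hd', hdB⟩
    · exact hs A hA B hB g ⟨d, Finset.mem_union_left _ hd, hdA⟩
        ⟨d', Finset.mem_union_left _ hd', hdB⟩
    · obtain ⟨p, hp, he⟩ := hdB
      refine absurd ?_ (hS.prop.1 hs' A hA (d * d'⁻¹ * p) ((hL _).2 ⟨d, hd, d', hd', p, hp, rfl⟩))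
      have : d * d'⁻¹ * p * s' = d * g := by
        rw [mul_assoc _ p, ← he]; group
      rw [this]; exact hdA
    · obtain ⟨p, hp, he⟩ := hdA
      refine absurd ?_ (hS.prop.1 hs1 B hB (d' * d⁻¹ * p) ((hL _).2 ⟨d', hd', d, hd, p, hp, rfl⟩))
      have : d' * d⁻¹ * p * s = d' * g := by
        rw [mul_assoc _ p, ← he]; group
      rw [this]; exact hdB
    · obtain ⟨p, hp, he⟩ := hdA
      obtain ⟨p', hp', he'⟩ := hdB
      have : s = s' := by
        apply hS.prop.2 s hs1 s' hs'
        refine (hQ _).2 ⟨p, hp, _, (hL _).2 ⟨d, hd, d', hd', p', hp', rfl⟩, ?_⟩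
        have h1 : s = p⁻¹ * (d * g) := by rw [he]; group
        have h2 : s' = p'⁻¹ * (d' * g) := by rw [he']; group
        rw [h1, h2]; group
      rw [this]
  · intro g
    obtain ⟨h, hh, hc⟩ := hcand g
    obtain ⟨q, hq, hqS⟩ := hmax (h * g) (fun A hA l hl => by
      rw [← mul_assoc]; exact hc A hA l hl)
    refine ⟨q * h, Finset.mem_image.2 ⟨(q, h), Finset.mem_product.2 ⟨hq, hh⟩, rfl⟩,
      Or.inr ⟨_, hqS, ?_⟩⟩
    simp only [mul_assoc]

theorem comb {N : Set G}
    (hN : ∀ F : Finset G, ∃ H : Finset G, ∀ g : G, ∃ h ∈ H, ∀ f ∈ F, f * h * g ∉ N)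
    (P : ℕ → Finset G) (hP : ∀ j, ∀ p ∈ P j, p ∈ N) :
    ∃ (H0 : Finset G) (H : ℕ → Finset G), ∀ n : ℕ, ∃ C : Set G,
      (∀ g : G, ∃ h ∈ H0, h * g ∈ C) ∧
      ∀ j < n, ∀ g : G, ∃ h ∈ H j, ∀ p ∈ P j, p * h * g ∉ C := by
  obtain ⟨H0, hH0⟩ := hN {1}
  choose Dt Ht hstep using fun (D : Finset G) (j : ℕ) => comb_step hN (P j) (hP j) D
  let D : ℕ → Finset G := fun n => Nat.rec H0 (fun j d => Dt d j) n
  have hind : ∀ m j : ℕ, ∃ T : Set (Set G), GoodFam N T ∧ SepFam (D j) T ∧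
      ∀ i, j ≤ i → i < j + m → ∀ g : G, ∃ h ∈ Ht (D i) i, {x : G | ∃ p ∈ P i, x = p * h * g} ∈ T := by
    intro m
    induction m with
    | zero =>
      intro j
      exact ⟨∅, by simp [GoodFam], by simp [SepFam], fun i h1 h2 => by omega⟩
    | succ m ih =>
      intro j
      obtain ⟨T, hT1, hT2, hT3⟩ := ih (j + 1)
      obtain ⟨T', h1, h2, h3, h4⟩ := hstep (D j) j T hT1 hT2
      refine ⟨T', h2, h3, fun i hji him => ?_⟩
      rcases hji.eq_or_lt with rfl | hlt
      · exact h4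
      · intro g
        obtain ⟨h, hh, hm⟩ := hT3 i hlt (by omega) g
        exact ⟨h, hh, h1 hm⟩
  refine ⟨H0, fun j => Ht (D j) j, fun n => ?_⟩
  obtain ⟨T, hT1, hT2, hT3⟩ := hind n 0
  refine ⟨(⋃₀ T)ᶜ, fun g => ?_, fun j hj g => ?_⟩
  · obtain ⟨h, hh, hav⟩ := comb_avoid hH0 hT1 (D := D 0) (by
      intro l hl h hh
      rw [Finset.mem_singleton.1 hl, one_mul]; exact hh) hT2 g
    refine ⟨h, hh, ?_⟩
    rintro ⟨A, hA, hm⟩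
    exact hav A hA 1 (by simp) (by simpa using hm)
  · obtain ⟨h, hh, hm⟩ := hT3 j (Nat.zero_le _) (by omega) g
    exact ⟨h, hh, fun p hp hc => hc ⟨_, hm, p, hp, rfl⟩⟩

/-- The full shift over `G` with two symbols. -/
def Shift (G : Type) : Type := G → Bool

instance : TopologicalSpace (Shift G) := inferInstanceAs (TopologicalSpace (G → Bool))
instance : CompactSpace (Shift G) := inferInstanceAs (CompactSpace (G → Bool))
instance [Countable G] : MetrizableSpace (Shift G) :=
  inferInstanceAs (MetrizableSpace (G → Bool))
instance : MulAction G (Shift G) where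
  smul g c := fun h => c (h * g)
  one_smul c := by funext h; exact congrArg c (mul_one h)
  mul_smul g k c := by funext h; exact congrArg c (mul_assoc h g k).symm

theorem shift_smul (g h : G) (c : Shift G) : (g • c) h = c (h * g) := rfl

theorem shift_cont (h : G) : Continuous (fun c : Shift G => c h) :=
  continuous_apply (A := fun _ : G => Bool) h

instance : ContinuousConstSMul G (Shift G) where
  continuous_const_smul g := continuous_pi (A := fun _ : G => Bool) fun h => shift_cont (h * g)

theorem shift_clopen (h : G) (b : Bool) : IsClopen {c : Shift G | c h = b} :=
  (isClopen_discrete {b}).preimage (shift_cont h)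

theorem exists_shift_pt [Countable G] {N : Set G}
    (hN : ∀ F : Finset G, ∃ H : Finset G, ∀ g : G, ∃ h ∈ H, ∀ f ∈ F, f * h * g ∉ N) :
    ∃ v : Shift G, IsMinimalPoint G v ∧
      (∃ c ∈ closure (MulAction.orbit G v), ∀ p ∈ N, c p = false) ∧
      ∃ c ∈ closure (MulAction.orbit G v), c 1 = true := by
  classical
  obtain ⟨e, he⟩ := exists_surjective_nat G
  let P : ℕ → Finset G := fun j => ((Finset.range j).image e).filter (· ∈ N)
  obtain ⟨H0, H, hC⟩ := comb hN P (fun j p hp => (Finset.mem_filter.1 hp).2)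
  have hPm : Monotone P := by
    intro i j hij p hp
    simp only [P, Finset.mem_filter, Finset.mem_image, Finset.mem_range] at hp ⊢
    obtain ⟨⟨k, hk, rfl⟩, hpN⟩ := hp
    exact ⟨⟨k, by omega, rfl⟩, hpN⟩
  let Z0 : Set (Shift G) := ⋂ g : G, ⋃ h ∈ H0, {c | c (h * g) = true}
  let Z : ℕ → Set (Shift G) := fun j => ⋂ g : G, ⋃ h ∈ H j, ⋂ p ∈ P j, {c | c (p * h * g) = false}
  have hZ0 : IsClosed Z0 := isClosed_iInter fun g =>
    (H0.finite_toSet.isClosed_biUnion fun h _ => (shift_clopen _ _).isClosed)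
  have hZ : ∀ j, IsClosed (Z j) := fun j => isClosed_iInter fun g =>
    ((H j).finite_toSet.isClosed_biUnion fun h _ =>
      isClosed_biInter fun p _ => (shift_clopen _ _).isClosed)
  have hZ0m : ∀ c, c ∈ Z0 ↔ ∀ g : G, ∃ h ∈ H0, c (h * g) = true := by
    intro c; simp [Z0]
  have hZm : ∀ j c, c ∈ Z j ↔ ∀ g : G, ∃ h ∈ H j, ∀ p ∈ P j, c (p * h * g) = false := by
    intro j c; simp [Z]
  let K : ℕ → Set (Shift G) := fun n => Z0 ∩ ⋂ j, ⋂ (_ : j < n), Z j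
  have hKne : (⋂ n, K n).Nonempty := by
    apply IsCompact.nonempty_iInter_of_sequence_nonempty_isCompact_isClosed
    · rintro n c ⟨h0, hc⟩
      refine ⟨h0, ?_⟩
      rw [mem_iInter₂] at hc ⊢
      exact fun j hj => hc j (by omega)
    · intro n
      obtain ⟨C, hC1, hC2⟩ := hC n
      refine ⟨fun g => decide (g ∈ C), (hZ0m _).2 ?_, mem_iInter₂.2 fun j hj => (hZm _ _).2 ?_⟩
      · intro g
        obtain ⟨h, hh, hm⟩ := hC1 g
        exact ⟨h, hh, decide_eq_true hm⟩
      · intro g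
        obtain ⟨h, hh, hm⟩ := hC2 j hj g
        exact ⟨h, hh, fun p hp => decide_eq_false (hm p hp)⟩
    · exact (hZ0.inter (isClosed_biInter fun j _ => hZ j)).isCompact
    · exact fun n => hZ0.inter (isClosed_biInter fun j _ => hZ j)
  have hKcl : IsClosed (⋂ n, K n) := isClosed_iInter fun n =>
    hZ0.inter (isClosed_biInter fun j _ => hZ j)
  have hK0 : ∀ c ∈ ⋂ n, K n, c ∈ Z0 := fun c hc => (mem_iInter.1 hc 0).1
  have hKj : ∀ c ∈ ⋂ n, K n, ∀ j, c ∈ Z j := fun c hc j =>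
    mem_iInter₂.1 (mem_iInter.1 hc (j + 1)).2 j (Nat.lt_succ_self j)
  have hKi : ∀ g : G, ∀ c ∈ ⋂ n, K n, g • c ∈ ⋂ n, K n := by
    intro g c hc
    refine mem_iInter.2 fun n => ⟨(hZ0m _).2 fun k => ?_, mem_iInter₂.2 fun j _ =>
      (hZm _ _).2 fun k => ?_⟩
    · obtain ⟨h, hh, hm⟩ := (hZ0m c).1 (hK0 c hc) (k * g)
      exact ⟨h, hh, by rw [shift_smul, mul_assoc]; exact hm⟩
    · obtain ⟨h, hh, hm⟩ := (hZm j c).1 (hKj c hc j) (k * g)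
      exact ⟨h, hh, fun p hp => by rw [shift_smul, mul_assoc]; exact hm p hp⟩
  obtain ⟨v, hvK, hv⟩ := exists_min hKcl hKne hKi
  refine ⟨v, hv, ?_, ?_⟩
  · have hne : (⋂ j, (closure (MulAction.orbit G v) ∩ ⋂ p ∈ P j, {c : Shift G | c p = false})).Nonempty := by
      have hcl : ∀ j, IsClosed (closure (MulAction.orbit G v) ∩
          ⋂ p ∈ P j, {c : Shift G | c p = false}) := fun j =>
        isClosed_closure.inter (isClosed_biInter fun p _ => (shift_clopen _ _).isClosed)
      apply IsCompact.nonempty_iInter_of_sequence_nonempty_isCompact_isClosed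
      · rintro n c ⟨h0, hc⟩
        refine ⟨h0, ?_⟩
        rw [mem_iInter₂] at hc ⊢
        exact fun p hp => hc p (hPm (Nat.le_succ n) hp)
      · intro j
        obtain ⟨h, hh, hm⟩ := (hZm j v).1 (hKj v hvK j) 1
        refine ⟨h • v, smul_mem_orbCl (self_mem_orbCl v) h, mem_iInter₂.2 fun p hp => ?_⟩
        have := hm p hp
        rw [mul_one] at this
        exact this
      · exact (hcl 0).isCompact
      · exact hcl
    obtain ⟨c, hc⟩ := hne
    rw [mem_iInter] at hc
    refine ⟨c, (hc 0).1, fun p hp => ?_⟩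
    obtain ⟨k, rfl⟩ := he p
    refine mem_iInter₂.1 (hc (k + 1)).2 (e k) ?_
    simp only [P, Finset.mem_filter, Finset.mem_image, Finset.mem_range]
    exact ⟨⟨k, by omega, rfl⟩, hp⟩
  · obtain ⟨h, hh, hm⟩ := (hZ0m v).1 (hK0 v hvK) 1
    refine ⟨h • v, smul_mem_orbCl (self_mem_orbCl v) h, ?_⟩
    rw [shift_smul, one_mul]
    rw [mul_one] at hm
    exact hm

theorem dense_min [Countable G] {X : Type} [TopologicalSpace X] [CompactSpace X]
    [MetrizableSpace X] [MulAction G X] [ContinuousConstSMul G X] (htrans : TransSys G X)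
    (hdis : ∀ Y : GSys G, Y.Minimal → DisjointSys G X Y.carrier) :
    Dense {x : X | IsMinimalPoint G x} := by
  classical
  rcases isEmpty_or_nonempty X with hX | hX
  · exact fun x => hX.elim x
  intro x0
  by_contra hx0
  obtain ⟨W', ⟨hW'1, hW'2⟩, hW'3⟩ := (closed_nhds_basis x0).mem_iff.1
    (isClosed_closure.isOpen_compl.mem_nhds hx0)
  let W := interior W'
  have hx0W : x0 ∈ W := mem_interior_iff_mem_nhds.2 hW'1
  have hWm : ∀ m : X, IsMinimalPoint G m → m ∉ closure W := fun m hm hmW =>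
    hW'3 (closure_minimal interior_subset hW'2 hmW) (subset_closure hm)
  obtain ⟨x, hx⟩ := exists_transPt htrans
  let N : Set G := {g | g • x ∈ W}
  have hN : ∀ F : Finset G, ∃ H : Finset G, ∀ g : G, ∃ h ∈ H, ∀ f ∈ F, f * h * g ∉ N := by
    intro F
    let O : Set X := ⋂ f ∈ F, (fun a : X => f • a) ⁻¹' (closure W)ᶜ
    have hO : IsOpen O := isOpen_biInter_finset fun f _ =>
      isClosed_closure.isOpen_compl.preimage (continuous_const_smul f)
    obtain ⟨H, hH⟩ := finite_visit (G := G) (K := (univ : Set X)) isCompact_univ hO (by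
      intro a _
      obtain ⟨m, hm, hmm⟩ := exists_min (G := G) (S := closure (MulAction.orbit G a))
        isClosed_closure ⟨_, self_mem_orbCl _⟩ (fun g a ha => smul_mem_orbCl ha g)
      obtain ⟨_, hb, ⟨g, rfl⟩⟩ := mem_closure_iff.1 hm O hO
        (mem_iInter₂.2 fun f _ => hWm _ (hmm.smul f))
      exact ⟨g, hb⟩)
    refine ⟨H, fun g => ?_⟩
    obtain ⟨h, hh, hm⟩ := hH (g • x) trivial
    refine ⟨h, hh, fun f hf hfN => mem_iInter₂.1 hm f hf (subset_closure ?_)⟩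
    have : (f * h * g) • x ∈ W := hfN
    simpa only [mul_smul] using this
  obtain ⟨v, hv, ⟨c, hc, hcN⟩, c', hc', hc'1⟩ := exists_shift_pt hN
  let J : Set (X × Shift G) := {p | ∀ g : G, ¬ (g • p.1 ∈ W ∧ (g • p.2) 1 = true)}
  have hJ : IsClosed J := by
    have : J = ⋂ g : G, {p : X × Shift G | (g • p.1 ∈ W ∧ (g • p.2) 1 = true)}ᶜ := by
      ext p; simp [J]
    rw [this]
    refine isClosed_iInter fun g => IsOpen.isClosed_compl ?_
    exact (isOpen_interior.preimage (by fun_prop : Continuous fun p : X × Shift G => g • p.1)).inter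
      ((shift_clopen 1 true).isOpen.preimage
        (by fun_prop : Continuous fun p : X × Shift G => g • p.2))
  have hJi : ∀ g : G, ∀ p ∈ J, (g • p.1, g • p.2) ∈ J := by
    intro g p hp k
    have := hp (k * g)
    rw [mul_smul, mul_smul] at this
    exact this
  let Pr : Set X := Prod.fst '' (J ∩ (univ ×ˢ closure (MulAction.orbit G v)))
  have hP : IsClosed Pr := by
    have : IsClosed (J ∩ (univ ×ˢ closure (MulAction.orbit G v))) :=
      hJ.inter (isClosed_univ.prod isClosed_closure)
    exact (this.isCompact.image continuous_fst).isClosed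
  have hPi : ∀ g : G, ∀ a ∈ Pr, g • a ∈ Pr := by
    rintro g _ ⟨p, ⟨hp1, hp2⟩, rfl⟩
    exact ⟨(g • p.1, g • p.2), ⟨hJi g p hp1, trivial, smul_mem_orbCl hp2.2 g⟩, rfl⟩
  have hxP : x ∈ Pr := by
    refine ⟨(x, c), ⟨?_, trivial, hc⟩, rfl⟩
    rintro g ⟨h1, h2⟩
    have h3 : c g = false := hcN g h1
    rw [shift_smul, one_mul] at h2
    simp [h3] at h2
  have hall := orbCl_subset hP hPi hxP
  rw [hx.closure_eq] at hall
  have := disj_use hdis hv J hJ hJi (by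
    intro a
    obtain ⟨p, ⟨hp1, hp2⟩, rfl⟩ := hall (mem_univ a)
    exact ⟨p.2, hp2.2, hp1⟩) x0 c' hc'
  exact this 1 ⟨by simpa using hx0W, by simpa using hc'1⟩

end Helpers

/-- A transitive `G`-system `(X,G)` (with `G` a countable discrete group) is disjoint with
all minimal `G`-systems if and only if `(X,G)` is ∞-transitive and there is a countable
dense set `D ⊆ X` of minimal points such that for every minimal `G`-system `(Y,G)`, every
`y ∈ Y`, every open neighborhood `V` of `y` and every nonempty open `U ⊆ X`, there is
`x ∈ D ∩ U` with `N_G((x,y), U × V) = {g : g • x ∈ U ∧ g • y ∈ V}` right syndetic. -/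
theorem stmt3 (G : Type) [Group G] [Countable G]
    (X : Type) [TopologicalSpace X] [CompactSpace X] [TopologicalSpace.MetrizableSpace X]
    [MulAction G X] [ContinuousConstSMul G X]
    (htrans : TransSys G X) :
    (∀ Y : GSys G, Y.Minimal → DisjointSys G X Y.carrier) ↔
      (InftyTransitive G X ∧
        ∃ D : Set X, D.Countable ∧ Dense D ∧ (∀ x ∈ D, IsMinimalPoint G x) ∧
          ∀ Y : GSys G, Y.Minimal → ∀ (y : Y.carrier) (V : Set Y.carrier),
            IsOpen V → y ∈ V → ∀ U : Set X, IsOpen U → U.Nonempty →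
              ∃ x ∈ D ∩ U, RightSyndetic {g : G | g • x ∈ U ∧ g • y ∈ V}) := by
  constructor
  · intro hdis
    have hD := dense_min htrans hdis
    exact ⟨inftyTrans_of htrans hdis hD, exists_D htrans hdis hD⟩
  · rintro ⟨hinf, D, hDc, -, -, hDs⟩ Y hY
    exact reverse_dir hinf hDc hDs Y hY
end

section
/- Let G be a countably infinite discrete group. Then the Bernoulli shift (2^G, G) is disjoint with every minimal G-system. -/
/-- The Bernoulli shift action of `G` on `2^G = G → Bool`, given by `(g • x) h = x (h * g)`. -/
instance bernSMul (G : Type) [Group G] : SMul G (G → Bool) :=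
  ⟨fun g x h => x (h * g)⟩

instance bernMulAction (G : Type) [Group G] : MulAction G (G → Bool) where
  one_smul x := funext fun h => congrArg x (mul_one h)
  mul_smul g g' x := funext fun h => (congrArg x (mul_assoc h g g')).symm

instance bernContinuousConstSMul (G : Type) [Group G] : ContinuousConstSMul G (G → Bool) :=
  ⟨fun g => continuous_pi fun h => continuous_apply (h * g)⟩

open Finset in
/-- Subsets of `S` (two-colourings of `S`) avoiding all bad events supported in `S`. -/
noncomputable def goodSets {V ι : Type} [DecidableEq V] (s : ι → Finset V)
    (Bad : ι → Finset V → Prop) (S : Finset V) : Finset (Finset V) :=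
  open Classical in S.powerset.filter (fun X => ∀ i, s i ⊆ S → ¬ Bad i X)

lemma mem_goodSets {V ι : Type} [DecidableEq V] (s : ι → Finset V)
    (Bad : ι → Finset V → Prop) (S X : Finset V) :
    X ∈ goodSets s Bad S ↔ X ⊆ S ∧ ∀ i, s i ⊆ S → ¬ Bad i X := by
  simp [goodSets]

lemma goodSets_step {V ι : Type} [DecidableEq V] (s : ι → Finset V)
    (Bad : ι → Finset V → Prop)
    (hdep : ∀ i X Y, X ∩ s i = Y ∩ s i → (Bad i X → Bad i Y)) (b : ℕ)
    (hb : ∀ i (A : Finset (Finset V)), (∀ X ∈ A, X ⊆ s i ∧ Bad i X) → A.card ≤ b)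
    (I : V → Finset ι) (hI : ∀ v i, v ∈ s i → i ∈ I v)
    (S : Finset V) (v : V) (hv : v ∉ S) :
    ∃ I' : Finset ι, I' ⊆ I v ∧ (∀ i ∈ I', s i ⊆ insert v S ∧ v ∈ s i) ∧
    2 * (goodSets s Bad S).card ≤ (goodSets s Bad (insert v S)).card +
      ∑ i ∈ I', (goodSets s Bad (insert v S \ s i)).card * b := by
  classical
  refine ⟨(I v).filter (fun i => s i ⊆ insert v S ∧ v ∈ s i), Finset.filter_subset _ _, ?_, ?_⟩
  · intro i hi
    exact (Finset.mem_filter.1 hi).2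
  set I' := (I v).filter (fun i => s i ⊆ insert v S ∧ v ∈ s i)
  let bs : ι → Finset (Finset V) := fun i => (insert v S).powerset.filter
    (fun X => X \ s i ∈ goodSets s Bad (insert v S \ s i) ∧ Bad i X)
  have hbs : ∀ i, (bs i).card ≤ (goodSets s Bad (insert v S \ s i)).card * b := by
    intro i
    have h1 : (bs i).card ≤ (goodSets s Bad (insert v S \ s i) ×ˢ
        ((s i).powerset.filter (fun X => Bad i X))).card := by
      apply Finset.card_le_card_of_injOn (fun X => (X \ s i, X ∩ s i))
      · intro X hX
        have hX' := (Finset.mem_filter.1 hX).2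
        simp only [Finset.coe_product, Set.mem_prod, Finset.mem_coe, Finset.mem_filter,
          Finset.mem_powerset]
        refine ⟨hX'.1, Finset.inter_subset_right, hdep i X _ ?_ hX'.2⟩
        ext a; simp
      · intro X _ Y _ h
        simp only [Prod.mk.injEq] at h
        rw [← Finset.sdiff_union_inter X (s i), ← Finset.sdiff_union_inter Y (s i), h.1, h.2]
    rw [Finset.card_product] at h1
    refine h1.trans (Nat.mul_le_mul_left _ (hb i _ ?_))
    intro X hX
    simpa using hX
  have hcard : 2 * (goodSets s Bad S).card =
      (goodSets s Bad S ∪ (goodSets s Bad S).image (insert v)).card := by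
    rw [Finset.card_union_of_disjoint, Finset.card_image_of_injOn, two_mul]
    · intro X hX Y hY h
      have hX' := ((mem_goodSets s Bad S X).1 hX).1
      have hY' := ((mem_goodSets s Bad S Y).1 hY).1
      have h1 : v ∉ X := fun h => hv (hX' h)
      have h2 : v ∉ Y := fun h => hv (hY' h)
      rw [← Finset.erase_insert h1, ← Finset.erase_insert h2]
      exact congrArg (fun Z => Finset.erase Z v) h
    · rw [Finset.disjoint_left]
      intro X hX hX2
      obtain ⟨Y, _, rfl⟩ := Finset.mem_image.1 hX2
      exact hv (((mem_goodSets s Bad S _).1 hX).1 (Finset.mem_insert_self _ _))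
  have hsub : goodSets s Bad S ∪ (goodSets s Bad S).image (insert v) ⊆
      goodSets s Bad (insert v S) ∪ I'.biUnion bs := by
    intro X hX
    have key : X ⊆ insert v S ∧ X.erase v ∈ goodSets s Bad S := by
      rcases Finset.mem_union.1 hX with h | h
      · have h' := (mem_goodSets s Bad S X).1 h
        refine ⟨h'.1.trans (Finset.subset_insert _ _), ?_⟩
        rw [Finset.erase_eq_of_notMem (fun h => hv (h'.1 h))]
        exact h
      · obtain ⟨Y, hY, rfl⟩ := Finset.mem_image.1 h
        have h' := (mem_goodSets s Bad S Y).1 hY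
        refine ⟨Finset.insert_subset_insert _ h'.1, ?_⟩
        rw [Finset.erase_insert (fun h => hv (h'.1 h))]
        exact hY
    obtain ⟨k1, k2⟩ := key
    rw [mem_goodSets] at k2
    by_cases hg : X ∈ goodSets s Bad (insert v S)
    · exact Finset.mem_union_left _ hg
    apply Finset.mem_union_right
    rw [mem_goodSets] at hg
    push Not at hg
    obtain ⟨i, hi, hbad⟩ := hg k1
    have hvi : v ∈ s i := by
      by_contra hvi
      apply k2.2 i
      · intro a ha
        have := hi ha
        grind
      · refine hdep i X _ ?_ hbad
        grind
    refine Finset.mem_biUnion.2 ⟨i, Finset.mem_filter.2 ⟨hI v i hvi, hi, hvi⟩, ?_⟩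
    refine Finset.mem_filter.2 ⟨Finset.mem_powerset.2 k1, ?_, hbad⟩
    rw [mem_goodSets]
    refine ⟨Finset.sdiff_subset_sdiff k1 le_rfl, ?_⟩
    intro j hj hbj
    have hjS : s j ⊆ S := by
      intro a ha
      have := hj ha
      grind
    apply k2.2 j hjS
    refine hdep j _ _ ?_ hbj
    ext a
    by_cases ha : a ∈ s j
    · have := hj ha
      have := hjS ha
      grind
    · grind
  calc 2 * (goodSets s Bad S).card = _ := hcard
    _ ≤ _ := Finset.card_le_card hsub
    _ ≤ _ := Finset.card_union_le _ _
    _ ≤ _ := Nat.add_le_add_left (Finset.card_biUnion_le.trans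
        (Finset.sum_le_sum fun i _ => hbs i)) _

/-- Rosenfeld-style counting replacement of the local lemma. -/
lemma goodSets_growth {V ι : Type} [DecidableEq V] (s : ι → Finset V)
    (Bad : ι → Finset V → Prop)
    (hdep : ∀ i X Y, X ∩ s i = Y ∩ s i → (Bad i X → Bad i Y)) (b : ℕ)
    (hb : ∀ i (A : Finset (Finset V)), (∀ X ∈ A, X ⊆ s i ∧ Bad i X) → A.card ≤ b)
    (I : V → Finset ι) (hI : ∀ v i, v ∈ s i → i ∈ I v)
    (m d : ℕ) (hs : ∀ i, (s i).card = m + 1) (hd : ∀ v, (I v).card ≤ d)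
    (β : ℝ) (hβ : 0 < β) (hβ2 : d * b + β * β ^ m ≤ 2 * β ^ m) :
    ∀ n (S : Finset V), S.card = n → ∀ S' ⊆ S,
      β ^ (S \ S').card * ((goodSets s Bad S').card : ℝ) ≤ (goodSets s Bad S).card := by
  intro n
  induction n with
  | zero =>
    intro S hS S' hS'
    rw [Finset.card_eq_zero] at hS
    subst hS
    rw [Finset.subset_empty] at hS'
    subst hS'
    simp
  | succ n ih =>
    intro S hS S' hS'
    by_cases hSS : S' = S
    · subst hSS; simp
    obtain ⟨v, hvS, hvS'⟩ := Finset.exists_of_ssubset (Finset.ssubset_iff_subset_ne.2 ⟨hS', hSS⟩)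
    set S0 := S.erase v with hS0
    have hins : insert v S0 = S := Finset.insert_erase hvS
    have hc0 : S0.card = n := by rw [hS0, Finset.card_erase_of_mem hvS, hS]; rfl
    have hv0 : v ∉ S0 := Finset.notMem_erase _ _
    have ih0 := ih S0 hc0
    obtain ⟨I', hI'1, hI'2, hst⟩ := goodSets_step s Bad hdep b hb I hI S0 v hv0
    rw [hins] at hst hI'2
    have hst' : 2 * ((goodSets s Bad S0).card : ℝ) ≤ (goodSets s Bad S).card +
      ∑ i ∈ I', ((goodSets s Bad (S \ s i)).card : ℝ) * b := by exact_mod_cast hst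
    have hpow : 0 < β ^ m := pow_pos hβ m
    have hterm : ∀ i ∈ I', β ^ m * (((goodSets s Bad (S \ s i)).card : ℝ) * b) ≤
        (goodSets s Bad S0).card * b := by
      intro i hi
      obtain ⟨h1, h2⟩ := hI'2 i hi
      have h3 := ih0 (S \ s i) (by intro a ha; grind)
      have h4 : S0 \ (S \ s i) = (s i).erase v := by
        ext a
        have := @h1 a
        grind
      rw [h4, Finset.card_erase_of_mem h2, hs i, Nat.add_sub_cancel] at h3
      rw [← mul_assoc]
      exact mul_le_mul_of_nonneg_right h3 (Nat.cast_nonneg _)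
    have hsum : β ^ m * ∑ i ∈ I', ((goodSets s Bad (S \ s i)).card : ℝ) * b ≤
        d * ((goodSets s Bad S0).card * b) := by
      rw [Finset.mul_sum]
      refine (Finset.sum_le_sum hterm).trans ?_
      rw [Finset.sum_const, nsmul_eq_mul]
      apply mul_le_mul_of_nonneg_right _ (by positivity)
      exact_mod_cast (Finset.card_le_card hI'1).trans (hd v)
    have hmain : β * ((goodSets s Bad S0).card : ℝ) ≤ (goodSets s Bad S).card := by
      refine le_of_mul_le_mul_left ?_ hpow
      have e1 := mul_le_mul_of_nonneg_left hst' hpow.le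
      have e2 := mul_le_mul_of_nonneg_right hβ2
        (Nat.cast_nonneg (α := ℝ) (goodSets s Bad S0).card)
      nlinarith
    have h5 := ih0 S' (by intro a ha; have := hS' ha; grind)
    have h6 : (S \ S').card = (S0 \ S').card + 1 := by
      have : S \ S' = insert v (S0 \ S') := by
        ext a; grind
      rw [this, Finset.card_insert_of_notMem (by grind)]
    rw [h6, pow_succ']
    calc _ = β * (β ^ (S0 \ S').card * ((goodSets s Bad S').card : ℝ)) := by ring
      _ ≤ β * ((goodSets s Bad S0).card : ℝ) := mul_le_mul_of_nonneg_left h5 hβ.le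
      _ ≤ _ := hmain

lemma goodSets_nonempty {V ι : Type} [DecidableEq V] (s : ι → Finset V)
    (Bad : ι → Finset V → Prop)
    (hdep : ∀ i X Y, X ∩ s i = Y ∩ s i → (Bad i X → Bad i Y)) (b : ℕ)
    (hb : ∀ i (A : Finset (Finset V)), (∀ X ∈ A, X ⊆ s i ∧ Bad i X) → A.card ≤ b)
    (I : V → Finset ι) (hI : ∀ v i, v ∈ s i → i ∈ I v)
    (m d : ℕ) (hs : ∀ i, (s i).card = m + 1) (hd : ∀ v, (I v).card ≤ d)
    (β : ℝ) (hβ : 0 < β) (hβ2 : d * b + β * β ^ m ≤ 2 * β ^ m) (S : Finset V) :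
    ∃ X ⊆ S, ∀ i, s i ⊆ S → ¬ Bad i X := by
  have h := goodSets_growth s Bad hdep b hb I hI m d hs hd β hβ hβ2 _ S rfl ∅
    (Finset.empty_subset _)
  have h1 : ∅ ∈ goodSets s Bad ∅ := by
    rw [mem_goodSets]
    refine ⟨le_rfl, fun i hi => ?_⟩
    have := hs i
    rw [Finset.subset_empty.1 hi] at this
    simp at this
  have h2 : 0 < (goodSets s Bad ∅).card := Finset.card_pos.2 ⟨_, h1⟩
  have h3 : (0 : ℝ) < (goodSets s Bad S).card := lt_of_lt_of_le (by positivity) h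
  have h4 : 0 < (goodSets s Bad S).card := by exact_mod_cast h3
  obtain ⟨X, hX⟩ := Finset.card_pos.1 h4
  rw [mem_goodSets] at hX
  exact ⟨X, hX⟩

/-- numerics -/
lemma exists_params (p : ℕ) (hp : 0 < p) : ∃ (β : ℝ) (N : ℕ), 0 < β ∧ 0 < N ∧
    ((p * N : ℕ) : ℝ) * ((2 ^ p - 1 : ℕ) ^ N : ℕ) + β * β ^ (p * N - 1) ≤ 2 * β ^ (p * N - 1) := by
  obtain ⟨β, hβ1, hβ2, hβ3⟩ : ∃ β : ℝ, 1 < β ∧ β < 2 ∧ (2 : ℝ) ^ p - 1 < β ^ p := by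
    have hc : Filter.Tendsto (fun β : ℝ => β ^ p) (nhdsWithin 2 (Set.Iio 2)) (nhds (2 ^ p)) :=
      ((continuous_pow p).tendsto 2).mono_left nhdsWithin_le_nhds
    have e1 := hc.eventually (lt_mem_nhds (show (2 : ℝ) ^ p - 1 < 2 ^ p by linarith))
    have e2 : ∀ᶠ β : ℝ in nhdsWithin 2 (Set.Iio 2), 1 < β :=
      nhdsWithin_le_nhds (lt_mem_nhds (by norm_num))
    have e3 : ∀ᶠ β : ℝ in nhdsWithin 2 (Set.Iio 2), β < 2 := self_mem_nhdsWithin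
    obtain ⟨β, h⟩ := (e1.and (e2.and e3)).exists
    exact ⟨β, h.2.1, h.2.2, h.1⟩
  have hβ0 : 0 < β := by linarith
  have hpw : (1 : ℝ) ≤ 2 ^ p := one_le_pow₀ (by norm_num)
  set r : ℝ := (2 ^ p - 1) / β ^ p with hr
  have hr0 : 0 ≤ r := div_nonneg (by linarith) (by positivity)
  have hr1 : r < 1 := (div_lt_one (by positivity)).2 hβ3
  have ht := (tendsto_self_mul_const_pow_of_lt_one hr0 hr1).const_mul ((p : ℝ) * β)
  rw [mul_zero] at ht
  obtain ⟨N, hN, hN1⟩ := ((ht.eventually (gt_mem_nhds (show (0 : ℝ) < 2 - β by linarith))).and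
    (Filter.eventually_gt_atTop 0)).exists
  refine ⟨β, N, hβ0, hN1, ?_⟩
  obtain ⟨k, hk⟩ : ∃ k, p * N = k + 1 := ⟨p * N - 1, by have := Nat.mul_pos hp hN1; omega⟩
  have hbr : (((2 ^ p - 1 : ℕ) ^ N : ℕ) : ℝ) = r ^ N * (β * β ^ k) := by
    have h2 : ((2 ^ p - 1 : ℕ) : ℝ) = 2 ^ p - 1 := by
      rw [Nat.cast_sub Nat.one_le_two_pow]; push_cast; rfl
    rw [Nat.cast_pow, h2, ← pow_succ', ← hk, pow_mul, ← mul_pow, hr, div_mul_cancel₀]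
    positivity
  rw [hbr, hk, Nat.add_sub_cancel, ← hk]
  have hpk : 0 < β ^ k := by positivity
  push_cast
  nlinarith

open Pointwise in
lemma exists_sep {G : Type} [Group G] [Infinite G] (K : Finset G) (N : ℕ) :
    ∃ C : Finset G, C.card = N ∧
      ∀ a ∈ K, ∀ a' ∈ K, ∀ c ∈ C, ∀ c' ∈ C, a * c = a' * c' → c = c' := by
  classical
  induction N with
  | zero => exact ⟨∅, by simp⟩
  | succ N ih =>
    obtain ⟨C, hC, hs⟩ := ih
    obtain ⟨x, hx⟩ := Infinite.exists_notMem_finset (K⁻¹ * K * C ∪ C)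
    have hx1 : x ∉ C := fun h => hx (Finset.mem_union_right _ h)
    have hx2 : ∀ a ∈ K, ∀ a' ∈ K, ∀ c ∈ C, a * x ≠ a' * c := by
      intro a ha a' ha' c hc h
      apply hx
      apply Finset.mem_union_left
      have : x = a⁻¹ * a' * c := by rw [mul_assoc, ← h, inv_mul_cancel_left]
      rw [this]
      exact Finset.mul_mem_mul (Finset.mul_mem_mul (Finset.inv_mem_inv ha) ha') hc
    refine ⟨insert x C, by rw [Finset.card_insert_of_notMem hx1, hC], ?_⟩
    intro a ha a' ha' c hc c' hc' h
    rcases Finset.mem_insert.1 hc with h1 | h1 <;> rcases Finset.mem_insert.1 hc' with h2 | h2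
    · rw [h1, h2]
    · subst h1
      exact absurd h (hx2 a ha a' ha' c' h2)
    · subst h2
      exact absurd h.symm (hx2 a' ha' a ha c h1)
    · exact hs a ha a' ha' c h1 c' h2 h

open Pointwise in
lemma exists_config {G : Type} [Group G] [Infinite G] (K Q : Finset G) (hQK : Q ⊆ K)
    (hQ : Q.Nonempty) (q : G → Bool) :
    ∃ C : Finset G, C.Nonempty ∧
      (∀ a ∈ K, ∀ a' ∈ K, ∀ c ∈ C, ∀ c' ∈ C, a * c = a' * c' → c = c') ∧
      ∃ x : G → Bool, ∀ g : G, ∃ c ∈ C, ∀ r ∈ Q, x (r * (c * g)) = q r := by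
  classical
  obtain ⟨β, N, hβ, hN, hpar⟩ := exists_params Q.card (Finset.card_pos.2 hQ)
  obtain ⟨C, hC, hsep⟩ := exists_sep K N
  refine ⟨C, Finset.card_pos.1 (hC ▸ hN), hsep, ?_⟩
  let s : G → Finset G := fun g => (Q ×ˢ C).image (fun rc => rc.1 * (rc.2 * g))
  let Bad : G → Finset G → Prop := fun g X => ∀ c ∈ C, ¬ ∀ r ∈ Q, (r * (c * g) ∈ X ↔ q r = true)
  have hmem : ∀ g, ∀ r ∈ Q, ∀ c ∈ C, r * (c * g) ∈ s g := fun g r hr c hc =>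
    Finset.mem_image.2 ⟨(r, c), Finset.mem_product.2 ⟨hr, hc⟩, rfl⟩
  have hdep : ∀ i X Y, X ∩ s i = Y ∩ s i → (Bad i X → Bad i Y) := by
    intro g X Y h hX c hc hall
    apply hX c hc
    intro r hr
    rw [← hall r hr]
    have h1 := congrArg (fun Z => r * (c * g) ∈ Z) h
    simpa [hmem g r hr c hc] using h1
  have hs : ∀ g, (s g).card = (Q.card * N - 1) + 1 := by
    intro g
    have : Q.card * N - 1 + 1 = Q.card * N := by
      have := Nat.mul_pos (Finset.card_pos.2 hQ) hN
      omega
    rw [this, Finset.card_image_of_injOn, Finset.card_product, hC]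
    rintro ⟨r, c⟩ h ⟨r', c'⟩ h' he
    simp only [Finset.coe_product, Set.mem_prod, Finset.mem_coe] at h h'
    simp only [← mul_assoc, mul_left_inj] at he
    have := hsep r (hQK h.1) r' (hQK h'.1) c h.2 c' h'.2 he
    subst this
    rw [mul_left_inj] at he
    rw [he]
  have hb : ∀ g (A : Finset (Finset G)), (∀ X ∈ A, X ⊆ s g ∧ Bad g X) →
      A.card ≤ (2 ^ Q.card - 1) ^ N := by
    intro g A hA
    let pat : Finset G := Q.filter (fun r => q r = true)
    have hcard : (C.pi (fun _ => Q.powerset.erase pat)).card = (2 ^ Q.card - 1) ^ N := by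
      rw [Finset.card_pi, Finset.prod_const, hC, Finset.card_erase_of_mem, Finset.card_powerset]
      exact Finset.mem_powerset.2 (Finset.filter_subset _ _)
    rw [← hcard]
    apply Finset.card_le_card_of_injOn (fun X c _ => Q.filter (fun r => r * (c * g) ∈ X))
    · intro X hX
      rw [Finset.mem_coe, Finset.mem_pi]
      intro c hc
      refine Finset.mem_erase.2 ⟨?_, Finset.mem_powerset.2 (Finset.filter_subset _ _)⟩
      intro he
      apply (hA X hX).2 c hc
      intro r hr
      have h1 := congrArg (fun Z => r ∈ Z) he
      simpa [pat, hr] using h1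
    · intro X hX Y hY he
      have key : ∀ r ∈ Q, ∀ c ∈ C, (r * (c * g) ∈ X ↔ r * (c * g) ∈ Y) := by
        intro r hr c hc
        have h1 := congrFun (congrFun he c) hc
        have h2 := congrArg (fun Z => r ∈ Z) h1
        simpa [hr] using h2
      have key2 : ∀ a ∈ s g, (a ∈ X ↔ a ∈ Y) := by
        intro a ha
        obtain ⟨⟨r, c⟩, h, rfl⟩ := Finset.mem_image.1 ha
        rw [Finset.mem_product] at h
        exact key r h.1 c h.2
      ext a
      exact ⟨fun h => (key2 a ((hA X hX).1 h)).1 h, fun h => (key2 a ((hA Y hY).1 h)).2 h⟩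
  let I : G → Finset G := fun v => (Q ×ˢ C).image (fun rc => rc.2⁻¹ * (rc.1⁻¹ * v))
  have hI : ∀ v g, v ∈ s g → g ∈ I v := by
    intro v g h
    obtain ⟨⟨r, c⟩, h', rfl⟩ := Finset.mem_image.1 h
    exact Finset.mem_image.2 ⟨(r, c), h', by simp⟩
  have hd : ∀ v, (I v).card ≤ Q.card * N := by
    intro v
    refine Finset.card_image_le.trans ?_
    rw [Finset.card_product, hC]
  have hfin := goodSets_nonempty s Bad hdep _ hb I hI _ _ hs hd β hβ hpar
  -- compactness
  let Z : G → Set (G → Bool) := fun g => {x | ∃ c ∈ C, ∀ r ∈ Q, x (r * (c * g)) = q r}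
  have hZ : ∀ g, IsClosed (Z g) := by
    intro g
    have : Z g = ⋃ c ∈ C, ⋂ r ∈ Q, {x : G → Bool | x (r * (c * g)) = q r} := by
      ext x; simp [Z]
    rw [this]
    refine Set.Finite.isClosed_biUnion C.finite_toSet fun c _ => ?_
    exact isClosed_biInter fun r _ => isClosed_eq (continuous_apply _) continuous_const
  have hne : (⋂ g, Z g).Nonempty := by
    rw [Set.nonempty_iff_ne_empty]
    intro hemp
    obtain ⟨u, hu⟩ := (isCompact_univ (X := G → Bool)).elim_finite_subfamily_closed Z hZ
      (by rw [hemp, Set.inter_empty])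
    obtain ⟨X, _, hX⟩ := hfin (u.biUnion s)
    have : (fun a => decide (a ∈ X)) ∈ Set.univ ∩ ⋂ i ∈ u, Z i := by
      refine ⟨trivial, Set.mem_iInter₂.2 fun g hg => ?_⟩
      have h1 := hX g (Finset.subset_biUnion_of_mem s hg)
      simp only [Bad] at h1
      push Not at h1
      by_contra hcon
      apply hX g (Finset.subset_biUnion_of_mem s hg)
      intro c hc hall
      apply hcon
      refine ⟨c, hc, fun r hr => ?_⟩
      have := hall r hr
      rw [Bool.eq_iff_iff, decide_eq_true_iff, this]
    rw [hu] at this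
    exact this
  obtain ⟨x, hx⟩ := hne
  exact ⟨x, fun g => Set.mem_iInter.1 hx g⟩

open Pointwise in
lemma exists_chain {G : Type} [Group G] [Infinite G] [DecidableEq G] (F T : Finset G)
    (hF : F.Nonempty) (p : G → Bool) (T' : Finset G) : T' ⊆ T →
    ∃ E : Finset G, E.Nonempty ∧
      (∀ a ∈ F * T, ∀ a' ∈ F * T, ∀ c ∈ E, ∀ c' ∈ E, a * c = a' * c' → c = c') ∧
      ∃ Ω : G → Set (G → Bool), (∀ t ∈ T', (Ω t).Nonempty ∧ IsClosed (Ω t) ∧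
        ∀ g : G, ∀ x ∈ Ω t, g • x ∈ Ω t) ∧
      ∀ z : G → (G → Bool), (∀ t ∈ T', z t ∈ Ω t) → ∀ g : G, ∃ e ∈ E,
        ∀ t ∈ T', ∀ f ∈ F, z t (f * (t * (e * g))) = p f := by
  classical
  induction T' using Finset.induction_on with
  | empty =>
    intro _
    exact ⟨{1}, by simp, by simp, fun _ => ∅, by simp, by simp⟩
  | insert t0 T' ht0 ih =>
    intro hT
    obtain ⟨E, hE, hEs, Ω, hΩ, hz⟩ := ih ((Finset.subset_insert _ _).trans hT)
    have ht0T : t0 ∈ T := hT (Finset.mem_insert_self _ _)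
    let q : G → Bool := fun w => decide (∃ f ∈ F, ∃ e ∈ E, w = f * t0 * e ∧ p f = true)
    have hq : ∀ f ∈ F, ∀ e ∈ E, q (f * t0 * e) = p f := by
      intro f hf e he
      rw [Bool.eq_iff_iff, decide_eq_true_iff]
      constructor
      · rintro ⟨f', hf', e', he', h, hp⟩
        have := hEs _ (Finset.mul_mem_mul hf ht0T) _ (Finset.mul_mem_mul hf' ht0T) e he e' he' h
        subst this
        rw [mul_left_inj, mul_left_inj] at h
        rw [h, hp]
      · intro hp
        exact ⟨f, hf, e, he, rfl, hp⟩
    have hsubK : F * {t0} * E ⊆ F * T * E := by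
      intro w hw
      obtain ⟨a, ha, e, he, rfl⟩ := Finset.mem_mul.1 hw
      obtain ⟨f, hf, t, ht, rfl⟩ := Finset.mem_mul.1 ha
      rw [Finset.mem_singleton.1 ht]
      exact Finset.mul_mem_mul (Finset.mul_mem_mul hf ht0T) he
    have hQne : (F * {t0} * E).Nonempty := (hF.mul (Finset.singleton_nonempty t0)).mul hE
    obtain ⟨C, hC, hCs, x, hx⟩ := exists_config _ _ hsubK hQne q
    let W : Set (G → Bool) := {x | ∀ g : G, ∃ c ∈ C, ∀ e ∈ E, ∀ f ∈ F,
      x (f * t0 * e * (c * g)) = p f}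
    have hWx : x ∈ W := by
      intro g
      obtain ⟨c, hc, h⟩ := hx g
      refine ⟨c, hc, fun e he f hf => ?_⟩
      rw [h _ (Finset.mul_mem_mul (Finset.mul_mem_mul hf (Finset.mem_singleton_self _)) he),
        hq f hf e he]
    have hWc : IsClosed W := by
      have : W = ⋂ g : G, ⋃ c ∈ C, ⋂ e ∈ E, ⋂ f ∈ F,
          {x : G → Bool | x (f * t0 * e * (c * g)) = p f} := by
        ext x; simp [W]
      rw [this]
      refine isClosed_iInter fun g => Set.Finite.isClosed_biUnion C.finite_toSet fun c _ => ?_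
      exact isClosed_biInter fun e _ => isClosed_biInter fun f _ =>
        isClosed_eq (continuous_apply _) continuous_const
    have hWi : ∀ g : G, ∀ x ∈ W, g • x ∈ W := by
      intro g x hx k
      obtain ⟨c, hc, h⟩ := hx (k * g)
      refine ⟨c, hc, fun e he f hf => ?_⟩
      rw [← h e he f hf]
      change x (f * t0 * e * (c * k) * g) = _
      simp only [mul_assoc]
    refine ⟨E * C, hE.mul hC, ?_, fun t => if t = t0 then W else Ω t, ?_, ?_⟩
    · intro a ha a' ha' w hw w' hw' h
      obtain ⟨e, he, c, hc, rfl⟩ := Finset.mem_mul.1 hw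
      obtain ⟨e', he', c', hc', rfl⟩ := Finset.mem_mul.1 hw'
      rw [← mul_assoc, ← mul_assoc] at h
      have h1 := hCs _ (Finset.mul_mem_mul ha he) _ (Finset.mul_mem_mul ha' he') c hc c' hc' h
      subst h1
      rw [mul_left_inj] at h
      rw [hEs a ha a' ha' e he e' he' h]
    · intro t ht
      by_cases h : t = t0
      · simp only [h, if_true]
        exact ⟨⟨x, hWx⟩, hWc, hWi⟩
      · simp only [h, if_false]
        exact hΩ t ((Finset.mem_insert.1 ht).resolve_left h)
    · intro z hzz g
      have h0 : z t0 ∈ W := by simpa using hzz t0 (Finset.mem_insert_self _ _)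
      obtain ⟨c, hc, h⟩ := h0 g
      obtain ⟨e, he, h'⟩ := hz z (fun t ht => by
        have h1 := hzz t (Finset.mem_insert_of_mem ht)
        have h2 : t ≠ t0 := fun h => ht0 (h ▸ ht)
        simpa [h2] using h1) (c * g)
      refine ⟨e * c, Finset.mul_mem_mul he hc, fun t ht f hf => ?_⟩
      rcases Finset.mem_insert.1 ht with rfl | ht
      · rw [← h e he f hf]
        simp only [mul_assoc]
      · rw [← h' t ht f hf]
        simp only [mul_assoc]

/-- For a countably infinite discrete group `G`, the Bernoulli shift `(2^G, G)` is
disjoint with every minimal `G`-system. -/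
theorem stmt4 (G : Type) [Group G] [Countable G] [Infinite G] :
    ∀ Y : GSys G, Y.Minimal → DisjointSys G (G → Bool) Y.carrier := by
  classical
  intro Y hY J hJ
  obtain ⟨_, hJc, hJi, hJ1, _⟩ := hJ
  by_contra hne
  obtain ⟨⟨x0, y0⟩, hxy⟩ := (Set.ne_univ_iff_exists_notMem J).1 hne
  have hnh : Jᶜ ∈ nhds (x0, y0) := hJc.isOpen_compl.mem_nhds hxy
  rw [nhds_prod_eq, Filter.mem_prod_iff] at hnh
  obtain ⟨A, hA, U', hU', hAU⟩ := hnh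
  obtain ⟨U, hUU', hUo, hyU⟩ := mem_nhds_iff.1 hU'
  rw [nhds_pi, Filter.mem_pi] at hA
  obtain ⟨F0, hF0, V, hV, hVA⟩ := hA
  let F : Finset G := insert 1 hF0.toFinset
  have hFA : ∀ x : G → Bool, (∀ f ∈ F, x f = x0 f) → x ∈ A := by
    intro x hx
    apply hVA
    intro f hf
    rw [hx f (Finset.mem_insert_of_mem (hF0.mem_toFinset.2 hf))]
    exact mem_of_mem_nhds (hV f)
  obtain ⟨T, hT⟩ : ∃ T : Finset G, ∀ y : Y.carrier, ∃ t ∈ T, t • y ∈ U := by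
    obtain ⟨T, hT⟩ := (isCompact_univ (X := Y.carrier)).elim_finite_subcover
      (fun g : G => (fun y : Y.carrier => g • y) ⁻¹' U)
      (fun g => hUo.preimage (continuous_const_smul g))
      (by
        intro y _
        obtain ⟨w, hw, hwU⟩ := (hY y).exists_mem_open hUo ⟨y0, hyU⟩ |>.imp fun a h => h
        obtain ⟨g, rfl⟩ := hw
        exact Set.mem_iUnion.2 ⟨g, hwU⟩)
    refine ⟨T, fun y => ?_⟩
    simpa using hT (Set.mem_univ y)
  obtain ⟨E, _, _, Ω, hΩ, hz⟩ := exists_chain F T ⟨1, Finset.mem_insert_self _ _⟩ x0 T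
    (Finset.Subset.refl _)
  have hex : ∀ t, ∃ z : G → Bool, t ∈ T → z ∈ Ω t ∧ (z, y0) ∈ J := by
    intro t
    by_cases ht : t ∈ T
    swap
    · exact ⟨x0, fun h => absurd h ht⟩
    obtain ⟨⟨w, hw⟩, hcl, hinv⟩ := hΩ t ht
    let B : Set Y.carrier := Prod.snd '' (J ∩ (Prod.fst ⁻¹' Ω t))
    have hBc : IsClosed B :=
      ((hJc.inter (hcl.preimage continuous_fst)).isCompact.image continuous_snd).isClosed
    obtain ⟨⟨w', y⟩, hwJ, rfl⟩ : w ∈ Prod.fst '' J := by rw [hJ1]; trivial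
    have horb : MulAction.orbit G y ⊆ B := by
      rintro _ ⟨g, rfl⟩
      exact ⟨(g • w', g • y), ⟨hJi g _ hwJ, hinv g _ hw⟩, rfl⟩
    have : y0 ∈ B := hBc.closure_subset_iff.2 horb (hY y y0)
    obtain ⟨⟨z, y'⟩, ⟨h1, h2⟩, h3⟩ := this
    simp only at h3
    subst h3
    exact ⟨z, fun _ => ⟨h2, h1⟩⟩
  choose z hzz using hex
  obtain ⟨e, _, he⟩ := hz z (fun t ht => (hzz t ht).1) 1
  obtain ⟨t, ht, htU⟩ := hT ((e * 1) • y0)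
  have hmem := hJi (t * (e * 1)) _ (hzz t ht).2
  simp only at hmem
  rw [mul_smul t (e * 1) y0] at hmem
  exact hAU (Set.mk_mem_prod (hFA _ (fun f hf => he t ht f hf)) (hUU' htU)) hmem
end

section
/- Let G be a countable discrete group and (X,G) a G-system. If (X,G) is totally transitive and has dense small periodic sets, then (X,G) is disjoint with all minimal G-systems. -/
/-- The action of a subgroup `H ≤ G` on `X` is (topologically) transitive. -/
def TransSubgroup (G : Type) [Group G] (X : Type) [TopologicalSpace X] [MulAction G X]
    (H : Subgroup G) : Prop :=
  ∀ U V : Set X, IsOpen U → IsOpen V → U.Nonempty → V.Nonempty →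
    ∃ h ∈ H, ((h • ·) '' U ∩ V).Nonempty

/-- `(X,G)` is totally transitive: `(X,H)` is transitive for every finite-index
subgroup `H ≤ G`. -/
def TotallyTransitive (G : Type) [Group G] (X : Type) [TopologicalSpace X] [MulAction G X] :
    Prop :=
  ∀ H : Subgroup G, H.FiniteIndex → TransSubgroup G X H

/-- `(X,G)` has dense small periodic sets: every nonempty open `U ⊆ X` contains a nonempty
closed set invariant under some finite-index subgroup of `G`. -/
def DenseSmallPeriodicSets (G : Type) [Group G] (X : Type) [TopologicalSpace X]
    [MulAction G X] : Prop :=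
  ∀ U : Set X, IsOpen U → U.Nonempty →
    ∃ E : Set X, E ⊆ U ∧ E.Nonempty ∧ IsClosed E ∧
      ∃ H : Subgroup G, H.FiniteIndex ∧ ∀ h ∈ H, ∀ x ∈ E, h • x ∈ E

/-- Existence of minimal nonempty closed invariant sets. -/
theorem exists_minimal_inv (G : Type) [Group G] (Y : Type) [TopologicalSpace Y] [CompactSpace Y]
    [Nonempty Y] [MulAction G Y] (K : Subgroup G) :
    ∃ M : Set Y, M.Nonempty ∧ IsClosed M ∧ (∀ k ∈ K, ∀ y ∈ M, k • y ∈ M) ∧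
      ∀ N : Set Y, N.Nonempty → IsClosed N → (∀ k ∈ K, ∀ y ∈ N, k • y ∈ N) → N ⊆ M → M ⊆ N := by
  let S : Set (Set Y) := {M | M.Nonempty ∧ IsClosed M ∧ ∀ k ∈ K, ∀ y ∈ M, k • y ∈ M}
  obtain ⟨M, hM, hM2⟩ := zorn_superset_nonempty S (by
    intro c hc hch hcn
    refine ⟨⋂₀ c, ⟨?_, isClosed_sInter fun s hs => (hc hs).2.1, ?_⟩, fun s hs =>
      Set.sInter_subset_of_mem hs⟩
    · have := hcn.to_subtype
      exact IsCompact.nonempty_sInter_of_directed_nonempty_isCompact_isClosed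
        (fun a ha b hb => (hch.total ha hb).elim (fun h => ⟨a, ha, subset_rfl, h⟩)
          (fun h => ⟨b, hb, h, subset_rfl⟩)) (fun s hs => (hc hs).1)
        (fun s hs => (hc hs).2.1.isCompact) (fun s hs => (hc hs).2.1)
    · intro k hk y hy s hs
      exact (hc hs).2.2 k hk y (hy s hs)) Set.univ
      ⟨Set.univ_nonempty, isClosed_univ, fun _ _ _ _ => trivial⟩
  exact ⟨M, hM2.prop.1, hM2.prop.2.1, hM2.prop.2.2, fun N a b c d => hM2.le_of_le ⟨a, b, c⟩ d⟩

/-- If a `G`-system (`G` a countable discrete group) is totally transitive and has dense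
small periodic sets, then it is disjoint with all minimal `G`-systems. -/
theorem stmt5 (G : Type) [Group G] [Countable G]
    (X : Type) [TopologicalSpace X] [CompactSpace X] [TopologicalSpace.MetrizableSpace X]
    [MulAction G X] [ContinuousConstSMul G X]
    (h1 : TotallyTransitive G X) (h2 : DenseSmallPeriodicSets G X) :
    ∀ Y : GSys G, Y.Minimal → DisjointSys G X Y.carrier := by
  intro Y hY J hJ
  obtain ⟨⟨p0, hp0⟩, hJc, hJi, hJ1, -⟩ := hJ
  have : Nonempty X := ⟨p0.1⟩
  have : Nonempty Y.carrier := ⟨p0.2⟩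
  have key : ∀ y0 : Y.carrier, ∀ U : Set X, IsOpen U → U.Nonempty → ∃ x ∈ U, (x, y0) ∈ J := by
    intro y0 U hU hUn
    obtain ⟨E, hEU, hEn, hEc, H, hH, hEH⟩ := h2 U hU hUn
    obtain ⟨K, hKn, hKf, hKH⟩ : ∃ K : Subgroup G, K.Normal ∧ K.FiniteIndex ∧ K ≤ H :=
      ⟨H.normalCore, inferInstance, inferInstance, H.normalCore_le⟩
    obtain ⟨M, hMn, hMc, hMi, hMm⟩ := exists_minimal_inv G Y.carrier K
    -- the translates of `M`
    let T : G ⧸ K → Set Y.carrier := fun q => {y | q.out⁻¹ • y ∈ M}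
    have hTc : ∀ q, IsClosed (T q) := fun q => hMc.preimage (continuous_const_smul _)
    have hTg : ∀ (g : G) (y), g⁻¹ • y ∈ M → y ∈ T (g : G ⧸ K) := by
      intro g y hy
      have h : (QuotientGroup.mk (g : G) : G ⧸ K).out⁻¹ * g ∈ K := by
        rw [← QuotientGroup.eq]; simp
      have := hMi _ h _ hy
      rwa [smul_smul, mul_assoc, mul_inv_cancel, mul_one] at this
    have hTi : ∀ q, ∀ k ∈ K, ∀ y ∈ T q, k • y ∈ T q := by
      intro q k hk y hy
      have := hMi _ (hKn.conj_mem k hk q.out⁻¹) _ hy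
      change q.out⁻¹ • k • y ∈ M
      simpa [smul_smul, mul_assoc] using this
    have hTu : ∀ y, ∃ q, y ∈ T q := by
      obtain ⟨m, hm⟩ := hMn
      have hcl : IsClosed (⋃ q, T q) := isClosed_iUnion_of_finite hTc
      have hsub : MulAction.orbit G m ⊆ ⋃ q, T q := by
        rintro _ ⟨g, rfl⟩
        exact Set.mem_iUnion.2 ⟨_, hTg g _ (by simpa using hm)⟩
      intro y
      exact Set.mem_iUnion.1 (closure_minimal hsub hcl (hY m y))
    let S : G ⧸ K → Set X := fun q => Prod.fst '' (J ∩ Prod.snd ⁻¹' (T q))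
    have hSc : ∀ q, IsClosed (S q) := fun q =>
      isClosedMap_fst_of_compactSpace _ (hJc.inter ((hTc q).preimage continuous_snd))
    have hSu : ⋃ q, S q = Set.univ := by
      ext x
      simp only [Set.mem_iUnion, Set.mem_univ, iff_true]
      obtain ⟨p, hp, rfl⟩ : x ∈ Prod.fst '' J := hJ1 ▸ Set.mem_univ x
      obtain ⟨q, hq⟩ := hTu p.2
      exact ⟨q, p, ⟨hp, hq⟩, rfl⟩
    obtain ⟨q, hq⟩ := nonempty_interior_of_iUnion_of_closed hSc hSu
    have hSq : ∀ x, x ∈ S q := by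
      intro x
      by_contra hx
      obtain ⟨k, hk, z, ⟨w, hw, rfl⟩, hz⟩ := h1 K hKf (interior (S q)) (S q)ᶜ isOpen_interior
        (hSc q).isOpen_compl hq ⟨x, hx⟩
      obtain ⟨p, ⟨hp, hpT⟩, hpw⟩ := interior_subset hw
      exact hz ⟨(k • p.1, k • p.2), ⟨hJi k p hp, hTi q k hk _ hpT⟩, by simp [hpw]⟩
    have hall : ∀ x : X, ∀ g : G, ∃ m ∈ M, (x, g • m) ∈ J := by
      intro x g
      obtain ⟨p, ⟨hp, hpT⟩, hpx⟩ := hSq (q.out • g⁻¹ • x)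
      refine ⟨q.out⁻¹ • p.2, hpT, ?_⟩
      have := hJi (g * q.out⁻¹) p hp
      rw [hpx] at this
      simpa [smul_smul, mul_assoc] using this
    obtain ⟨q0, hq0⟩ := hTu y0
    let g : G := q0.out
    let N : Set Y.carrier := M ∩ (g • ·) ⁻¹' (Prod.snd '' (J ∩ Prod.fst ⁻¹' E))
    have hMN : M ⊆ N := by
      apply hMm N
      · obtain ⟨e, he⟩ := hEn
        obtain ⟨m, hm, hmJ⟩ := hall e g
        exact ⟨m, hm, (e, g • m), ⟨hmJ, he⟩, rfl⟩
      · exact hMc.inter ((isClosedMap_snd_of_compactSpace _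
          (hJc.inter (hEc.preimage continuous_fst))).preimage (continuous_const_smul g))
      · rintro k hk y ⟨hy, p, ⟨hp, hpE⟩, hpy⟩
        have hc := hKn.conj_mem k hk g
        refine ⟨hMi k hk y hy, ((g * k * g⁻¹) • p.1, (g * k * g⁻¹) • p.2),
          ⟨hJi _ p hp, hEH _ (hKH hc) _ hpE⟩, ?_⟩
        simp only at hpy ⊢
        rw [hpy]
        simp [smul_smul, mul_assoc]
      · exact Set.inter_subset_left
    obtain ⟨-, p, ⟨hp, hpE⟩, hpy⟩ := hMN hq0
    simp only [g, smul_inv_smul] at hpy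
    exact ⟨p.1, hEU hpE, by rw [← hpy]; exact hp⟩
  ext ⟨x, y⟩
  simp only [Set.mem_univ, iff_true]
  have hc : IsClosed {x : X | (x, y) ∈ J} := hJc.preimage (by fun_prop)
  by_contra hx
  obtain ⟨x', hx', hJ'⟩ := key y {x : X | (x, y) ∈ J}ᶜ hc.isOpen_compl ⟨x, hx⟩
  exact hx' hJ'
end

section
/- Let G be a countable discrete group and (X,G) a G-system. If (X,G) is totally transitive and its set of regularly recurrent points is dense, then (X,G) is disjoint with all minimal G-systems. -/
/-- A point `x ∈ X` is regularly recurrent: for every open neighborhood `U` of `x` there is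
a finite-index subgroup `H ≤ G` with `H ⊆ N_G(x,U)`. -/
def RegularlyRecurrent (G : Type) [Group G] {X : Type} [TopologicalSpace X] [MulAction G X]
    (x : X) : Prop :=
  ∀ U : Set X, IsOpen U → x ∈ U → ∃ H : Subgroup G, H.FiniteIndex ∧ ∀ h ∈ H, h • x ∈ U

theorem exists_minimal_aux {G Y : Type} [Group G] [TopologicalSpace Y] [CompactSpace Y]
    [MulAction G Y] [ContinuousConstSMul G Y] [Nonempty Y] (H : Subgroup G) :
    ∃ M : Set Y, IsClosed M ∧ M.Nonempty ∧ (∀ h ∈ H, ∀ z ∈ M, h • z ∈ M) ∧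
      ∀ z ∈ M, ∀ K : Set Y, IsClosed K → (∀ h ∈ H, h • z ∈ K) → M ⊆ K := by
  obtain ⟨M, hM⟩ := zorn_superset
    {M : Set Y | IsClosed M ∧ M.Nonempty ∧ (∀ h ∈ H, ∀ z ∈ M, h • z ∈ M)} (by
      intro c hc hchain
      rcases c.eq_empty_or_nonempty with rfl | hne
      · exact ⟨Set.univ, ⟨isClosed_univ, Set.univ_nonempty, by simp⟩, by simp⟩
      · refine ⟨⋂₀ c, ⟨isClosed_sInter fun s hs => (hc hs).1, ?_, ?_⟩,
          fun s hs => Set.sInter_subset_of_mem hs⟩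
        · have : Nonempty c := hne.to_subtype
          exact IsCompact.nonempty_sInter_of_directed_nonempty_isCompact_isClosed
            (fun a ha b hb => (hchain.total ha hb).elim
              (fun h => ⟨a, ha, subset_rfl, h⟩) (fun h => ⟨b, hb, h, subset_rfl⟩))
            (fun s hs => (hc hs).2.1) (fun s hs => (hc hs).1.isCompact) (fun s hs => (hc hs).1)
        · intro h hh z hz s hs
          exact (hc hs).2.2 h hh z (hz s hs))
  obtain ⟨⟨hcl, hne, hinv⟩, hmin⟩ := hM
  refine ⟨M, hcl, hne, hinv, ?_⟩
  intro z hz K hK hzK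
  have hT : (closure {w | ∃ h ∈ H, w = h • z}) ∈
      {M : Set Y | IsClosed M ∧ M.Nonempty ∧ (∀ h ∈ H, ∀ z ∈ M, h • z ∈ M)} := by
    refine ⟨isClosed_closure, ⟨z, subset_closure ⟨1, H.one_mem, by simp⟩⟩, ?_⟩
    intro h hh w hw
    refine map_mem_closure (continuous_const_smul h) hw ?_
    rintro _ ⟨k, hk, rfl⟩
    exact ⟨h * k, H.mul_mem hh hk, by rw [mul_smul]⟩
  have h1 : closure {w | ∃ h ∈ H, w = h • z} ⊆ M := by
    refine closure_minimal ?_ hcl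
    rintro _ ⟨k, hk, rfl⟩
    exact hinv k hk z hz
  refine (hmin hT h1).trans (closure_minimal ?_ hK)
  rintro _ ⟨k, hk, rfl⟩
  exact hzK k hk

/-- If a `G`-system (`G` a countable discrete group) is totally transitive and its
regularly recurrent points are dense, then it is disjoint with all minimal `G`-systems. -/
theorem stmt6 (G : Type) [Group G] [Countable G]
    (X : Type) [TopologicalSpace X] [CompactSpace X] [TopologicalSpace.MetrizableSpace X]
    [MulAction G X] [ContinuousConstSMul G X]
    (h1 : TotallyTransitive G X) (h2 : Dense {x : X | RegularlyRecurrent G x}) :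
    ∀ Y : GSys G, Y.Minimal → DisjointSys G X Y.carrier := by
  intro Y hY J hJ
  obtain ⟨hJne, hJc, hJi, hJ1, hJ2⟩ := hJ
  obtain ⟨p₀, -⟩ := hJne
  have hX : Nonempty X := ⟨p₀.1⟩
  have hYne : Nonempty Y.carrier := ⟨p₀.2⟩
  -- the main claim
  have key : ∀ U : Set X, IsOpen U → U.Nonempty → ∀ y : Y.carrier, ∃ x ∈ U, (x, y) ∈ J := by
    intro U hU hUne y
    obtain ⟨x, hxU, hxr⟩ := h2.inter_open_nonempty U hU hUne
    obtain ⟨V, hV, hVc, hVU⟩ := exists_mem_nhds_isClosed_subset (hU.mem_nhds hxU)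
    obtain ⟨H₀, hH₀, hH₀V⟩ := hxr (interior V) isOpen_interior (mem_interior_iff_mem_nhds.2 hV)
    let H := H₀.normalCore
    have hHf : H.FiniteIndex := inferInstance
    have hHn : H.Normal := inferInstance
    have hHV : ∀ h ∈ H, h • x ∈ V := fun h hh =>
      interior_subset (hH₀V h (H₀.normalCore_le hh))
    obtain ⟨M, hMc, ⟨m₀, hm₀⟩, hMi, hMm⟩ := exists_minimal_aux (Y := Y.carrier) H
    have hcover : ∀ w : Y.carrier, ∃ q : G ⧸ H, (q.out)⁻¹ • w ∈ M := by
      intro w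
      have hSc : IsClosed (⋃ q : G ⧸ H, {w : Y.carrier | (q.out)⁻¹ • w ∈ M}) :=
        isClosed_iUnion_of_finite fun q => hMc.preimage (continuous_const_smul _)
      have hsub : MulAction.orbit G m₀ ⊆ ⋃ q : G ⧸ H, {w : Y.carrier | (q.out)⁻¹ • w ∈ M} := by
        rintro _ ⟨g, rfl⟩
        refine Set.mem_iUnion.2 ⟨(g : G ⧸ H), ?_⟩
        have hh : ((g : G ⧸ H).out)⁻¹ * g ∈ H :=
          QuotientGroup.eq.1 (QuotientGroup.out_eq' (g : G ⧸ H))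
        have := hMi _ hh m₀ hm₀
        simpa [mul_smul] using this
      have := closure_minimal hsub hSc (hY m₀ w)
      simpa using this
    let P : Set X := Prod.fst '' (J ∩ (Prod.snd ⁻¹' M))
    have hPc : IsClosed P :=
      ((hJc.inter (hMc.preimage continuous_snd)).isCompact.image continuous_fst).isClosed
    have hPi : ∀ h ∈ H, ∀ z ∈ P, h • z ∈ P := by
      rintro h hh _ ⟨⟨a, b⟩, ⟨hab, hb⟩, rfl⟩
      exact ⟨(h • a, h • b), ⟨hJi h _ hab, hMi h hh b hb⟩, rfl⟩
    have hPcover : (⋃ q : G ⧸ H, {z : X | (q.out)⁻¹ • z ∈ P}) = Set.univ := by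
      refine Set.eq_univ_of_forall fun z => ?_
      obtain ⟨⟨a, b⟩, hab, rfl⟩ : z ∈ Prod.fst '' J := hJ1 ▸ Set.mem_univ z
      obtain ⟨q, hq⟩ := hcover b
      exact Set.mem_iUnion.2 ⟨q, ((q.out)⁻¹ • a, (q.out)⁻¹ • b), ⟨hJi _ _ hab, hq⟩, rfl⟩
    obtain ⟨q, hq⟩ := nonempty_interior_of_iUnion_of_closed
      (fun q : G ⧸ H => hPc.preimage (continuous_const_smul (q.out)⁻¹)) hPcover
    have hPuniv : ∀ z, z ∈ P := by
      intro z
      by_contra hz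
      obtain ⟨a, ha⟩ := hq
      have hO : IsOpen {w : X | q.out • w ∈ interior ((fun z : X => (q.out)⁻¹ • z) ⁻¹' P)} :=
        isOpen_interior.preimage (continuous_const_smul q.out)
      obtain ⟨h, hh, _, ⟨u, hu, rfl⟩, hu2⟩ := h1 H hHf _ Pᶜ hO hPc.isOpen_compl
        ⟨(q.out)⁻¹ • a, by simpa using ha⟩ ⟨z, hz⟩
      have huP : u ∈ P := by simpa using interior_subset hu
      exact hu2 (hPi h hh u huP)
    obtain ⟨r, hr⟩ := hcover y
    obtain ⟨⟨a, m⟩, ⟨ham, hm⟩, hax⟩ := hPuniv ((r.out)⁻¹ • x)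
    simp only at hax
    let K : Set Y.carrier := Prod.snd '' (J ∩ (Prod.fst ⁻¹' V))
    have hKc : IsClosed K :=
      ((hJc.inter (hVc.preimage continuous_fst)).isCompact.image continuous_snd).isClosed
    have hMK := hMm m hm {z | r.out • z ∈ K} (hKc.preimage (continuous_const_smul r.out)) (by
      intro h hh
      refine ⟨(r.out • h • a, r.out • h • m), ⟨hJi _ _ (hJi h _ ham), ?_⟩, rfl⟩
      have := hHV _ (hHn.conj_mem h hh r.out)
      simpa [hax, mul_smul] using this)
    have hyK : y ∈ K := by simpa using hMK hr
    obtain ⟨⟨b, c⟩, ⟨hbc, hb⟩, rfl⟩ := hyK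
    exact ⟨b, hVU hb, hbc⟩
  refine Set.eq_univ_of_forall fun ⟨x, y⟩ => ?_
  by_contra hxy
  have hO : IsOpen {z : X | (z, y) ∈ Jᶜ} := hJc.isOpen_compl.preimage (by fun_prop)
  obtain ⟨z, hz, hzJ⟩ := key _ hO ⟨x, hxy⟩ y
  exact hz hzJ
end

section
/- Let G be a countable discrete group and (X,G) an ∞-transitive G-system with a dense set of distal points. Then (X,G) is disjoint with all minimal G-systems. -/
/-- `x` and `y` are proximal: `inf_{g ∈ G} dist (g • x) (g • y) = 0`. -/
def Proximal (G : Type) [Group G] {X : Type*} [MetricSpace X] [MulAction G X]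
    (x y : X) : Prop :=
  ∀ ε : ℝ, 0 < ε → ∃ g : G, dist (g • x) (g • y) < ε

/-- `x` is a distal point: no point of the orbit closure of `x` other than `x` itself is
proximal to `x`. -/
def DistalPoint (G : Type) [Group G] {X : Type*} [MetricSpace X] [MulAction G X]
    (x : X) : Prop :=
  ∀ y ∈ closure (MulAction.orbit G x), y ≠ x → ¬ Proximal G x y

open Filter Topology

attribute [local instance] Ultrafilter.mul Ultrafilter.semigroup

set_option linter.unusedSectionVars false

section aux
variable {G : Type} [Group G] {Z : Type} [TopologicalSpace Z] [CompactSpace Z] [T2Space Z]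
  [MulAction G Z] [ContinuousConstSMul G Z]

/-- The limit of `g • z` along the ultrafilter `p`. -/
noncomputable def pl (p : Ultrafilter G) (z : Z) : Z := Ultrafilter.extend (fun g : G => g • z) p

theorem pl_tendsto (p : Ultrafilter G) (z : Z) :
    Tendsto (fun g : G => g • z) (p : Filter G) (𝓝 (pl p z)) :=
  (ultrafilter_extend_eq_iff (f := fun g : G => g • z) (b := p)).1 rfl

theorem pl_eq {p : Ultrafilter G} {z w : Z}
    (h : Tendsto (fun g : G => g • z) (p : Filter G) (𝓝 w)) : pl p z = w :=
  tendsto_nhds_unique (pl_tendsto p z) h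

theorem pl_cont (z : Z) : Continuous (fun p : Ultrafilter G => pl p z) :=
  continuous_ultrafilter_extend _

theorem pl_pure (g : G) (z : Z) : pl (pure g : Ultrafilter G) z = g • z := by
  apply pl_eq
  rw [Ultrafilter.coe_pure]
  exact tendsto_pure_nhds _ _

theorem pl_mul (p q : Ultrafilter G) (z : Z) : pl (p * q) z = pl p (pl q z) := by
  apply pl_eq
  rw [tendsto_nhds]
  intro O hO hw
  change ∀ᶠ m in ((p * q : Ultrafilter G) : Filter G), m • z ∈ O
  rw [Ultrafilter.eventually_mul]
  have h1 := (pl_tendsto p (pl q z)).eventually (hO.mem_nhds hw)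
  filter_upwards [h1] with m hm
  have h2 := ((pl_tendsto q z).const_smul m).eventually (hO.mem_nhds hm)
  filter_upwards [h2] with n hn
  rwa [mul_smul]

end aux

theorem key {G : Type} [Group G]
    {X : Type} [MetricSpace X] [CompactSpace X] [MulAction G X] [ContinuousConstSMul G X]
    {Y : Type} [TopologicalSpace Y] [CompactSpace Y] [T2Space Y] [MulAction G Y]
    [ContinuousConstSMul G Y] (hY : ∀ y : Y, Dense (MulAction.orbit G y))
    (x x1 : X) (y : Y) (hd : DistalPoint G x1) (hp : Proximal G x x1) :
    ∃ u : Ultrafilter G, pl u x = x1 ∧ pl u y = y := by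
  have hSc : IsClosed {p : Ultrafilter G | pl p x = pl p x1} :=
    isClosed_eq (pl_cont x) (pl_cont x1)
  obtain ⟨p0, hp0⟩ : ∃ p : Ultrafilter G, pl p x = pl p x1 := by
    choose g hg using fun n : ℕ => hp (1 / ((n : ℝ) + 1)) (by positivity)
    refine ⟨(hyperfilter ℕ).map g, ?_⟩
    have h1 := (pl_tendsto ((hyperfilter ℕ).map g) x).dist (pl_tendsto ((hyperfilter ℕ).map g) x1)
    rw [Ultrafilter.coe_map, tendsto_map'_iff] at h1
    have h2 : Tendsto (fun n : ℕ => dist (g n • x) (g n • x1)) (hyperfilter ℕ : Filter ℕ) (𝓝 0) := by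
      have h3 : Tendsto (fun n : ℕ => dist (g n • x) (g n • x1)) atTop (𝓝 0) :=
        squeeze_zero (fun _ => dist_nonneg) (fun n => (hg n).le)
          tendsto_one_div_add_atTop_nhds_zero_nat
      exact h3.mono_left Nat.hyperfilter_le_atTop
    exact dist_eq_zero.1 (tendsto_nhds_unique h1 h2)
  have hK : (fun p : Ultrafilter G => pl p y) '' {p : Ultrafilter G | pl p x = pl p x1}
      = Set.univ := by
    have hc : IsClosed ((fun p : Ultrafilter G => pl p y) ''
        {p : Ultrafilter G | pl p x = pl p x1}) :=
      (hSc.isCompact.image (pl_cont y)).isClosed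
    rw [← hc.closure_eq]
    refine ((hY (pl p0 y)).mono ?_).closure_eq
    rintro _ ⟨g, rfl⟩
    refine ⟨pure g * p0, ?_, ?_⟩
    · simp only [Set.mem_ofPred_eq, pl_mul, hp0]
    · simp only [pl_mul, pl_pure]
  obtain ⟨q, hq1, hq2⟩ : y ∈ (fun p : Ultrafilter G => pl p y) ''
      {p : Ultrafilter G | pl p x = pl p x1} := hK ▸ Set.mem_univ y
  have hT : IsClosed {p : Ultrafilter G | pl p x = pl p x1 ∧ pl p y = y} :=
    hSc.inter (isClosed_eq (pl_cont y) continuous_const)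
  obtain ⟨u, ⟨hu1, hu2⟩, hu⟩ := exists_idempotent_in_compact_subsemigroup
    (M := Ultrafilter G) Ultrafilter.continuous_mul_left
    {p : Ultrafilter G | pl p x = pl p x1 ∧ pl p y = y} ⟨q, hq1, hq2⟩ hT.isCompact (by
      rintro a ⟨ha1, ha2⟩ b ⟨hb1, hb2⟩
      exact ⟨by rw [pl_mul, pl_mul, hb1], by rw [pl_mul, hb2, ha2]⟩)
  refine ⟨u, ?_, hu2⟩
  rw [hu1]
  by_contra hne
  refine hd (pl u x1) ?_ hne ?_
  · exact mem_closure_of_tendsto (pl_tendsto u x1) (Eventually.of_forall fun g => ⟨g, rfl⟩)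
  · intro ε hε
    have h := (pl_tendsto u x1).dist (pl_tendsto u (pl u x1))
    rw [← pl_mul, hu, dist_self] at h
    exact (h.eventually (gt_mem_nhds hε)).exists

theorem prox_residual {G : Type} [Group G]
    {X : Type} [MetricSpace X] [CompactSpace X] [MulAction G X] [ContinuousConstSMul G X]
    (h1 : InftyTransitive G X) (x0 : X) : ∀ᶠ x in residual X, Proximal G x x0 := by
  have hn : ∀ n : ℕ, ∀ᶠ x in residual X, ∃ g : G, dist (g • x) (g • x0) < 1 / ((n : ℝ) + 1) := by
    intro n
    set ε : ℝ := 1 / ((n : ℝ) + 1) with hε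
    have hεp : 0 < ε := by positivity
    apply residual_of_dense_open
    · have : {x : X | ∃ g : G, dist (g • x) (g • x0) < ε}
          = ⋃ g : G, {x : X | dist (g • x) (g • x0) < ε} := by ext; simp
      change IsOpen {x : X | ∃ g : G, dist (g • x) (g • x0) < ε}
      rw [this]
      exact isOpen_iUnion fun g =>
        isOpen_lt ((continuous_const_smul g).dist continuous_const) continuous_const
    · change Dense {x : X | ∃ g : G, dist (g • x) (g • x0) < ε}
      rw [dense_iff_inter_open]
      intro V hV hVne
      obtain ⟨t, ht⟩ := (isCompact_univ (X := X)).elim_finite_subcover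
        (fun c : X => Metric.ball c (ε / 2)) (fun _ => Metric.isOpen_ball)
        (fun x _ => Set.mem_iUnion.2 ⟨x, Metric.mem_ball_self (by positivity)⟩)
      have hcov : ∀ z : X, ∃ c ∈ t, dist z c < ε / 2 := by
        intro z
        simpa using ht (Set.mem_univ z)
      have hk : 0 < t.card := by
        obtain ⟨c, hc, -⟩ := hcov x0
        exact Finset.card_pos.2 ⟨c, hc⟩
      let e := t.equivFin
      obtain ⟨v, hv⟩ := hVne
      obtain ⟨g, w, ⟨a, ha, rfl⟩, hw⟩ := h1 t.card hk (Set.univ.pi fun _ => V)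
        (Set.univ.pi fun i => Metric.ball ((e.symm i : t) : X) (ε / 2))
        (isOpen_set_pi Set.finite_univ fun _ _ => hV)
        (isOpen_set_pi Set.finite_univ fun _ _ => Metric.isOpen_ball)
        ⟨fun _ => v, fun _ _ => hv⟩
        ⟨fun i => ((e.symm i : t) : X), fun i _ => Metric.mem_ball_self (by positivity)⟩
      obtain ⟨c, hc, hcd⟩ := hcov (g • x0)
      have hwc := hw (e ⟨c, hc⟩) (Set.mem_univ _)
      simp only [Equiv.symm_apply_apply, Metric.mem_ball, Pi.smul_apply] at hwc
      refine ⟨a (e ⟨c, hc⟩), ha _ (Set.mem_univ _), g, ?_⟩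
      have := dist_triangle_right (g • a (e ⟨c, hc⟩)) (g • x0) c
      linarith
  filter_upwards [eventually_countable_forall.2 hn] with x hx ε hε
  obtain ⟨n, hn⟩ := exists_nat_one_div_lt hε
  obtain ⟨g, hg⟩ := hx n
  exact ⟨g, hg.trans hn⟩

theorem stmt7 (G : Type) [Group G] [Countable G]
    (X : Type) [MetricSpace X] [CompactSpace X] [MulAction G X] [ContinuousConstSMul G X]
    (h1 : InftyTransitive G X) (h2 : Dense {x : X | DistalPoint G x}) :
    ∀ Y : GSys G, Y.Minimal → DisjointSys G X Y.carrier := by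
  intro Y hY J ⟨hne, hcl, hinv, hfst, hsnd⟩
  obtain ⟨D, hDs, hDc, hDd⟩ := h2.exists_countable_dense_subset
  have hres : ∀ᶠ x in residual X, ∀ d ∈ D, Proximal G x d :=
    (eventually_countable_ball hDc).2 fun d _ => prox_residual h1 d
  haveI : Nonempty X := ⟨hne.some.1⟩
  obtain ⟨x, hx⟩ := (dense_of_mem_residual hres).nonempty
  obtain ⟨⟨x', y⟩, hxy, rfl⟩ : x ∈ Prod.fst '' J := hfst ▸ Set.mem_univ x
  have hD : ∀ d ∈ D, (d, y) ∈ J := by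
    intro d hd
    obtain ⟨u, hu1, hu2⟩ := key hY x' d y (hDs hd) (hx d hd)
    have h := (pl_tendsto u x').prodMk_nhds (pl_tendsto u y)
    rw [hu1, hu2] at h
    exact hcl.mem_of_tendsto h (Eventually.of_forall fun g => hinv g _ hxy)
  have hX : ∀ z : X, (z, y) ∈ J := by
    have hc : IsClosed {z : X | (z, y) ∈ J} := hcl.preimage (by fun_prop)
    intro z
    exact hc.closure_subset_iff.2 hD (hDd z)
  rw [Set.eq_univ_iff_forall]
  rintro ⟨z, w⟩
  have hc : IsClosed {w : Y.carrier | (z, w) ∈ J} := hcl.preimage (by fun_prop)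
  refine hc.closure_subset_iff.2 ?_ (hY y w)
  rintro _ ⟨g, rfl⟩
  have := hinv g _ (hX (g⁻¹ • z))
  simpa using this
end

section
/- Let G be a group and S ⊂ G. Then S is right piecewise syndetic if and only if S has nonempty intersection with every right thickly syndetic subset of G. -/
/-- `S` is right piecewise syndetic: there is a finite `F ⊆ G` such that for every finite
`A ⊆ G` there is `g ∈ G` with `A * g ⊆ F * S`. -/
def RightPiecewiseSyndetic {G : Type*} [Group G] (S : Set G) : Prop :=
  ∃ F : Finset G, ∀ A : Finset G, ∃ g : G, ∀ a ∈ A, ∃ f ∈ F, f⁻¹ * (a * g) ∈ S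

/-- `S ⊆ G` is right piecewise syndetic iff it meets every right thickly syndetic subset
of `G`. -/
theorem stmt8 {G : Type*} [Group G] (S : Set G) :
    RightPiecewiseSyndetic S ↔
      ∀ T : Set G, RightThicklySyndetic T → (S ∩ T).Nonempty := by
  classical
  constructor
  · rintro ⟨F, hF⟩ T hT
    obtain ⟨Q, ⟨K, hK⟩, hQ⟩ := hT (F.image (fun x => x⁻¹))
    obtain ⟨g, hg⟩ := hF (K.image (fun x => x⁻¹))
    obtain ⟨k, hk, hkQ⟩ := hK g
    obtain ⟨f, hf, hfS⟩ := hg k⁻¹ (Finset.mem_image_of_mem _ hk)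
    exact ⟨_, hfS, hQ f⁻¹ (Finset.mem_image_of_mem _ hf) _ hkQ⟩
  · intro h
    by_contra hS
    have hT : RightThicklySyndetic Sᶜ := by
      intro A
      refine ⟨{q | ∀ a ∈ A, a * q ∉ S}, ?_, fun a ha q hq => hq a ha⟩
      by_contra hQ
      apply hS
      refine ⟨A.image (fun x => x⁻¹), fun B => ?_⟩
      by_contra hB
      apply hQ
      refine ⟨B.image (fun x => x⁻¹), fun g => ?_⟩
      by_contra hg
      apply hB
      refine ⟨g, fun b hb => ?_⟩
      by_contra hc
      apply hg
      refine ⟨b⁻¹, Finset.mem_image_of_mem _ hb, fun a ha haS => hc ?_⟩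
      refine ⟨a⁻¹, Finset.mem_image_of_mem _ ha, ?_⟩
      simpa using haS
    obtain ⟨x, hx, hx'⟩ := h _ hT
    exact hx' hx
end

section
/- Let G be a group and S ⊂ G a right thick subset of G. Then (1) for any finite-index subgroup H of G, S ∩ H is right thick in H; and (2) for any g ∈ G and any finite-index subgroup H of G, gSg⁻¹ ∩ H is right thick in H. -/
/-- `S` is right thick in `G`: for every finite `A ⊆ G` there is `g` with `A * g ⊆ S`. -/
def RightThick {G : Type*} [Group G] (S : Set G) : Prop :=
  ∀ A : Finset G, ∃ g : G, ∀ a ∈ A, a * g ∈ S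

/-- `T` is right thick in the subgroup `H`: for every finite `A ⊆ H` there is `h ∈ H`
with `A * h ⊆ T`. -/
def RightThickIn {G : Type*} [Group G] (H : Subgroup G) (T : Set G) : Prop :=
  ∀ A : Finset G, ↑A ⊆ (H : Set G) → ∃ h ∈ H, ∀ a ∈ A, a * h ∈ T

theorem stmt9_aux {G : Type*} [Group G] (S : Set G) (hS : RightThick S)
    (H : Subgroup G) (hH : H.FiniteIndex) : RightThickIn H (S ∩ H) := by
  classical
  intro A hA
  haveI : Fintype (G ⧸ H) := Fintype.ofFinite _
  obtain ⟨g, hg⟩ := hS ((A ×ˢ (Finset.univ : Finset (G ⧸ H))).image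
    (fun p => p.1 * (Quotient.out p.2)⁻¹))
  have hmem : (Quotient.out (g : G ⧸ H))⁻¹ * g ∈ H := by
    rw [← QuotientGroup.eq]
    exact Quotient.out_eq _
  refine ⟨_, hmem, fun a ha => ⟨?_, H.mul_mem (hA ha) hmem⟩⟩
  rw [← mul_assoc]
  exact hg _ (Finset.mem_image.2 ⟨(a, (g : G ⧸ H)), by simp [ha], rfl⟩)

/-- If `S` is right thick in `G`, then (1) for every finite-index subgroup `H ≤ G`,
`S ∩ H` is right thick in `H`; and (2) for every `g ∈ G` and finite-index `H ≤ G`,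
`gSg⁻¹ ∩ H` is right thick in `H`. -/
theorem stmt9 {G : Type*} [Group G] (S : Set G) (hS : RightThick S) :
    (∀ H : Subgroup G, H.FiniteIndex → RightThickIn H (S ∩ H)) ∧
      (∀ (g : G) (H : Subgroup G), H.FiniteIndex →
        RightThickIn H ({x : G | ∃ s ∈ S, x = g * s * g⁻¹} ∩ H)) := by
  classical
  refine ⟨stmt9_aux S hS, fun g H hH => stmt9_aux _ ?_ H hH⟩
  intro A
  obtain ⟨k, hk⟩ := hS (A.image (fun a => g⁻¹ * a * g))
  refine ⟨g * k * g⁻¹, fun a ha => ⟨_, hk _ (Finset.mem_image_of_mem _ ha), ?_⟩⟩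
  group
end

section
/- Let G be a group, A and B finite subsets of G, and n ∈ ℕ. If |B| ≥ n(|A|² + 1), then there are elements b₁, …, bₙ ∈ B such that the translates Ab₁, …, Abₙ are mutually disjoint. -/
/-- Let `G` be a group, `A, B` finite subsets of `G` and `n ∈ ℕ`. If
`|B| ≥ n * (|A|² + 1)`, then there are `n` distinct elements `b₁, …, bₙ ∈ B` such that the
right translates `A * b₁, …, A * bₙ` are mutually disjoint. -/
theorem stmt10 {G : Type*} [Group G] (A B : Finset G) (n : ℕ)
    (h : n * (A.card ^ 2 + 1) ≤ B.card) :
    ∃ C : Finset G, C ⊆ B ∧ C.card = n ∧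
      ∀ b ∈ C, ∀ b' ∈ C, b ≠ b' →
        ((fun a => a * b) '' (A : Set G)) ∩ ((fun a => a * b') '' (A : Set G)) = ∅ := by
  classical
  induction n with
  | zero => exact ⟨∅, by simp, by simp, by simp⟩
  | succ n ih =>
    obtain ⟨C, hCB, hC, hd⟩ := ih (le_trans (Nat.mul_le_mul_right _ (Nat.le_succ n)) h)
    have hlt : (C ∪ (A ×ˢ A ×ˢ C).image (fun p => p.1⁻¹ * p.2.1 * p.2.2)).card < B.card := by
      have h1 := Finset.card_union_le C ((A ×ˢ A ×ˢ C).image (fun p => p.1⁻¹ * p.2.1 * p.2.2))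
      have h2 : ((A ×ˢ A ×ˢ C).image (fun p => p.1⁻¹ * p.2.1 * p.2.2)).card ≤ _ :=
        Finset.card_image_le
      rw [Finset.card_product, Finset.card_product, hC] at h2
      rw [hC] at h1
      nlinarith
    obtain ⟨b, hb, hbn⟩ := Finset.exists_mem_notMem_of_card_lt_card hlt
    rw [Finset.mem_union, not_or] at hbn
    obtain ⟨hbC, hbI⟩ := hbn
    have key : ∀ c ∈ C, ∀ a ∈ A, ∀ a' ∈ A, a * b ≠ a' * c := by
      intro c hc a ha a' ha' he
      apply hbI
      rw [Finset.mem_image]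
      refine ⟨(a, a', c), by simp [ha, ha', hc], ?_⟩
      simp only
      rw [mul_assoc, ← he, inv_mul_cancel_left]
    refine ⟨insert b C, Finset.insert_subset hb hCB, ?_, ?_⟩
    · rw [Finset.card_insert_of_notMem hbC, hC]
    · intro x hx y hy hxy
      rw [Finset.mem_insert] at hx hy
      rcases hx with rfl | hx <;> rcases hy with rfl | hy
      · exact absurd rfl hxy
      · rw [Set.eq_empty_iff_forall_notMem]
        rintro z ⟨⟨a, ha, rfl⟩, ⟨a', ha', he⟩⟩
        exact key y hy a ha a' ha' he.symm
      · rw [Set.eq_empty_iff_forall_notMem]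
        rintro z ⟨⟨a, ha, rfl⟩, ⟨a', ha', he⟩⟩
        exact key x hx a' ha' a ha he
      · exact hd x hx y hy hxy
end

section
/- Let G be an infinite discrete group and A ⊂ G a right syndetic subset. Then for any finite subset F ⊂ G there is a right syndetic subset B ⊂ A such that for any distinct b, b' ∈ B ∪ {e_G}, Fb ∩ Fb' = ∅. -/
/-- Let `G` be an infinite discrete group and `A ⊆ G` right syndetic. Then for every
finite `F ⊆ G` there is a right syndetic `B ⊆ A` such that for all distinct
`b, b' ∈ B ∪ {e}`, the translates `F * b` and `F * b'` are disjoint. -/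
theorem stmt11 {G : Type*} [Group G] [Infinite G] (A : Set G) (hA : RightSyndetic A)
    (F : Finset G) :
    ∃ B : Set G, B ⊆ A ∧ RightSyndetic B ∧
      ∀ b ∈ insert (1 : G) B, ∀ b' ∈ insert (1 : G) B, b ≠ b' →
        ((fun f => f * b) '' (F : Set G)) ∩ ((fun f => f * b') '' (F : Set G)) = ∅ := by
  classical
  obtain ⟨K, hK⟩ := hA
  let D : Finset G := insert 1 ((F ×ˢ F).image (fun p => p.1⁻¹ * p.2))
  have hD1 : (1 : G) ∈ D := Finset.mem_insert_self _ _
  have hDF : ∀ f ∈ F, ∀ f' ∈ F, f⁻¹ * f' ∈ D := fun f hf f' hf' =>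
    Finset.mem_insert_of_mem (Finset.mem_image.2 ⟨(f, f'), by simp [hf, hf'], rfl⟩)
  have hDinv : ∀ d ∈ D, d⁻¹ ∈ D := by
    intro d hd
    rcases Finset.mem_insert.1 hd with rfl | h
    · simpa using hD1
    · obtain ⟨⟨f, f'⟩, hp, rfl⟩ := Finset.mem_image.1 h
      have := Finset.mem_product.1 hp
      simpa using hDF f' this.2 f this.1
  obtain ⟨B, hB⟩ := zorn_subset
    {B : Set G | B ⊆ A \ (D : Set G) ∧ B.Pairwise (fun b b' => b * b'⁻¹ ∉ D)} (by
      intro c hc hch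
      refine ⟨⋃₀ c, ⟨Set.sUnion_subset fun s hs => (hc hs).1, ?_⟩,
        fun s hs => Set.subset_sUnion_of_mem hs⟩
      exact (Set.pairwise_sUnion hch.directedOn).2 fun s hs => (hc hs).2)
  obtain ⟨⟨hBA, hBp⟩, hmax⟩ := hB
  have hcov : ∀ a ∈ A, a ∉ D → ∃ d ∈ D, d⁻¹ * a ∈ B := by
    intro a ha haD
    by_contra! hno
    have haB : a ∉ B := fun h => hno 1 hD1 (by simpa using h)
    have h1 : ∀ b ∈ B, a * b⁻¹ ∉ D := fun b hb hd => hno _ hd (by simpa using hb)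
    have := hmax (y := insert a B) ⟨Set.insert_subset ⟨ha, by simpa using haD⟩ hBA, by
      refine hBp.insert fun b hb _ => ⟨h1 b hb, fun hd => h1 b hb ?_⟩
      simpa using hDinv _ hd⟩ (Set.subset_insert _ _)
    exact haB (this (Set.mem_insert _ _))
  refine ⟨B, fun b hb => (hBA hb).1, ?_, ?_⟩
  · obtain ⟨a, haA, haD⟩ : ∃ a ∈ A, a ∉ D := by
      obtain ⟨g, hg⟩ := Infinite.exists_notMem_finset ((K ×ˢ D).image (fun p => p.1 * p.2))
      obtain ⟨k, hk, hkA⟩ := hK g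
      refine ⟨_, hkA, fun h => hg ?_⟩
      exact Finset.mem_image.2 ⟨(k, k⁻¹ * g), Finset.mem_product.2 ⟨hk, h⟩, by simp⟩
    obtain ⟨d0, -, hb0⟩ := hcov a haA haD
    set b0 := d0⁻¹ * a
    refine ⟨(K ×ˢ D).image (fun p => p.1 * p.2) ∪
      (K ×ˢ D).image (fun p => p.1 * p.2 * b0⁻¹), fun g => ?_⟩
    obtain ⟨k, hk, hkA⟩ := hK g
    by_cases h : k⁻¹ * g ∈ D
    · refine ⟨k * (k⁻¹ * g) * b0⁻¹, Finset.mem_union_right _ (Finset.mem_image.2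
        ⟨(k, k⁻¹ * g), Finset.mem_product.2 ⟨hk, h⟩, rfl⟩), ?_⟩
      simpa using hb0
    · obtain ⟨d, hd, hdB⟩ := hcov _ hkA h
      refine ⟨k * d, Finset.mem_union_left _ (Finset.mem_image.2
        ⟨(k, d), Finset.mem_product.2 ⟨hk, hd⟩, rfl⟩), ?_⟩
      simpa [mul_assoc] using hdB
  · intro b hb b' hb' hne
    have key : b * b'⁻¹ ∉ D := by
      rcases hb with rfl | hb <;> rcases hb' with rfl | hb'
      · exact absurd rfl hne
      · intro h
        exact (hBA hb').2 (by simpa using hDinv _ h)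
      · intro h
        exact (hBA hb).2 (by simpa using h)
      · exact hBp hb hb' hne
    rw [Set.eq_empty_iff_forall_notMem]
    rintro x ⟨⟨f, hf, rfl⟩, ⟨f', hf', h⟩⟩
    apply key
    have h' : f' * b' = f * b := h
    have : b * b'⁻¹ = f⁻¹ * f' := by
      rw [mul_inv_eq_iff_eq_mul, mul_assoc, h']
      simp
    rw [this]
    exact hDF f hf f' hf'
end

section
/- Let G be a discrete group and (X,G) an ∞-transitive G-system. Then for every x ∈ X, the proximal cell Prox_G(x) is a residual subset of X (it contains a dense G_δ set). -/
/-- Let `G` be a discrete group and `(X,G)` an ∞-transitive `G`-system. Then for every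
`x ∈ X`, the proximal cell `Prox_G(x)` is residual in `X`: it contains a dense Gδ set. -/
theorem stmt14 (G : Type) [Group G]
    (X : Type) [MetricSpace X] [CompactSpace X] [MulAction G X] [ContinuousConstSMul G X]
    (h : InftyTransitive G X) (x : X) :
    ∃ s : Set X, s ⊆ {y : X | Proximal G x y} ∧ IsGδ s ∧ Dense s := by
  classical
  refine ⟨⋂ n : ℕ, ⋃ g : G, {y : X | dist (g • x) (g • y) < 1 / ((n : ℝ) + 1)}, ?_, ?_, ?_⟩
  · intro y hy ε hε
    obtain ⟨n, hn⟩ := exists_nat_one_div_lt hε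
    have h1 := Set.mem_iInter.1 hy n
    obtain ⟨g, hg⟩ := Set.mem_iUnion.1 h1
    exact ⟨g, lt_trans hg hn⟩
  · refine IsGδ.iInter_of_isOpen fun n => isOpen_iUnion fun g => ?_
    exact isOpen_lt (continuous_const.dist (continuous_const_smul g)) continuous_const
  · refine dense_iInter_of_isOpen_nat (fun n => isOpen_iUnion fun g => ?_) (fun n => ?_)
    · exact isOpen_lt (continuous_const.dist (continuous_const_smul g)) continuous_const
    · rw [dense_iff_inter_open]
      intro U hU hUne
      set ε : ℝ := 1 / ((n : ℝ) + 1) with hε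
      have hpos : 0 < ε := by positivity
      obtain ⟨t, -, htf, ht⟩ := finite_cover_balls_of_compact (isCompact_univ (X := X))
        (half_pos hpos)
      have hcov : ∀ z : X, ∃ c ∈ t, dist z c < ε / 2 := by
        intro z
        simpa using ht (Set.mem_univ z)
      obtain ⟨k, f, hf⟩ : ∃ (k : ℕ) (f : Fin k → X), Set.range f = t := by
        have := htf.fintype
        exact ⟨Fintype.card t, fun i => ((Fintype.equivFin t).symm i : X), by
          rw [← Function.comp_def, Set.range_comp, (Fintype.equivFin t).symm.surjective.range_eq]
          simp⟩
      have hk : 0 < k := by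
        obtain ⟨c, hc, -⟩ := hcov x
        rw [← hf] at hc
        obtain ⟨i, -⟩ := hc
        exact i.pos
      obtain ⟨u, hu⟩ := hUne
      obtain ⟨g, w, ⟨v, hv, rfl⟩, hw⟩ := h k hk (Set.univ.pi fun _ => U)
        (Set.univ.pi fun i => Metric.ball (f i) (ε / 2))
        (isOpen_set_pi Set.finite_univ fun _ _ => hU)
        (isOpen_set_pi Set.finite_univ fun _ _ => Metric.isOpen_ball)
        ⟨fun _ => u, fun _ _ => hu⟩
        ⟨f, fun i _ => Metric.mem_ball_self (half_pos hpos)⟩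
      obtain ⟨c, hc, hd⟩ := hcov (g • x)
      rw [← hf] at hc
      obtain ⟨i, rfl⟩ := hc
      refine ⟨v i, hv i trivial, Set.mem_iUnion.2 ⟨g, ?_⟩⟩
      have h2 : dist (g • v i) (f i) < ε / 2 := hw i trivial
      have h3 := dist_triangle_right (g • x) (g • v i) (f i)
      show dist (g • x) (g • v i) < ε
      linarith
end

section
/- Let G be a countable discrete group, (X,G) and (Y,G) G-systems with (Y,G) minimal, and J a joining of (X,G) and (Y,G). Then for any nonempty open set V ⊂ Y, the set {x ∈ X : there exists y ∈ V with (x,y) ∈ J} has nonempty interior in X. -/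
/-- Let `G` be a countable discrete group, `(X,G)` and `(Y,G)` `G`-systems with `(Y,G)`
minimal, and `J` a joining of `(X,G)` and `(Y,G)`. Then for every nonempty open `V ⊆ Y`,
the set `{x ∈ X : ∃ y ∈ V, (x,y) ∈ J}` has nonempty interior. -/
theorem stmt16 (G : Type) [Group G] [Countable G]
    (X Y : Type)
    [TopologicalSpace X] [CompactSpace X] [TopologicalSpace.MetrizableSpace X]
    [MulAction G X] [ContinuousConstSMul G X]
    [TopologicalSpace Y] [CompactSpace Y] [TopologicalSpace.MetrizableSpace Y]
    [MulAction G Y] [ContinuousConstSMul G Y]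
    (hmin : ∀ y : Y, Dense (MulAction.orbit G y))
    (J : Set (X × Y)) (hJ : IsJoining G J)
    (V : Set Y) (hV : IsOpen V) (hVne : V.Nonempty) :
    (interior {x : X | ∃ y ∈ V, (x, y) ∈ J}).Nonempty := by
  obtain ⟨⟨p, hp⟩, hcl, hinv, hfst, -⟩ := hJ
  obtain ⟨v, hv⟩ := hVne
  obtain ⟨K, hK, hKc, hKV⟩ := exists_mem_nhds_isClosed_subset (hV.mem_nhds hv)
  set A : Set X := Prod.fst '' (J ∩ Prod.snd ⁻¹' K) with hA
  have hAc : IsClosed A :=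
    (((hcl.inter (hKc.preimage continuous_snd)).isCompact).image continuous_fst).isClosed
  have hAV : A ⊆ {x : X | ∃ y ∈ V, (x, y) ∈ J} := by
    rintro _ ⟨⟨x, y⟩, ⟨h1, h2⟩, rfl⟩
    exact ⟨y, hKV h2, h1⟩
  haveI : Nonempty X := ⟨p.1⟩
  have hU : ⋃ g : G, (fun x : X => g • x) ⁻¹' A = Set.univ := by
    refine Set.eq_univ_of_forall fun x => ?_
    have hx : x ∈ Prod.fst '' J := hfst ▸ Set.mem_univ x
    obtain ⟨⟨x', y⟩, hxy, rfl⟩ := hx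
    obtain ⟨z, hz, g, rfl⟩ := (hmin y).inter_open_nonempty (interior K) isOpen_interior
      ⟨v, mem_interior_iff_mem_nhds.2 hK⟩
    exact Set.mem_iUnion.2 ⟨g, (g • x', g • y), ⟨hinv g _ hxy, (interior_subset (s := K) hz : g • y ∈ K)⟩, rfl⟩
  obtain ⟨g, x, hx⟩ := nonempty_interior_of_iUnion_of_closed
    (fun g : G => hAc.preimage (continuous_const_smul g)) hU
  refine ⟨g • x, interior_mono hAV ?_⟩
  have h := (Homeomorph.smul (α := X) g).preimage_interior A
  have hx' : x ∈ (Homeomorph.smul (α := X) g) ⁻¹' interior A := by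
    rw [h]; exact hx
  exact hx'
end
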